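/- (Global Hölder regularity of the optimal transport map.) Let U₁ and U₂ be bounded open convex subsets of ℝ² of Lebesgue area 1, and let ψ be a potential of the optimal transport between U₁ and U₂. Then for every α ∈ (0,1) there is a constant C, depending only on α and the diameters of U₁ and U₂, such that ‖∇ψ(x) − ∇ψ(y)‖ ≤ C‖x − y‖^α for all x, y in the closure of U₁ (where ∇ψ denotes the continuous extension of the gradient of ψ to the closure of U₁). -/

import Mathlib

noncomputable section

open MeasureTheory Metric Set
open scoped RealInnerProductSpace

abbrev R2 : Type := EuclideanSpace ℝ (Fin 2)

/-- `p` is a subgradient of `f` at `x`. -/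
def SubgradAt (f : R2 → ℝ) (x p : R2) : Prop :=
  ∀ y : R2, f x + ⟪p, y - x⟫ ≤ f y

/-- `ψ` is a (canonically extended) potential of the optimal transport between `U₁` and `U₂`:
it is convex on `ℝ²`, all its subgradients lie in `closure U₂`, and its gradient map pushes
the Lebesgue measure restricted to `U₁` forward to the Lebesgue measure restricted to `U₂`. -/
def IsOTPotential (U₁ U₂ : Set R2) (ψ : R2 → ℝ) : Prop :=
  ConvexOn ℝ Set.univ ψ ∧
  (∀ x p : R2, SubgradAt ψ x p → p ∈ closure U₂) ∧
  MeasureTheory.Measure.map (fun x => gradient ψ x) (MeasureTheory.volume.restrict U₁) =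
    MeasureTheory.volume.restrict U₂

/-- `S` is a centred section of `w` at `x₀` of height `h`:
`S = {w < w x₀ + p · (· - x₀) + h}` for a slope `p` chosen so that
the centre of mass of `S` is `x₀`. -/
def IsCentredSection (w : R2 → ℝ) (x₀ : R2) (h : ℝ) (S : Set R2) : Prop :=
  ∃ p : R2, S = {x : R2 | w x < w x₀ + ⟪p, x - x₀⟫ + h} ∧
    (∫ x in S, (x - x₀) ∂(MeasureTheory.volume)) = 0

/-- Dilation of `S` about `x₀` by factor `t`. -/
def dilate (x₀ : R2) (t : ℝ) (S : Set R2) : Set R2 :=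
  (fun x => x₀ + t • (x - x₀)) '' S

/-- The (closed) ellipse centred at `0` with half-axis `A` in unit direction `e` and
half-axis `B` in the orthogonal unit direction `f`. -/
def ellipse (e f : R2) (A B : ℝ) : Set R2 :=
  {x : R2 | (⟪x, e⟫ / A) ^ 2 + (⟪x, f⟫ / B) ^ 2 ≤ 1}

/-- `w` is an Alexandrov solution of `det D² w = χ_Ω` in `ℝ²`: the Lebesgue measure of the
subdifferential image of any Borel set `E` equals the Lebesgue measure of `E ∩ Ω`. -/
def AlexandrovSol (w : R2 → ℝ) (Ω : Set R2) : Prop :=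
  ∀ E : Set R2, MeasurableSet E →
    MeasureTheory.volume (⋃ x ∈ E, {p : R2 | SubgradAt w x p}) =
      MeasureTheory.volume (E ∩ Ω)

/-- Membership of the pair `(u, v)` in the normalized family `S(δ̄)`, together with the
associated data: the domains `Ω₁, Ω₂`, and, for each height `h ∈ (0,1]`, the ellipse
`E_h = ellipse (e h) (f h) (L h) (l h)` centred at `0` (long half-axis `L h` in unit
direction `e h`, short half-axis `l h` in the orthogonal unit direction `f h`, area `hπ`,
so `L h * l h = h`), whose perpendicular ellipse is
`E_h^⊥ = ellipse (f h) (e h) (L h) (l h)`.  The eccentricity is `η_u(h) = L h / l h`. -/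
def InSFamily (δb : ℝ) (u v : R2 → ℝ) (Ω₁ Ω₂ : Set R2)
    (L l : ℝ → ℝ) (e f : ℝ → R2) : Prop :=
  ConvexOn ℝ Set.univ u ∧ ConvexOn ℝ Set.univ v ∧
  Convex ℝ Ω₁ ∧ Convex ℝ Ω₂ ∧
  (interior Ω₁).Nonempty ∧ (interior Ω₂).Nonempty ∧
  (0 : R2) ∈ frontier Ω₁ ∧ (0 : R2) ∈ frontier Ω₂ ∧
  (fun x => gradient u x) '' Ω₁ = Ω₂ ∧ (fun y => gradient v y) '' Ω₂ = Ω₁ ∧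
  AlexandrovSol u Ω₁ ∧ u 0 = 0 ∧ SubgradAt u 0 0 ∧
  AlexandrovSol v Ω₂ ∧ v 0 = 0 ∧ SubgradAt v 0 0 ∧
  (∀ y ∈ Ω₂, v y = ⨆ x : R2, (⟪x, y⟫ - u x)) ∧
  L 1 = 1 ∧ l 1 = 1 ∧
  (∀ h : ℝ, h ∈ Set.Ioc (0 : ℝ) 1 →
    ‖e h‖ = 1 ∧ ‖f h‖ = 1 ∧ ⟪e h, f h⟫ = 0 ∧
    0 < l h ∧ l h ≤ L h ∧ L h * l h = h ∧
    (∃ S : Set R2, IsCentredSection u 0 h S ∧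
      (∃ xh : R2, (fun z => xh + δb • z) '' ellipse (e h) (f h) (L h) (l h) ⊆ Ω₁ ∩ S) ∧
      S ⊆ (fun z => δb⁻¹ • z) '' ellipse (e h) (f h) (L h) (l h)) ∧
    (∃ S : Set R2, IsCentredSection v 0 h S ∧
      (∃ yh : R2, (fun z => yh + δb • z) '' ellipse (f h) (e h) (L h) (l h) ⊆ Ω₂ ∩ S) ∧
      S ⊆ (fun z => δb⁻¹ • z) '' ellipse (f h) (e h) (L h) (l h)))

/-- `z ↦ t • x` cone over `Ω` with vertex `0` (closed): the tangent cone of `Ω` at `0`. -/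
def tangentConeZero (Ω : Set R2) : Set R2 :=
  closure {y : R2 | ∃ t : ℝ, 0 ≤ t ∧ ∃ x ∈ Ω, y = t • x}

/-- The planar cross product (determinant) of two vectors. -/
def det2 (a b : R2) : ℝ := a 0 * b 1 - a 1 * b 0

/-- `r` is the unit direction of the right tangent ray of `∂Ω` at `0`:
it lies in the tangent cone of `Ω` at `0` and the whole tangent cone lies
(weakly) counterclockwise from it. -/
def IsRightTangent (Ω : Set R2) (r : R2) : Prop :=
  ‖r‖ = 1 ∧ r ∈ tangentConeZero Ω ∧ ∀ x ∈ tangentConeZero Ω, 0 ≤ det2 r x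

/-- `l` is the unit direction of the left tangent ray of `∂Ω` at `0`:
it lies in the tangent cone of `Ω` at `0` and the whole tangent cone lies
(weakly) clockwise from it. -/
def IsLeftTangent (Ω : Set R2) (l : R2) : Prop :=
  ‖l‖ = 1 ∧ l ∈ tangentConeZero Ω ∧ ∀ x ∈ tangentConeZero Ω, det2 l x ≤ 0

/-- The open cone of direction `e` and opening angle `θ`. -/
def cone2 (e : R2) (θ : ℝ) : Set R2 :=
  {y : R2 | ∃ lam : ℝ, 0 < lam ∧ ∃ w : R2, ‖w‖ = 1 ∧
    InnerProductGeometry.angle w e < θ ∧ y = lam • w}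

open scoped ComplexConjugate

/-! ### Harnack inequalities -/

lemma harnack_strict {f : ℂ → ℂ} {c z : ℂ} {r : ℝ} (hf : DifferentiableOn ℂ f (ball c r))
    (hre : ∀ z ∈ ball c r, 0 < (f z).re) (hr : 0 < r) (hz : dist z c ≤ r / 2) :
    ‖f z‖ ≤ 3 * ‖f c‖ ∧ ‖f c‖ ≤ 3 * ‖f z‖ := by
  have hc : c ∈ ball c r := mem_ball_self hr
  have hzb : z ∈ ball c r := by rw [mem_ball]; linarith
  have hden : ∀ z ∈ ball c r, f z + conj (f c) ≠ 0 := by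
    intro z hz h
    have := congrArg Complex.re h
    simp at this
    linarith [hre z hz, hre c hc]
  set m : ℂ → ℂ := fun z => (f z - f c) / (f z + conj (f c)) with hm
  have hmd : DifferentiableOn ℂ m (ball c r) :=
    (hf.sub_const _).div (hf.add_const _) hden
  have hm0 : m c = 0 := by simp [hm]
  have hmaps : MapsTo m (ball c r) (closedBall (m c) 1) := by
    intro z hz
    rw [hm0, mem_closedBall_zero_iff, hm]
    simp only [norm_div]
    apply div_le_one_of_le₀ _ (norm_nonneg _)
    rw [← sq_le_sq₀ (norm_nonneg _) (norm_nonneg _), Complex.sq_norm, Complex.sq_norm,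
      Complex.normSq_apply, Complex.normSq_apply]
    simp
    nlinarith [mul_pos (hre z hz) (hre c hc)]
  have h1 := Complex.dist_le_div_mul_dist_of_mapsTo_ball hmd hmaps hzb
  rw [hm0, dist_zero_right] at h1
  have h2 : ‖m z‖ ≤ 1 / 2 := by
    refine h1.trans ?_
    rw [div_mul_eq_mul_div, one_mul, div_le_iff₀ hr]; linarith
  simp only [hm, norm_div] at h2
  rw [div_le_iff₀ (norm_pos_iff.2 (hden z hzb))] at h2
  have h3 : ‖f z + conj (f c)‖ ≤ ‖f z‖ + ‖f c‖ := by
    refine (norm_add_le _ _).trans ?_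
    simp
  have h4 := norm_sub_norm_le (f z) (f c)
  have h5 := norm_sub_norm_le (f c) (f z)
  rw [norm_sub_rev] at h5
  constructor <;> linarith

lemma harnack_ball {f : ℂ → ℂ} {c z : ℂ} {r : ℝ} (hf : DifferentiableOn ℂ f (ball c r))
    (hre : ∀ z ∈ ball c r, 0 ≤ (f z).re) (hr : 0 < r) (hz : dist z c ≤ r / 2) :
    ‖f z‖ ≤ 3 * ‖f c‖ ∧ ‖f c‖ ≤ 3 * ‖f z‖ := by
  have key : ∀ η : ℝ, 0 < η → ‖f z‖ ≤ 3 * ‖f c‖ + 4 * η ∧ ‖f c‖ ≤ 3 * ‖f z‖ + 4 * η := by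
    intro η hη
    have := harnack_strict (f := fun z => f z + (η : ℂ)) (hf.add_const _)
      (fun z hz => by simpa using add_pos_of_nonneg_of_pos (hre z hz) hη) hr hz
    have e1 : ∀ a : ℂ, ‖a + (η : ℂ)‖ ≤ ‖a‖ + η := fun a => by
      refine (norm_add_le _ _).trans ?_
      simp [abs_of_pos hη]
    have e2 : ∀ a : ℂ, ‖a‖ ≤ ‖a + (η : ℂ)‖ + η := fun a => by
      have := norm_sub_le (a + (η : ℂ)) (η : ℂ)
      simpa [abs_of_pos hη] using this
    constructor <;> linarith [e1 (f z), e1 (f c), e2 (f z), e2 (f c), this.1, this.2]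
  constructor
  · refine le_of_forall_pos_le_add fun η hη => ?_
    linarith [(key (η / 4) (by linarith)).1]
  · refine le_of_forall_pos_le_add fun η hη => ?_
    linarith [(key (η / 4) (by linarith)).2]

/-- `ν` satisfies the Harnack inequality on balls contained in `O`. -/
def Harnack (O : Set ℂ) (ν : ℂ → ℝ) : Prop :=
  ∀ c r, 0 < r → ball c r ⊆ O → ∀ z, dist z c ≤ r / 2 → ν z ≤ 3 * ν c ∧ ν c ≤ 3 * ν z

lemma harnack_norm {O : Set ℂ} {f : ℂ → ℂ} (hf : DifferentiableOn ℂ f O)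
    (hre : ∀ z ∈ O, 0 ≤ (f z).re) : Harnack O (fun z => ‖f z‖) :=
  fun _ _ hr hO _ hz => harnack_ball (hf.mono hO) (fun z hz => hre z (hO hz)) hr hz

lemma exists_unimodular (a : ℂ) : ∃ k : ℂ, ‖k‖ = 1 ∧ k * a = ‖a‖ := by
  by_cases h : a = 0
  · exact ⟨1, by simp, by simp [h]⟩
  · have h0 : (‖a‖ : ℂ) ≠ 0 := by simpa using h
    refine ⟨conj a / ‖a‖, by simp [h], ?_⟩
    rw [div_mul_eq_mul_div, Complex.conj_mul', sq, mul_div_assoc, div_self h0, mul_one]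

lemma harnack_one_sub_norm {O : Set ℂ} {g : ℂ → ℂ} (hg : DifferentiableOn ℂ g O)
    (hle : ∀ z ∈ O, ‖g z‖ ≤ 1) : Harnack O (fun z => 1 - ‖g z‖) := by
  intro c r hr hO z hz
  have main : ∀ a : ℂ, ∃ k : ℂ, ‖k‖ = 1 ∧ k * g a = ‖g a‖ := fun a => exists_unimodular _
  have hre : ∀ k : ℂ, ‖k‖ = 1 → ∀ z ∈ ball c r, 0 ≤ (1 - k * g z).re := by
    intro k hk z hz
    have := (Complex.re_le_norm (k * g z))
    rw [norm_mul, hk, one_mul] at this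
    simp only [Complex.sub_re, Complex.one_re]
    linarith [hle z (hO hz)]
  have lo : ∀ k : ℂ, ‖k‖ = 1 → ∀ z, 1 - ‖g z‖ ≤ ‖1 - k * g z‖ := by
    intro k hk z
    have := norm_sub_norm_le 1 (k * g z)
    simpa [hk] using this
  have eqn : ∀ k a, k * g a = ‖g a‖ → a ∈ O → ‖1 - k * g a‖ = 1 - ‖g a‖ := by
    intro k a h ha
    rw [h, ← Complex.ofReal_one, ← Complex.ofReal_sub, Complex.norm_real, Real.norm_eq_abs,
      abs_of_nonneg (by linarith [hle a ha])]
  have hcO : c ∈ O := hO (mem_ball_self hr)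
  have hzO : z ∈ O := hO (by rw [mem_ball]; linarith)
  have hd : ∀ k : ℂ, DifferentiableOn ℂ (fun z => 1 - k * g z) (ball c r) := fun k =>
    ((hg.mono hO).const_mul k).const_sub 1
  obtain ⟨k, hk, hkc⟩ := main c
  obtain ⟨l, hl, hlz⟩ := main z
  have A := (harnack_ball (hd k) (hre k hk) hr hz).1
  have B := (harnack_ball (hd l) (hre l hl) hr hz).2
  rw [eqn k c hkc hcO] at A
  rw [eqn l z hlz hzO] at B
  exact ⟨(lo k hk z).trans A, (lo l hl c).trans B⟩

/-- Harnack chains along a Lipschitz path. -/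
lemma Harnack.chain {O : Set ℂ} {ν : ℂ → ℝ} (h : Harnack O ν) {γ : ℝ → ℂ} {ρ L : ℝ} (hρ : 0 < ρ)
    (N : ℕ) : ∀ a b : ℝ, a ≤ b → (∀ t ∈ Icc a b, ball (γ t) ρ ⊆ O) →
    (∀ s ∈ Icc a b, ∀ t ∈ Icc a b, dist (γ s) (γ t) ≤ L * |s - t|) →
    L * (b - a) ≤ N * (ρ / 2) → 0 ≤ ν (γ a) → 0 ≤ ν (γ b) →
    ν (γ a) ≤ 3 ^ (N + 1) * ν (γ b) ∧ ν (γ b) ≤ 3 ^ (N + 1) * ν (γ a) := by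
  have step : ∀ a b : ℝ, ball (γ a) ρ ⊆ O → dist (γ b) (γ a) ≤ ρ / 2 →
      ν (γ b) ≤ 3 * ν (γ a) ∧ ν (γ a) ≤ 3 * ν (γ b) := fun a b h1 h2 => h _ _ hρ h1 _ h2
  induction N with
  | zero =>
    intro a b hab hball hlip hlen _ _
    have : dist (γ b) (γ a) ≤ ρ / 2 := by
      refine (hlip b ⟨hab, le_rfl⟩ a ⟨le_rfl, hab⟩).trans ?_
      rw [abs_of_nonneg (by linarith)]
      simp at hlen; linarith
    have := step a b (hball a ⟨le_rfl, hab⟩) this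
    simpa using this.symm
  | succ N ih =>
    intro a b hab hball hlip hlen ha hb
    set c := a + (b - a) / (N + 1) with hc
    have hN : (0 : ℝ) < N + 1 := by positivity
    have hac : a ≤ c := by
      have : 0 ≤ (b - a) / (N + 1) := div_nonneg (by linarith) hN.le
      linarith
    have hcb : c ≤ b := by
      have : (b - a) / (N + 1) ≤ b - a := div_le_self (by linarith) (by linarith [N.cast_nonneg (α := ℝ)])
      linarith
    have hd : dist (γ c) (γ a) ≤ ρ / 2 := by
      refine (hlip c ⟨hac, hcb⟩ a ⟨le_rfl, hab⟩).trans ?_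
      rw [abs_of_nonneg (by linarith), hc, add_sub_cancel_left, ← mul_div_assoc, div_le_iff₀ hN]
      push_cast at hlen
      linarith
    have h1 := step a c (hball a ⟨le_rfl, hab⟩) hd
    have hc0 : 0 ≤ ν (γ c) := by linarith
    have h2 := ih c b hcb (fun t ht => hball t ⟨hac.trans ht.1, ht.2⟩)
      (fun s hs t ht => hlip s ⟨hac.trans hs.1, hs.2⟩ t ⟨hac.trans ht.1, ht.2⟩) (by
        have e : b - c = (b - a) * N / (N + 1) := by rw [hc]; field_simp; ring
        rw [e, ← mul_div_assoc, div_le_iff₀ hN]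
        push_cast at hlen
        have : L * ((b - a) * N) = (L * (b - a)) * N := by ring
        rw [this]
        nlinarith [N.cast_nonneg (α := ℝ)]) hc0 hb
    have p3 : (0 : ℝ) ≤ 3 ^ (N + 1) := by positivity
    constructor
    · calc ν (γ a) ≤ 3 * ν (γ c) := h1.2
        _ ≤ 3 * (3 ^ (N + 1) * ν (γ b)) := by linarith [h2.1]
        _ = _ := by ring
    · calc ν (γ b) ≤ 3 ^ (N + 1) * ν (γ c) := h2.2
        _ ≤ 3 ^ (N + 1) * (3 * ν (γ a)) := mul_le_mul_of_nonneg_left h1.1 p3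
        _ = _ := by ring

/-- Level rays of a holomorphic function leave every bounded open set. -/
lemma exists_level_ray_exit {O : Set ℂ} (hO : IsOpen O) (hb : Bornology.IsBounded O) {F : ℂ → ℂ}
    (hF : DifferentiableOn ℂ F O) {z₀ : ℂ} (hz₀ : z₀ ∈ O) (him : (F z₀).im = 0) :
    ∃ q ∈ frontier O, q ∈ closure {z | z ∈ O ∧ (F z).im = 0 ∧ (F z).re ≤ (F z₀).re} := by
  set S : Set ℂ := {z | z ∈ O ∧ (F z).im = 0 ∧ (F z).re ≤ (F z₀).re} with hS
  by_contra! hcon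
  have hSO : S ⊆ O := fun z hz => hz.1
  have hcl : closure S ⊆ O := by
    intro z hz
    by_contra hzO
    refine hcon z ?_ hz
    rw [hO.frontier_eq]
    exact ⟨closure_mono hSO hz, hzO⟩
  have hSc : IsClosed S := by
    rw [← closure_subset_iff_isClosed]
    intro z hz
    have hzO := hcl hz
    have hc : ContinuousAt F z := (hF.differentiableAt (hO.mem_nhds hzO)).continuousAt
    have hne : (nhdsWithin z S).NeBot := mem_closure_iff_nhdsWithin_neBot.1 hz
    have hct : Filter.Tendsto F (nhdsWithin z S) (nhds (F z)) := hc.mono_left nhdsWithin_le_nhds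
    refine ⟨hzO, ?_, ?_⟩
    · have t1 := (Complex.continuous_im.tendsto _).comp hct
      refine tendsto_nhds_unique (t1.congr' ?_) tendsto_const_nhds
      filter_upwards [self_mem_nhdsWithin] with a ha using ha.2.1
    · have t1 := (Complex.continuous_re.tendsto _).comp hct
      refine le_of_tendsto t1 ?_
      filter_upwards [self_mem_nhdsWithin] with a ha using ha.2.2
  have hScomp : IsCompact S := isCompact_of_isClosed_isBounded hSc (hb.subset hSO)
  have hcont : ContinuousOn (fun z => (F z).re) S :=
    Complex.continuous_re.comp_continuousOn (hF.continuousOn.mono hSO)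
  obtain ⟨z₁, hz₁, hmin⟩ := hScomp.exists_isMinOn ⟨z₀, hz₀, him, le_rfl⟩ hcont
  set S' : Set ℂ := {z | z ∈ S ∧ (F z).re = (F z₁).re} with hS'
  have hS'c : IsCompact S' := by
    have : S' = S ∩ (fun z => (F z).re) ⁻¹' {(F z₁).re} := rfl
    rw [this]
    exact hScomp.of_isClosed_subset (hcont.preimage_isClosed_of_isClosed hSc isClosed_singleton)
      inter_subset_left
  obtain ⟨z₂, hz₂, hmax⟩ := hS'c.exists_isMaxOn ⟨z₁, hz₁, rfl⟩ Complex.continuous_re.continuousOn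
  have han : AnalyticAt ℂ F z₂ := hF.analyticAt (hO.mem_nhds hz₂.1.1)
  rcases han.eventually_constant_or_nhds_le_map_nhds with h | h
  · have h' : ∀ᶠ t : ℝ in nhds 0, F (z₂ + t) = F z₂ ∧ z₂ + t ∈ O := by
      have : Filter.Tendsto (fun t : ℝ => z₂ + (t : ℂ)) (nhds 0) (nhds z₂) := by
        have : Continuous (fun t : ℝ => z₂ + (t : ℂ)) := by fun_prop
        simpa using this.tendsto 0
      exact this.eventually (h.and (hO.mem_nhds hz₂.1.1))
    obtain ⟨t, ht, ht'⟩ := ((h'.filter_mono nhdsWithin_le_nhds).and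
      (self_mem_nhdsWithin (s := Ioi (0:ℝ)))).exists
    have hm : z₂ + (t : ℂ) ∈ S' := by
      refine ⟨⟨ht.2, ?_, ?_⟩, ?_⟩
      · rw [ht.1]; exact hz₂.1.2.1
      · rw [ht.1]; exact hz₂.1.2.2
      · rw [ht.1]; exact hz₂.2
    have := hmax hm
    simp at this
    exact absurd ht' (not_lt.2 this)
  · have h1 : F '' O ∈ nhds (F z₂) := h (Filter.image_mem_map (hO.mem_nhds hz₂.1.1))
    have h' : ∀ᶠ t : ℝ in nhds 0, F z₂ - t ∈ F '' O := by
      have : Filter.Tendsto (fun t : ℝ => F z₂ - (t : ℂ)) (nhds 0) (nhds (F z₂)) := by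
        have : Continuous (fun t : ℝ => F z₂ - (t : ℂ)) := by fun_prop
        simpa using this.tendsto 0
      exact this.eventually h1
    obtain ⟨t, ⟨z, hzO, hz⟩, ht'⟩ := ((h'.filter_mono nhdsWithin_le_nhds).and
      (self_mem_nhdsWithin (s := Ioi (0:ℝ)))).exists
    have ht0 : (0:ℝ) < t := ht'
    have hre : (F z).re = (F z₂).re - t := by rw [hz]; simp
    have hm : z ∈ S := by
      refine ⟨hzO, ?_, ?_⟩
      · rw [hz]; simp [hz₂.1.2.1]
      · rw [hre]; linarith [hz₂.1.2.2]
    have := hmin hm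
    simp only [mem_ofPred_eq] at this
    linarith [hz₂.2]

/-! ### Complexified transport data -/

/-- The source point associated with a point of the Minty plane. -/
def srcPt (ω : ℂ → ℂ) (ζ : ℂ) : ℂ := (ζ + conj (ω ζ)) / 2

/-- The target point associated with a point of the Minty plane. -/
def tgtPt (ω : ℂ → ℂ) (ζ : ℂ) : ℂ := (ζ - conj (ω ζ)) / 2

/-- A holomorphic representation of a planar transport map between convex domains. -/
structure OTData (R d c : ℝ) (ω : ℂ → ℂ) (D V₁ V₂ : Set ℂ) (y : ℂ) : Prop where
  R_pos : 0 < R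
  R_le : R ≤ 1
  d_ge : 1 ≤ d
  c_pos : 0 < c
  lip : ∀ a b, ‖ω a - ω b‖ ≤ ‖a - b‖
  isOpen : IsOpen D
  preconn : IsPreconnected D
  bdd : ∀ ζ ∈ D, ‖ζ - y‖ ≤ d
  holo : DifferentiableOn ℂ ω D
  open₁ : IsOpen V₁
  open₂ : IsOpen V₂
  conv₁ : Convex ℝ V₁
  conv₂ : Convex ℝ V₂
  src_mem : ∀ ζ ∈ D, srcPt ω ζ ∈ V₁
  tgt_mem : ∀ ζ ∈ D, tgtPt ω ζ ∈ V₂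
  src_fr : ∀ ζ ∈ frontier D, srcPt ω ζ ∈ frontier V₁
  tgt_fr : ∀ ζ ∈ frontier D, tgtPt ω ζ ∈ frontier V₂
  y_mem : y ∈ D
  ball₁ : ball (srcPt ω y) R ⊆ V₁
  ball₂ : ball (tgtPt ω y) R ⊆ V₂
  deriv_le : ‖deriv ω y‖ ≤ 1 - c

lemma srcPt_re (ω : ℂ → ℂ) (a : ℂ) : (srcPt ω a).re = (a.re + (ω a).re) / 2 := by simp [srcPt]

lemma srcPt_im (ω : ℂ → ℂ) (a : ℂ) : (srcPt ω a).im = (a.im - (ω a).im) / 2 := by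
  simp [srcPt]; ring

lemma tgtPt_re (ω : ℂ → ℂ) (a : ℂ) : (tgtPt ω a).re = (a.re - (ω a).re) / 2 := by simp [tgtPt]

lemma tgtPt_im (ω : ℂ → ℂ) (a : ℂ) : (tgtPt ω a).im = (a.im + (ω a).im) / 2 := by simp [tgtPt]

lemma re_srcPt_mul_tgtPt (ω : ℂ → ℂ) (a b : ℂ) :
    ((srcPt ω a - srcPt ω b) * conj (tgtPt ω a - tgtPt ω b)).re =
      (‖a - b‖ ^ 2 - ‖ω a - ω b‖ ^ 2) / 4 := by
  rw [Complex.sq_norm, Complex.sq_norm, Complex.normSq_apply, Complex.normSq_apply]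
  simp only [Complex.mul_re, Complex.conj_re, Complex.conj_im, Complex.sub_re, Complex.sub_im,
    srcPt_re, srcPt_im, tgtPt_re, tgtPt_im]
  ring

lemma srcPt_add_tgtPt (ω : ℂ → ℂ) (a : ℂ) : srcPt ω a + tgtPt ω a = a := by
  simp only [srcPt, tgtPt]; ring

lemma subset_of_disjoint_frontier {X : Type*} [TopologicalSpace X] {S D : Set X}
    (hS : IsPreconnected S) (hD : IsOpen D)
    (hne : (S ∩ D).Nonempty) (hd : ∀ z ∈ S, z ∉ frontier D) : S ⊆ D := by
  refine hS.subset_of_closure_inter_subset hD hne ?_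
  rintro z ⟨hz, hzS⟩
  by_contra h
  exact hd z hzS (by rw [hD.frontier_eq]; exact ⟨hz, h⟩)

namespace OTData

variable {R d c : ℝ} {ω : ℂ → ℂ} {D V₁ V₂ : Set ℂ} {y : ℂ}

lemma src_lip (h : OTData R d c ω D V₁ V₂ y) (a b : ℂ) :
    ‖srcPt ω a - srcPt ω b‖ ≤ ‖a - b‖ := by
  have e : srcPt ω a - srcPt ω b = ((a - b) + conj (ω a - ω b)) / 2 := by
    simp [srcPt]; ring
  rw [e, norm_div]
  have := norm_add_le (a - b) (conj (ω a - ω b))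
  rw [RCLike.norm_conj] at this
  have h2 := h.lip a b
  simp only [Complex.norm_ofNat]
  linarith

lemma tgt_lip (h : OTData R d c ω D V₁ V₂ y) (a b : ℂ) :
    ‖tgtPt ω a - tgtPt ω b‖ ≤ ‖a - b‖ := by
  have e : tgtPt ω a - tgtPt ω b = ((a - b) - conj (ω a - ω b)) / 2 := by
    simp [tgtPt]; ring
  rw [e, norm_div]
  have := norm_sub_le (a - b) (conj (ω a - ω b))
  rw [RCLike.norm_conj] at this
  have h2 := h.lip a b
  simp only [Complex.norm_ofNat]
  linarith

lemma continuous (h : OTData R d c ω D V₁ V₂ y) : Continuous ω := by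
  refine (LipschitzWith.of_dist_le_mul (K := 1) fun a b => ?_).continuous
  simpa [dist_eq_norm] using h.lip a b

lemma continuous_src (h : OTData R d c ω D V₁ V₂ y) : Continuous (srcPt ω) := by
  have := h.continuous
  unfold srcPt; fun_prop

lemma continuous_tgt (h : OTData R d c ω D V₁ V₂ y) : Continuous (tgtPt ω) := by
  have := h.continuous
  unfold tgtPt; fun_prop

lemma norm_deriv_le (h : OTData R d c ω D V₁ V₂ y) (ζ : ℂ) : ‖deriv ω ζ‖ ≤ 1 := by
  have := norm_deriv_le_of_lip' (f := ω) (x₀ := ζ) (C := 1) zero_le_one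
    (Filter.Eventually.of_forall fun a => by simpa using h.lip a ζ)
  exact this

lemma src_notMem (h : OTData R d c ω D V₁ V₂ y) {q : ℂ} (hq : q ∈ frontier D) :
    srcPt ω q ∉ V₁ := by
  have := h.src_fr q hq
  rw [h.open₁.frontier_eq] at this
  exact this.2

lemma tgt_notMem (h : OTData R d c ω D V₁ V₂ y) {q : ℂ} (hq : q ∈ frontier D) :
    tgtPt ω q ∉ V₂ := by
  have := h.tgt_fr q hq
  rw [h.open₂.frontier_eq] at this
  exact this.2

lemma le_norm_src (h : OTData R d c ω D V₁ V₂ y) {q : ℂ} (hq : q ∈ frontier D) :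
    R ≤ ‖srcPt ω y - srcPt ω q‖ := by
  by_contra! hc
  refine h.src_notMem hq (h.ball₁ ?_)
  rwa [mem_ball, dist_comm, dist_eq_norm]

lemma le_norm_tgt (h : OTData R d c ω D V₁ V₂ y) {q : ℂ} (hq : q ∈ frontier D) :
    R ≤ ‖tgtPt ω y - tgtPt ω q‖ := by
  by_contra! hc
  refine h.tgt_notMem hq (h.ball₂ ?_)
  rwa [mem_ball, dist_comm, dist_eq_norm]

lemma ball_subset (h : OTData R d c ω D V₁ V₂ y) : ball y R ⊆ D := by
  refine subset_of_disjoint_frontier (convex_ball y R).isPreconnected h.isOpen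
    ⟨y, mem_ball_self h.R_pos, h.y_mem⟩ fun z hz hzf => ?_
  have h1 := (h.le_norm_src hzf).trans (h.src_lip y z)
  rw [mem_ball, dist_comm, dist_eq_norm] at hz
  linarith

lemma bdd_closure (h : OTData R d c ω D V₁ V₂ y) {q : ℂ} (hq : q ∈ closure D) :
    ‖q - y‖ ≤ d := by
  have : closure D ⊆ closedBall y d := closure_minimal (fun z hz => by
    rw [mem_closedBall, dist_eq_norm]; exact h.bdd z hz) isClosed_closedBall
  have := this hq
  rwa [mem_closedBall, dist_eq_norm] at this

lemma harnack_deriv (h : OTData R d c ω D V₁ V₂ y) : Harnack D (fun z => 1 - ‖deriv ω z‖) :=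
  harnack_one_sub_norm (h.holo.deriv h.isOpen) fun z _ => h.norm_deriv_le z

/-- A bound on the derivative at an interior point yields a strict contraction estimate. -/
lemma contract (h : OTData R d c ω D V₁ V₂ y) {ζ : ℂ} {r k : ℝ} (hr : 0 < r)
    (hb : ball ζ r ⊆ D) (hk : k ≤ 1 - ‖deriv ω ζ‖) (q : ℂ) :
    ‖ω q - ω ζ‖ ≤ ‖q - ζ‖ - k / 3 * min ‖q - ζ‖ (r / 2) := by
  have hin : ∀ q, ‖q - ζ‖ ≤ r / 2 → ‖ω q - ω ζ‖ ≤ (1 - k / 3) * ‖q - ζ‖ := by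
    intro q hq
    have hs : closedBall ζ (r / 2) ⊆ D := fun z hz => hb (by
      rw [mem_closedBall] at hz; rw [mem_ball]; linarith)
    refine (convex_closedBall ζ (r / 2)).norm_image_sub_le_of_norm_deriv_le (𝕜 := ℂ)
      (fun z hz => h.holo.differentiableAt (h.isOpen.mem_nhds (hs hz))) (fun z hz => ?_)
      (mem_closedBall_self (by linarith)) (by rwa [mem_closedBall, dist_eq_norm])
    have := (h.harnack_deriv ζ r hr hb z hz).2
    simp only at this
    linarith
  by_cases hq : ‖q - ζ‖ ≤ r / 2
  · rw [min_eq_left hq]; have := hin q hq; linarith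
  · push Not at hq
    rw [min_eq_right hq.le]
    set n := ‖q - ζ‖ with hn
    have hn0 : 0 < n := by linarith
    set m : ℂ := ζ + ((r / 2 / n : ℝ) : ℂ) * (q - ζ) with hm
    have e1 : ‖m - ζ‖ = r / 2 := by
      rw [hm, add_sub_cancel_left, norm_mul, Complex.norm_real, Real.norm_eq_abs, ← hn,
        abs_of_pos (by positivity)]
      field_simp
    have e2 : ‖q - m‖ = n - r / 2 := by
      have : q - m = ((1 - r / 2 / n : ℝ) : ℂ) * (q - ζ) := by rw [hm]; push_cast; ring
      rw [this, norm_mul, Complex.norm_real, Real.norm_eq_abs, ← hn, abs_of_nonneg]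
      · field_simp
      · rw [sub_nonneg, div_le_one hn0]; exact hq.le
    have h1 := hin m e1.le
    have h2 := h.lip q m
    have h3 : ‖ω q - ω ζ‖ ≤ ‖ω q - ω m‖ + ‖ω m - ω ζ‖ := norm_sub_le_norm_sub_add_norm_sub _ _ _
    rw [e1] at h1; rw [e2] at h2
    linarith

lemma contract_center (h : OTData R d c ω D V₁ V₂ y) {q : ℂ} (hq : q ∈ closure D) :
    ‖ω q - ω y‖ ≤ (1 - c * R / (6 * d)) * ‖q - y‖ := by
  have h1 := h.contract h.R_pos h.ball_subset (k := c) (by linarith [h.deriv_le]) q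
  have h2 := h.bdd_closure hq
  have hd : 0 < d := by linarith [h.d_ge]
  have hR := h.R_pos
  have hc := h.c_pos
  have h3 : R / (2 * d) * ‖q - y‖ ≤ min ‖q - y‖ (R / 2) := by
    apply le_min
    · refine mul_le_of_le_one_left (norm_nonneg _) ?_
      rw [div_le_one (by positivity)]
      linarith [h.R_le, h.d_ge]
    · calc R / (2 * d) * ‖q - y‖ ≤ R / (2 * d) * d := by gcongr
        _ = R / 2 := by field_simp
  have h4 : c / 3 * (R / (2 * d) * ‖q - y‖) ≤ c / 3 * min ‖q - y‖ (R / 2) := by gcongr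
  have e : c / 3 * (R / (2 * d) * ‖q - y‖) = c * R / (6 * d) * ‖q - y‖ := by field_simp; ring
  linarith

end OTData

/-! ### Argument computations -/

lemma cos_arg_nonneg {X P h₁ h₂ : ℂ} (hX : X ≠ 0) (hP : P ≠ 0) (hh₁ : h₁ ≠ 0) (hh₂ : h₂ ≠ 0)
    (h : 0 ≤ (X * conj P).re) :
    0 ≤ Real.cos ((X * conj h₁).arg - (P * conj h₂).arg + (h₁ * conj h₂).arg) := by
  have c1 : conj h₁ ≠ 0 := by simpa using hh₁
  have c2 : conj h₂ ≠ 0 := by simpa using hh₂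
  set a := X * conj h₁ with ha
  set b := P * conj h₂ with hb
  set e := h₁ * conj h₂ with he
  have a0 : a ≠ 0 := mul_ne_zero hX c1
  have b0 : b ≠ 0 := mul_ne_zero hP c2
  have e0 : e ≠ 0 := mul_ne_zero hh₁ c2
  rw [Real.cos_add, Real.cos_sub, Real.sin_sub, Complex.cos_arg a0, Complex.cos_arg b0,
    Complex.cos_arg e0, Complex.sin_arg, Complex.sin_arg, Complex.sin_arg]
  have key : (a * conj b * e).re = ‖h₁‖ ^ 2 * ‖h₂‖ ^ 2 * (X * conj P).re := by
    rw [Complex.sq_norm, Complex.sq_norm, Complex.normSq_apply, Complex.normSq_apply, ha, hb, he]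
    simp
    ring
  have e1 : (a.re / ‖a‖ * (b.re / ‖b‖) + a.im / ‖a‖ * (b.im / ‖b‖)) * (e.re / ‖e‖) -
      (a.im / ‖a‖ * (b.re / ‖b‖) - a.re / ‖a‖ * (b.im / ‖b‖)) * (e.im / ‖e‖) =
      (a * conj b * e).re / (‖a‖ * ‖b‖ * ‖e‖) := by
    have := norm_pos_iff.2 a0
    have := norm_pos_iff.2 b0
    have := norm_pos_iff.2 e0
    simp
    field_simp
    ring
  rw [e1, key]
  positivity

lemma re_mul_pos_of_arg {a e : ℂ} (a0 : a ≠ 0) (e0 : e ≠ 0)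
    (h : |a.arg + e.arg| < Real.pi / 2) : 0 < (a * e).re := by
  have h1 : 0 < Real.cos (a.arg + e.arg) :=
    Real.cos_pos_of_mem_Ioo ⟨by linarith [(abs_lt.1 h).1], (abs_lt.1 h).2⟩
  have ha := norm_pos_iff.2 a0
  have he := norm_pos_iff.2 e0
  rw [Real.cos_add, Complex.cos_arg a0, Complex.cos_arg e0, Complex.sin_arg, Complex.sin_arg] at h1
  have : a.re / ‖a‖ * (e.re / ‖e‖) - a.im / ‖a‖ * (e.im / ‖e‖) = (a * e).re / (‖a‖ * ‖e‖) := by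
    simp; field_simp
  rw [this] at h1
  exact (div_pos_iff_of_pos_right (by positivity)).1 h1

/-- A continuous function on a connected set with `cos χ ≥ 0` and `|χ| < 3π/2` at one point
stays in `[-π/2, π/2]`. -/
lemma abs_le_of_cos_nonneg {D : Set ℂ} (hD : IsPreconnected D) {χ : ℂ → ℝ}
    (hχ : ContinuousOn χ D) (hcos : ∀ z ∈ D, 0 ≤ Real.cos (χ z)) {y : ℂ} (hy : y ∈ D)
    (hχy : |χ y| < 3 * Real.pi / 2) : ∀ z ∈ D, |χ z| ≤ Real.pi / 2 := by
  have hord := (hD.image χ hχ).ordConnected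
  have pp := Real.pi_pos
  have hneg : ∀ t, Real.pi / 2 < |t| → |t| < 3 * Real.pi / 2 → t ∉ χ '' D := by
    rintro t h1 h2 ⟨z, hz, rfl⟩
    have := hcos z hz
    rw [← Real.cos_abs] at this
    have h3 := Real.cos_neg_of_pi_div_two_lt_of_lt h1 (by linarith)
    linarith
  have hy' : |χ y| ≤ Real.pi / 2 := by
    by_contra! hc
    exact hneg _ hc hχy ⟨y, hy, rfl⟩
  intro z hz
  by_contra! hc
  have h1 := abs_le.1 hy'
  rcases le_total 0 (χ z) with h0 | h0
  · rw [abs_of_nonneg h0] at hc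
    set t := min (χ z) Real.pi with ht
    have t1 : Real.pi / 2 < t := lt_min hc (by linarith)
    have t2 : t ≤ Real.pi := min_le_right _ _
    refine hneg t (by rw [abs_of_pos (by linarith)]; exact t1)
      (by rw [abs_of_pos (by linarith)]; linarith)
      (hord.out ⟨y, hy, rfl⟩ ⟨z, hz, rfl⟩ ⟨by linarith, min_le_left _ _⟩)
  · rw [abs_of_nonpos h0] at hc
    set t := max (χ z) (-Real.pi) with ht
    have t1 : t < -(Real.pi / 2) := max_lt (by linarith) (by linarith)
    have t2 : -Real.pi ≤ t := le_max_right _ _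
    refine hneg t (by rw [abs_of_neg (by linarith)]; linarith)
      (by rw [abs_of_neg (by linarith)]; linarith)
      (hord.out ⟨z, hz, rfl⟩ ⟨y, hy, rfl⟩ ⟨le_max_left _ _, by linarith⟩)

/-! ### Convex sets seen from a deep interior point -/

lemma cone_mem {V : Set ℂ} (hV : Convex ℝ V) (hVo : IsOpen V) {Y o q v : ℂ} {R s : ℝ}
    (hq : q ∈ closure V) (hY : ball Y R ⊆ V) (hqo : ‖q - o‖ < R / 2)
    (hv : ‖v - (Y - o)‖ < R / 2) (hs : 0 < s) (hs1 : s ≤ 1) : q + s * v ∈ V := by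
  have h1 : q + v ∈ V := hY (by
    rw [mem_ball, dist_eq_norm]
    have : q + v - Y = (q - o) + (v - (Y - o)) := by ring
    rw [this]
    exact (norm_add_le _ _).trans_lt (by linarith))
  rcases hs1.eq_or_lt with rfl | hs1
  · simpa using h1
  · have := hV.openSegment_closure_interior_subset_interior hq (by rwa [hVo.interior_eq])
      (⟨1 - s, s, by linarith, hs, by ring, rfl⟩ :
        (1 - s) • q + s • (q + v) ∈ openSegment ℝ q (q + v))
    rw [hVo.interior_eq] at this
    convert this using 1
    simp only [Complex.real_smul]; push_cast; ring

lemma mul_conj_mem_slitPlane {V : Set ℂ} (hV : Convex ℝ V) {Y o q a : ℂ} {R : ℝ} (hq : q ∉ V)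
    (ha : a ∈ V) (hY : ball Y R ⊆ V) (hqo : ‖q - o‖ < R) (hh : Y - o ≠ 0) :
    (a - q) * conj (Y - o) ∈ Complex.slitPlane := by
  set h := Y - o with hh'
  by_contra hc
  rw [Complex.mem_slitPlane_iff] at hc
  push Not at hc
  obtain ⟨hre, him⟩ := hc
  have hn : 0 < ‖h‖ ^ 2 := by positivity
  set k := -((a - q) * conj h).re / ‖h‖ ^ 2 with hk
  have hk0 : 0 ≤ k := div_nonneg (by linarith) hn.le
  have hX : a - q = -(k : ℂ) * h := by
    have e1 : (a - q) * conj h = ((-(k * ‖h‖ ^ 2) : ℝ) : ℂ) := by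
      apply Complex.ext
      · rw [Complex.ofReal_re, hk, div_mul_cancel₀ _ hn.ne', neg_neg]
      · rw [him, Complex.ofReal_im]
    have e2 : conj h * h = ((‖h‖ ^ 2 : ℝ) : ℂ) := by
      rw [Complex.conj_mul']; push_cast; rfl
    have hn' : ((‖h‖ ^ 2 : ℝ) : ℂ) ≠ 0 := by exact_mod_cast hn.ne'
    apply mul_right_cancel₀ hn'
    rw [← e2]
    calc (a - q) * (conj h * h) = ((a - q) * conj h) * h := by ring
      _ = _ := by rw [e1, e2]; push_cast; ring
  have h1 : q + h ∈ V := hY (by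
    rw [mem_ball, dist_eq_norm]
    have : q + h - Y = q - o := by rw [hh']; ring
    rwa [this])
  apply hq
  have hk1 : 0 < 1 + k := by linarith
  have := hV ha h1 (a := 1 / (1 + k)) (b := k / (1 + k)) (by positivity) (by positivity)
    (by field_simp)
  convert this using 1
  simp only [Complex.real_smul]
  have hk2 : (1 + (k : ℂ)) ≠ 0 := by exact_mod_cast hk1.ne'
  push_cast
  field_simp
  have : a = q - k * h := by linear_combination hX
  rw [this]; ring

lemma re_le_abs_im {V : Set ℂ} (hV : Convex ℝ V) (hVo : IsOpen V) {Y o q q' : ℂ} {R : ℝ}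
    (hR : 0 < R) (hq : q ∈ closure V) (hq'n : q' ∉ V) (hY : ball Y R ⊆ V) (hqo : ‖q - o‖ < R / 4)
    (hq'o : ‖q' - o‖ < R / 4) :
    R / 2 * ((q' - q) * conj (Y - o)).re ≤ |((q' - q) * conj (Y - o)).im| * ‖Y - o‖ := by
  set h := Y - o with hh'
  by_contra! hc
  have hYq : R ≤ ‖Y - q'‖ := by
    by_contra! hcc
    exact hq'n (hY (by rwa [mem_ball, dist_comm, dist_eq_norm]))
  have hh : R / 2 < ‖h‖ := by
    have : ‖Y - q'‖ ≤ ‖h‖ + ‖q' - o‖ := by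
      rw [show Y - q' = h - (q' - o) by rw [hh']; ring]; exact norm_sub_le _ _
    linarith
  have hh0 : 0 < ‖h‖ := by linarith
  set A := ((q' - q) * conj h).re with hA
  set B := ((q' - q) * conj h).im with hB
  have hApos : 0 < A := by
    have : 0 ≤ |B| * ‖h‖ := by positivity
    by_contra! hcc
    nlinarith
  set s := A / ‖h‖ ^ 2 with hs
  have hs0 : 0 < s := by positivity
  have hX2 : ‖q' - q‖ ≤ R / 2 := by
    rw [show q' - q = (q' - o) - (q - o) by ring]
    exact (norm_sub_le _ _).trans (by linarith)
  have hs1 : s ≤ 1 := by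
    rw [hs, div_le_one (by positivity)]
    have : A ≤ ‖(q' - q) * conj h‖ := Complex.re_le_norm _
    rw [norm_mul, RCLike.norm_conj] at this
    nlinarith
  have hs' : (s : ℂ) ≠ 0 := by exact_mod_cast hs0.ne'
  have e2 : conj h * h = ((‖h‖ ^ 2 : ℝ) : ℂ) := by
    rw [Complex.conj_mul']; push_cast; rfl
  have hn' : ((‖h‖ ^ 2 : ℝ) : ℂ) ≠ 0 := by exact_mod_cast (by positivity : (0:ℝ) < ‖h‖ ^ 2).ne'
  have hv : (q' - q) / s - h = Complex.I * ((B / A : ℝ) : ℂ) * h := by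
    have e1 : (q' - q) * conj h = A + B * Complex.I := (Complex.re_add_im _).symm
    have hA' : (A : ℂ) ≠ 0 := by exact_mod_cast hApos.ne'
    have e3 : (q' - q) = (A + B * Complex.I) * h / ((‖h‖ ^ 2 : ℝ) : ℂ) := by
      rw [eq_div_iff hn', ← e2, ← e1]; ring
    rw [e3, hs]
    have hn'' : (‖h‖ : ℂ) ≠ 0 := by exact_mod_cast hh0.ne'
    push_cast
    field_simp
    ring
  have := cone_mem hV hVo (s := s) (v := (q' - q) / s) hq hY (by linarith : ‖q - o‖ < R / 2) (by
    rw [← hh', hv, norm_mul, norm_mul, Complex.norm_I, one_mul, Complex.norm_real,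
      Real.norm_eq_abs, abs_div, abs_of_pos hApos, div_mul_eq_mul_div, div_lt_iff₀ hApos]
    exact hc) hs0 hs1
  apply hq'n
  convert this using 1
  field_simp
  ring

lemma norm_le_abs_im {V : Set ℂ} (hV : Convex ℝ V) (hVo : IsOpen V) {Y o q q' : ℂ} {R : ℝ}
    (hR : 0 < R) (hq : q ∈ frontier V) (hq' : q' ∈ frontier V) (hY : ball Y R ⊆ V)
    (hqo : ‖q - o‖ < R / 4) (hq'o : ‖q' - o‖ < R / 4) :
    R / 4 * ‖q' - q‖ ≤ |((q' - q) * conj (Y - o)).im| := by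
  rw [hVo.frontier_eq] at hq hq'
  have h1 := re_le_abs_im hV hVo hR hq.1 hq'.2 hY hqo hq'o
  have h2 := re_le_abs_im hV hVo hR hq'.1 hq.2 hY hq'o hqo
  have hYq : R ≤ ‖Y - q'‖ := by
    by_contra! hcc
    exact hq'.2 (hY (by rwa [mem_ball, dist_comm, dist_eq_norm]))
  set h := Y - o with hh'
  have hh : 3 * R / 4 < ‖h‖ := by
    have : ‖Y - q'‖ ≤ ‖h‖ + ‖q' - o‖ := by
      rw [show Y - q' = h - (q' - o) by rw [hh']; ring]; exact norm_sub_le _ _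
    linarith
  have e : (q - q') * conj h = -((q' - q) * conj h) := by ring
  rw [e, Complex.neg_re, Complex.neg_im, abs_neg] at h2
  have h3 : R / 2 * |((q' - q) * conj h).re| ≤ |((q' - q) * conj h).im| * ‖h‖ := by
    rcases abs_cases ((q' - q) * conj h).re with ⟨h0, _⟩ | ⟨h0, _⟩ <;> rw [h0] <;> assumption
  have h4 : ‖q' - q‖ * ‖h‖ ≤ |((q' - q) * conj h).re| + |((q' - q) * conj h).im| := by
    have := Complex.norm_le_abs_re_add_abs_im ((q' - q) * conj h)
    rwa [norm_mul, RCLike.norm_conj] at this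
  set a := |((q' - q) * conj h).im|
  have ha : 0 ≤ a := abs_nonneg _
  have hh0 : 0 < ‖h‖ := by linarith
  have h5 : R / 2 * (‖q' - q‖ * ‖h‖) ≤ a * (‖h‖ + R / 2) := by nlinarith
  have h6 : a * (‖h‖ + R / 2) ≤ a * (2 * ‖h‖) := by gcongr; linarith
  have h7 : (R / 4 * ‖q' - q‖) * (2 * ‖h‖) ≤ a * (2 * ‖h‖) := by linarith
  exact le_of_mul_le_mul_right h7 (by positivity)

/-! ### The chart based at a point -/

/-- A bi-Lipschitz change of variable, holomorphic on the domain. -/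
def chart (ω : ℂ → ℂ) (y o ζ : ℂ) : ℂ := (ζ * conj (y - o) - ω ζ * conj (ω y - ω o)) / 2

lemma chart_sub_im (ω : ℂ → ℂ) (y o a b : ℂ) : (chart ω y o a - chart ω y o b).im =
    ((srcPt ω a - srcPt ω b) * conj (srcPt ω y - srcPt ω o)).im +
    ((tgtPt ω a - tgtPt ω b) * conj (tgtPt ω y - tgtPt ω o)).im := by
  simp only [chart, ← sub_div, Complex.div_ofNat_im, Complex.mul_im,
    Complex.conj_re, Complex.conj_im, Complex.sub_re, Complex.sub_im, srcPt_re, srcPt_im, tgtPt_re,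
    tgtPt_im]
  ring

lemma chart_sub_re (ω : ℂ → ℂ) (y o a b : ℂ) : (chart ω y o a - chart ω y o b).re =
    ((srcPt ω a - srcPt ω b) * conj (tgtPt ω y - tgtPt ω o)).re +
    ((tgtPt ω a - tgtPt ω b) * conj (srcPt ω y - srcPt ω o)).re := by
  simp only [chart, ← sub_div, Complex.div_ofNat_re, Complex.mul_re,
    Complex.conj_re, Complex.conj_im, Complex.sub_re, Complex.sub_im, srcPt_re, srcPt_im, tgtPt_re,
    tgtPt_im]
  ring

/-- Lower bi-Lipschitz constant of the charts. -/
def chartLow (R d c : ℝ) : ℝ := c * R ^ 2 / (24 * d)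

namespace OTData

variable {R d c : ℝ} {ω : ℂ → ℂ} {D V₁ V₂ : Set ℂ} {y o : ℂ}

lemma chartLow_pos (h : OTData R d c ω D V₁ V₂ y) : 0 < chartLow R d c := by
  have := h.R_pos; have := h.c_pos; have := h.d_ge
  unfold chartLow; positivity

lemma chart_le (h : OTData R d c ω D V₁ V₂ y) (ho : o ∈ closure D) (a b : ℂ) :
    ‖chart ω y o a - chart ω y o b‖ ≤ d * ‖a - b‖ := by
  have e : chart ω y o a - chart ω y o b =
      ((a - b) * conj (y - o) - (ω a - ω b) * conj (ω y - ω o)) / 2 := by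
    simp only [chart]; ring
  rw [e, norm_div]
  have h1 := norm_sub_le ((a - b) * conj (y - o)) ((ω a - ω b) * conj (ω y - ω o))
  simp only [norm_mul, RCLike.norm_conj] at h1
  have h2 := h.lip a b
  have h3 := h.lip y o
  have h4 := h.bdd_closure ho
  rw [norm_sub_rev] at h4
  have h5 : ‖ω a - ω b‖ * ‖ω y - ω o‖ ≤ ‖a - b‖ * ‖y - o‖ := by gcongr
  have h6 : ‖a - b‖ * ‖y - o‖ ≤ ‖a - b‖ * d := by gcongr
  simp only [Complex.norm_ofNat]
  linarith

lemma contract_base (h : OTData R d c ω D V₁ V₂ y) (ho : o ∈ closure D) :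
    ‖ω y - ω o‖ ≤ (1 - c * R / (6 * d)) * ‖y - o‖ := by
  have := h.contract_center ho
  rwa [norm_sub_rev, norm_sub_rev o] at this

lemma le_chart (h : OTData R d c ω D V₁ V₂ y) (ho : o ∈ closure D) (hoy : R / 2 ≤ ‖y - o‖)
    (a b : ℂ) : chartLow R d c * ‖a - b‖ ≤ ‖chart ω y o a - chart ω y o b‖ := by
  have e : chart ω y o a - chart ω y o b =
      ((a - b) * conj (y - o) - (ω a - ω b) * conj (ω y - ω o)) / 2 := by
    simp only [chart]; ring
  rw [e, norm_div]
  have h1 := norm_sub_norm_le ((a - b) * conj (y - o)) ((ω a - ω b) * conj (ω y - ω o))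
  simp only [norm_mul, RCLike.norm_conj] at h1
  have h2 := h.lip a b
  have h3 := h.contract_base ho
  have h5 : ‖ω a - ω b‖ * ‖ω y - ω o‖ ≤ ‖a - b‖ * ((1 - c * R / (6 * d)) * ‖y - o‖) := by gcongr
  have hd : 0 < d := by linarith [h.d_ge]
  have hR := h.R_pos
  have hc := h.c_pos
  have h6 : ‖a - b‖ * (c * R / (6 * d) * (R / 2)) ≤ ‖a - b‖ * (c * R / (6 * d) * ‖y - o‖) := by
    gcongr
  have h7 : chartLow R d c * ‖a - b‖ = ‖a - b‖ * (c * R / (6 * d) * (R / 2)) / 2 := by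
    unfold chartLow; field_simp; ring
  rw [h7]
  simp only [Complex.norm_ofNat]
  linarith

lemma chart_surjective (h : OTData R d c ω D V₁ V₂ y) (ho : o ∈ closure D)
    (hoy : R / 2 ≤ ‖y - o‖) : Function.Surjective (chart ω y o) := by
  intro w
  have hd : 0 < d := by linarith [h.d_ge]
  have hR := h.R_pos
  have hc := h.c_pos
  have ha : 0 < ‖y - o‖ := by linarith
  have ha' : conj (y - o) ≠ 0 := (map_ne_zero _).2 (norm_pos_iff.1 ha)
  have hK : 0 < c * R / (6 * d) := by positivity
  set K : NNReal := Real.toNNReal (1 - c * R / (6 * d)) with hKdef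
  have hcon : ContractingWith K (fun ζ => (2 * w + ω ζ * conj (ω y - ω o)) / conj (y - o)) := by
    constructor
    · rw [hKdef, Real.toNNReal_lt_one]; linarith
    · refine LipschitzWith.of_dist_le_mul fun a b => ?_
      rw [dist_eq_norm, dist_eq_norm, ← sub_div]
      have e : 2 * w + ω a * conj (ω y - ω o) - (2 * w + ω b * conj (ω y - ω o)) =
        (ω a - ω b) * conj (ω y - ω o) := by ring
      rw [e, norm_div, norm_mul, RCLike.norm_conj, RCLike.norm_conj, div_le_iff₀ ha]
      have h3 := h.contract_base ho
      have h0 : (0 : ℝ) ≤ 1 - c * R / (6 * d) := by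
        by_contra! hcc
        have := (norm_nonneg _).trans h3
        nlinarith
      rw [hKdef, Real.coe_toNNReal _ h0]
      calc ‖ω a - ω b‖ * ‖ω y - ω o‖ ≤ ‖a - b‖ * ((1 - c * R / (6 * d)) * ‖y - o‖) := by
            gcongr; exact h.lip a b
        _ = _ := by ring
  have hfp := hcon.fixedPoint_isFixedPt
  generalize ContractingWith.fixedPoint _ hcon = ζ at hfp
  refine ⟨ζ, ?_⟩
  unfold Function.IsFixedPt at hfp
  rw [div_eq_iff ha'] at hfp
  unfold chart
  rw [← hfp]; ring

end OTData

/-- The inverse of the chart. -/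
def chartInv (ω : ℂ → ℂ) (y o : ℂ) : ℂ → ℂ := Function.invFun (chart ω y o)

namespace OTData

variable {R d c : ℝ} {ω : ℂ → ℂ} {D V₁ V₂ : Set ℂ} {y o : ℂ}

lemma chart_inv (h : OTData R d c ω D V₁ V₂ y) (ho : o ∈ closure D)
    (hoy : R / 2 ≤ ‖y - o‖) (w : ℂ) : chart ω y o (chartInv ω y o w) = w :=
  Function.rightInverse_invFun (h.chart_surjective ho hoy) w

lemma inv_chart (h : OTData R d c ω D V₁ V₂ y) (ho : o ∈ closure D)
    (hoy : R / 2 ≤ ‖y - o‖) (a : ℂ) : chartInv ω y o (chart ω y o a) = a := by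
  have h1 := h.le_chart ho hoy (chartInv ω y o (chart ω y o a)) a
  rw [h.chart_inv ho hoy, sub_self, norm_zero] at h1
  have h2 : ‖chartInv ω y o (chart ω y o a) - a‖ ≤ 0 := by
    by_contra! hc
    nlinarith [h.chartLow_pos]
  exact sub_eq_zero.1 (norm_le_zero_iff.1 h2)

lemma inv_le (h : OTData R d c ω D V₁ V₂ y) (ho : o ∈ closure D)
    (hoy : R / 2 ≤ ‖y - o‖) (w w' : ℂ) :
    chartLow R d c * ‖chartInv ω y o w - chartInv ω y o w'‖ ≤ ‖w - w'‖ := by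
  have := h.le_chart ho hoy (chartInv ω y o w) (chartInv ω y o w')
  rwa [h.chart_inv ho hoy, h.chart_inv ho hoy] at this

lemma continuous_inv (h : OTData R d c ω D V₁ V₂ y) (ho : o ∈ closure D)
    (hoy : R / 2 ≤ ‖y - o‖) : Continuous (chartInv ω y o) := by
  have hp := h.chartLow_pos
  refine (LipschitzWith.of_dist_le_mul (K := (chartLow R d c)⁻¹.toNNReal) fun a b => ?_).continuous
  rw [Real.coe_toNNReal _ (by positivity), dist_eq_norm, dist_eq_norm, inv_mul_eq_div,
    le_div_iff₀ hp, mul_comm]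
  exact h.inv_le ho hoy a b

lemma continuous_chart (h : OTData R d c ω D V₁ V₂ y) : Continuous (chart ω y o) := by
  have := h.continuous
  unfold chart; fun_prop

/-- Connected sets of the chart plane avoiding the image of the boundary lift to `D`. -/
lemma lift_mem (h : OTData R d c ω D V₁ V₂ y) (ho : o ∈ closure D) (hoy : R / 2 ≤ ‖y - o‖)
    {S : Set ℂ} (hS : IsPreconnected S) {w₀ : ℂ} (hw₀ : w₀ ∈ S) (hD : chartInv ω y o w₀ ∈ D)
    (hfr : ∀ q ∈ frontier D, chart ω y o q ∉ S) {w : ℂ} (hw : w ∈ S) : chartInv ω y o w ∈ D := by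
  have h1 := hS.image _ (h.continuous_inv ho hoy).continuousOn
  refine subset_of_disjoint_frontier h1 h.isOpen ⟨_, ⟨w₀, hw₀, rfl⟩, hD⟩ ?_ ⟨w, hw, rfl⟩
  rintro _ ⟨v, hv, rfl⟩ hf
  exact hfr _ hf (by rwa [h.chart_inv ho hoy])

end OTData

namespace OTData

variable {R d c : ℝ} {ω : ℂ → ℂ} {D V₁ V₂ : Set ℂ} {y o : ℂ}

lemma re_base_pos (h : OTData R d c ω D V₁ V₂ y) (ho : o ∈ closure D) (hoy : R / 2 ≤ ‖y - o‖) :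
    0 < ((srcPt ω y - srcPt ω o) * conj (tgtPt ω y - tgtPt ω o)).re := by
  rw [re_srcPt_mul_tgtPt]
  have h1 := h.contract_base ho
  have hd : 0 < d := by linarith [h.d_ge]
  have hR := h.R_pos
  have hc := h.c_pos
  have h2 : 0 < c * R / (6 * d) * ‖y - o‖ := by
    have : 0 < ‖y - o‖ := by linarith
    positivity
  have h3 : ‖ω y - ω o‖ < ‖y - o‖ := by linarith
  have := pow_lt_pow_left₀ h3 (norm_nonneg _) two_ne_zero
  linarith

lemma base_ne_zero (h : OTData R d c ω D V₁ V₂ y) (ho : o ∈ closure D) (hoy : R / 2 ≤ ‖y - o‖) :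
    srcPt ω y - srcPt ω o ≠ 0 ∧ tgtPt ω y - tgtPt ω o ≠ 0 := by
  have := h.re_base_pos ho hoy
  constructor <;> intro h0 <;> simp [h0] at this

lemma src_slit (h : OTData R d c ω D V₁ V₂ y) (ho : o ∈ closure D) (hoy : R / 2 ≤ ‖y - o‖)
    {q ζ : ℂ} (hq : q ∈ frontier D) (hqo : ‖q - o‖ < R / 4) (hζ : ζ ∈ D) :
    (srcPt ω ζ - srcPt ω q) * conj (srcPt ω y - srcPt ω o) ∈ Complex.slitPlane :=
  mul_conj_mem_slitPlane h.conv₁ (h.src_notMem hq) (h.src_mem ζ hζ) h.ball₁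
    (by linarith [h.src_lip q o, h.R_pos]) (h.base_ne_zero ho hoy).1

lemma tgt_slit (h : OTData R d c ω D V₁ V₂ y) (ho : o ∈ closure D) (hoy : R / 2 ≤ ‖y - o‖)
    {q ζ : ℂ} (hq : q ∈ frontier D) (hqo : ‖q - o‖ < R / 4) (hζ : ζ ∈ D) :
    (tgtPt ω ζ - tgtPt ω q) * conj (tgtPt ω y - tgtPt ω o) ∈ Complex.slitPlane :=
  mul_conj_mem_slitPlane h.conv₂ (h.tgt_notMem hq) (h.tgt_mem ζ hζ) h.ball₂
    (by linarith [h.tgt_lip q o, h.R_pos]) (h.base_ne_zero ho hoy).2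

lemma re_mul_conj_pos_of_near {R : ℝ} {a b e : ℂ} (h1 : R ≤ ‖a - b‖) (h2 : ‖b - e‖ < R / 4)
    (hR : 0 < R) : 0 < ((a - b) * conj (a - e)).re := by
  have e1 : (a - b) * conj (a - e) = (a - b) * conj (a - b) + (a - b) * conj (b - e) := by
    rw [← mul_add, ← map_add]; ring_nf
  have h3 := Complex.abs_re_le_norm ((a - b) * conj (b - e))
  rw [norm_mul, RCLike.norm_conj] at h3
  rw [e1, Complex.add_re, Complex.mul_conj, Complex.ofReal_re, ← Complex.sq_norm]
  nlinarith [neg_le_of_abs_le h3, norm_nonneg (b - e)]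

lemma abs_chi_le (h : OTData R d c ω D V₁ V₂ y) (ho : o ∈ closure D) (hoy : R / 2 ≤ ‖y - o‖)
    {q ζ : ℂ} (hq : q ∈ frontier D) (hqo : ‖q - o‖ < R / 4) (hζ : ζ ∈ D) :
    |((srcPt ω ζ - srcPt ω q) * conj (srcPt ω y - srcPt ω o)).arg -
      ((tgtPt ω ζ - tgtPt ω q) * conj (tgtPt ω y - tgtPt ω o)).arg +
      ((srcPt ω y - srcPt ω o) * conj (tgtPt ω y - tgtPt ω o)).arg| ≤ Real.pi / 2 := by
  have hR := h.R_pos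
  have hs := fun z (hz : z ∈ D) => h.src_slit ho hoy hq hqo hz
  have ht := fun z (hz : z ∈ D) => h.tgt_slit ho hoy hq hqo hz
  have c1 := h.continuous_src
  have c2 := h.continuous_tgt
  refine abs_le_of_cos_nonneg (y := y) h.preconn (χ := fun ζ =>
    ((srcPt ω ζ - srcPt ω q) * conj (srcPt ω y - srcPt ω o)).arg -
      ((tgtPt ω ζ - tgtPt ω q) * conj (tgtPt ω y - tgtPt ω o)).arg +
      ((srcPt ω y - srcPt ω o) * conj (tgtPt ω y - tgtPt ω o)).arg) ?_ ?_ h.y_mem ?_ ζ hζ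
  · refine ContinuousOn.add (ContinuousOn.sub ?_ ?_) continuousOn_const
    · intro z hz
      refine ContinuousAt.continuousWithinAt ?_
      refine ContinuousAt.comp (f := fun ζ => (srcPt ω ζ - srcPt ω q) * conj (srcPt ω y - srcPt ω o))
        (Complex.continuousAt_arg (hs z hz)) (by fun_prop)
    · intro z hz
      refine ContinuousAt.continuousWithinAt ?_
      refine ContinuousAt.comp (f := fun ζ => (tgtPt ω ζ - tgtPt ω q) * conj (tgtPt ω y - tgtPt ω o))
        (Complex.continuousAt_arg (ht z hz)) (by fun_prop)
  · intro z hz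
    apply cos_arg_nonneg
    · exact left_ne_zero_of_mul (Complex.slitPlane_ne_zero (hs z hz))
    · exact left_ne_zero_of_mul (Complex.slitPlane_ne_zero (ht z hz))
    · exact (h.base_ne_zero ho hoy).1
    · exact (h.base_ne_zero ho hoy).2
    · rw [re_srcPt_mul_tgtPt]
      have := pow_le_pow_left₀ (norm_nonneg _) (h.lip z q) 2
      linarith
  · have a1 : |((srcPt ω y - srcPt ω q) * conj (srcPt ω y - srcPt ω o)).arg| < Real.pi / 2 :=
      Complex.abs_arg_lt_pi_div_two_iff.2 (Or.inl (re_mul_conj_pos_of_near (h.le_norm_src hq)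
        ((h.src_lip q o).trans_lt hqo) hR))
    have a2 : |((tgtPt ω y - tgtPt ω q) * conj (tgtPt ω y - tgtPt ω o)).arg| < Real.pi / 2 :=
      Complex.abs_arg_lt_pi_div_two_iff.2 (Or.inl (re_mul_conj_pos_of_near (h.le_norm_tgt hq)
        ((h.tgt_lip q o).trans_lt hqo) hR))
    have a3 := Complex.abs_arg_lt_pi_div_two_iff.2 (Or.inl (h.re_base_pos ho hoy))
    rw [abs_lt] at a1 a2 a3 ⊢
    constructor <;> linarith [a1.1, a1.2, a2.1, a2.2, a3.1, a3.2]

lemma abs_chi_le_closure (h : OTData R d c ω D V₁ V₂ y) (ho : o ∈ closure D)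
    (hoy : R / 2 ≤ ‖y - o‖) {q ζ : ℂ} (hq : q ∈ frontier D) (hqo : ‖q - o‖ < R / 4)
    (hζ : ζ ∈ closure D)
    (h1 : (srcPt ω ζ - srcPt ω q) * conj (srcPt ω y - srcPt ω o) ∈ Complex.slitPlane)
    (h2 : (tgtPt ω ζ - tgtPt ω q) * conj (tgtPt ω y - tgtPt ω o) ∈ Complex.slitPlane) :
    |((srcPt ω ζ - srcPt ω q) * conj (srcPt ω y - srcPt ω o)).arg -
      ((tgtPt ω ζ - tgtPt ω q) * conj (tgtPt ω y - tgtPt ω o)).arg +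
      ((srcPt ω y - srcPt ω o) * conj (tgtPt ω y - tgtPt ω o)).arg| ≤ Real.pi / 2 := by
  have c1 := h.continuous_src
  have c2 := h.continuous_tgt
  have k1 : ContinuousAt (fun ζ => ((srcPt ω ζ - srcPt ω q) * conj (srcPt ω y - srcPt ω o)).arg) ζ :=
    ContinuousAt.comp (f := fun ζ => (srcPt ω ζ - srcPt ω q) * conj (srcPt ω y - srcPt ω o))
        (Complex.continuousAt_arg h1) (by fun_prop)
  have k2 : ContinuousAt (fun ζ => ((tgtPt ω ζ - tgtPt ω q) * conj (tgtPt ω y - tgtPt ω o)).arg) ζ :=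
    ContinuousAt.comp (f := fun ζ => (tgtPt ω ζ - tgtPt ω q) * conj (tgtPt ω y - tgtPt ω o))
        (Complex.continuousAt_arg h2) (by fun_prop)
  have hne := mem_closure_iff_nhdsWithin_neBot.1 hζ
  have k3 := (((k1.sub k2).add (continuousAt_const (y :=
    ((srcPt ω y - srcPt ω o) * conj (tgtPt ω y - tgtPt ω o)).arg))).abs).mono_left
    (nhdsWithin_le_nhds (s := D))
  refine le_of_tendsto k3 ?_
  filter_upwards [self_mem_nhdsWithin] with a ha using h.abs_chi_le ho hoy hq hqo ha

lemma order_aux (h : OTData R d c ω D V₁ V₂ y) (ho : o ∈ closure D) (hoy : R / 2 ≤ ‖y - o‖)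
    {q q' : ℂ} (hq : q ∈ frontier D) (hqo : ‖q - o‖ < R / 4) (hq' : q' ∈ frontier D)
    (hqo' : ‖q' - o‖ < R / 4)
    (h1 : 0 < ((srcPt ω q' - srcPt ω q) * conj (srcPt ω y - srcPt ω o)).im) :
    0 ≤ ((tgtPt ω q' - tgtPt ω q) * conj (tgtPt ω y - tgtPt ω o)).im := by
  by_contra! h2
  have A := h.abs_chi_le_closure ho hoy hq hqo (frontier_subset_closure hq')
    (Complex.mem_slitPlane_iff.2 (Or.inr h1.ne')) (Complex.mem_slitPlane_iff.2 (Or.inr h2.ne))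
  have e1 : (srcPt ω q - srcPt ω q') * conj (srcPt ω y - srcPt ω o) =
    -((srcPt ω q' - srcPt ω q) * conj (srcPt ω y - srcPt ω o)) := by ring
  have e2 : (tgtPt ω q - tgtPt ω q') * conj (tgtPt ω y - tgtPt ω o) =
    -((tgtPt ω q' - tgtPt ω q) * conj (tgtPt ω y - tgtPt ω o)) := by ring
  have B := h.abs_chi_le_closure ho hoy hq' hqo' (frontier_subset_closure hq)
    (by rw [e1]; exact Complex.mem_slitPlane_iff.2 (Or.inr (by rw [Complex.neg_im]; exact neg_ne_zero.2 h1.ne')))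
    (by rw [e2]; exact Complex.mem_slitPlane_iff.2 (Or.inr (by rw [Complex.neg_im]; exact neg_ne_zero.2 h2.ne)))
  rw [e1, e2, Complex.arg_neg_eq_arg_sub_pi_of_im_pos h1,
    Complex.arg_neg_eq_arg_add_pi_of_im_neg h2] at B
  rw [abs_le] at A B
  linarith [A.2, B.1, Real.pi_pos]

/-- Boundary points are ordered consistently in the source and the target. -/
lemma order_pos (h : OTData R d c ω D V₁ V₂ y) (ho : o ∈ closure D) (hoy : R / 2 ≤ ‖y - o‖)
    {q q' : ℂ} (hq : q ∈ frontier D) (hqo : ‖q - o‖ < R / 4) (hq' : q' ∈ frontier D)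
    (hqo' : ‖q' - o‖ < R / 4) (h1 : 0 < (chart ω y o q' - chart ω y o q).im) :
    R / 4 * ‖srcPt ω q' - srcPt ω q‖ ≤
      ((srcPt ω q' - srcPt ω q) * conj (srcPt ω y - srcPt ω o)).im ∧
    R / 4 * ‖tgtPt ω q' - tgtPt ω q‖ ≤
      ((tgtPt ω q' - tgtPt ω q) * conj (tgtPt ω y - tgtPt ω o)).im := by
  rw [chart_sub_im] at h1
  have A := norm_le_abs_im h.conv₁ h.open₁ h.R_pos (h.src_fr q hq) (h.src_fr q' hq') h.ball₁
    ((h.src_lip q o).trans_lt hqo) ((h.src_lip q' o).trans_lt hqo')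
  have B := norm_le_abs_im h.conv₂ h.open₂ h.R_pos (h.tgt_fr q hq) (h.tgt_fr q' hq') h.ball₂
    ((h.tgt_lip q o).trans_lt hqo) ((h.tgt_lip q' o).trans_lt hqo')
  have S1 := h.order_aux ho hoy hq hqo hq' hqo'
  have S2 := h.order_aux ho hoy hq' hqo' hq hqo
  have e1 : (srcPt ω q - srcPt ω q') * conj (srcPt ω y - srcPt ω o) =
    -((srcPt ω q' - srcPt ω q) * conj (srcPt ω y - srcPt ω o)) := by ring
  have e2 : (tgtPt ω q - tgtPt ω q') * conj (tgtPt ω y - tgtPt ω o) =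
    -((tgtPt ω q' - tgtPt ω q) * conj (tgtPt ω y - tgtPt ω o)) := by ring
  rw [e1, e2, Complex.neg_im, Complex.neg_im] at S2
  set a := ((srcPt ω q' - srcPt ω q) * conj (srcPt ω y - srcPt ω o)).im
  set b := ((tgtPt ω q' - tgtPt ω q) * conj (tgtPt ω y - tgtPt ω o)).im
  have ha : 0 ≤ a := by
    by_contra! hc
    have := S2 (by linarith)
    linarith
  have hb : 0 ≤ b := by
    by_contra! hc
    rcases ha.eq_or_lt with h0 | h0
    · linarith
    · linarith [S1 h0]
  rw [abs_of_nonneg ha] at A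
  rw [abs_of_nonneg hb] at B
  exact ⟨A, B⟩

lemma order_neg (h : OTData R d c ω D V₁ V₂ y) (ho : o ∈ closure D) (hoy : R / 2 ≤ ‖y - o‖)
    {q q' : ℂ} (hq : q ∈ frontier D) (hqo : ‖q - o‖ < R / 4) (hq' : q' ∈ frontier D)
    (hqo' : ‖q' - o‖ < R / 4) (h1 : (chart ω y o q' - chart ω y o q).im < 0) :
    R / 4 * ‖srcPt ω q' - srcPt ω q‖ ≤
      -((srcPt ω q' - srcPt ω q) * conj (srcPt ω y - srcPt ω o)).im ∧
    R / 4 * ‖tgtPt ω q' - tgtPt ω q‖ ≤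
      -((tgtPt ω q' - tgtPt ω q) * conj (tgtPt ω y - tgtPt ω o)).im := by
  have := h.order_pos ho hoy hq' hqo' hq hqo (by rw [← neg_sub, Complex.neg_im]; linarith)
  rw [norm_sub_rev (srcPt ω q), norm_sub_rev (tgtPt ω q)] at this
  rwa [← Complex.neg_im, ← Complex.neg_im, ← neg_mul, ← neg_mul, neg_sub, neg_sub]

lemma order_abs (h : OTData R d c ω D V₁ V₂ y) (ho : o ∈ closure D) (hoy : R / 2 ≤ ‖y - o‖)
    {q q' : ℂ} (hq : q ∈ frontier D) (hqo : ‖q - o‖ < R / 4) (hq' : q' ∈ frontier D)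
    (hqo' : ‖q' - o‖ < R / 4) :
    R / 4 * ‖q' - q‖ ≤ |(chart ω y o q' - chart ω y o q).im| := by
  have tri : ‖q' - q‖ ≤ ‖srcPt ω q' - srcPt ω q‖ + ‖tgtPt ω q' - tgtPt ω q‖ := by
    have : q' - q = (srcPt ω q' - srcPt ω q) + (tgtPt ω q' - tgtPt ω q) := by
      have a := srcPt_add_tgtPt ω q
      have b := srcPt_add_tgtPt ω q'
      linear_combination a - b
    calc ‖q' - q‖ = _ := by rw [this]
      _ ≤ _ := norm_add_le _ _
  have hR := h.R_pos
  have tri' := mul_le_mul_of_nonneg_left tri (by linarith : 0 ≤ R / 4)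
  have A := norm_le_abs_im h.conv₁ h.open₁ h.R_pos (h.src_fr q hq) (h.src_fr q' hq') h.ball₁
    ((h.src_lip q o).trans_lt hqo) ((h.src_lip q' o).trans_lt hqo')
  have B := norm_le_abs_im h.conv₂ h.open₂ h.R_pos (h.tgt_fr q hq) (h.tgt_fr q' hq') h.ball₂
    ((h.tgt_lip q o).trans_lt hqo) ((h.tgt_lip q' o).trans_lt hqo')
  rcases lt_trichotomy (chart ω y o q' - chart ω y o q).im 0 with h0 | h0 | h0
  · have := h.order_neg ho hoy hq hqo hq' hqo' h0
    rw [chart_sub_im] at h0 ⊢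
    rw [abs_of_neg h0]; linarith [this.1, this.2]
  · have S1 := h.order_aux ho hoy hq hqo hq' hqo'
    have S2 := h.order_aux ho hoy hq' hqo' hq hqo
    have e1 : (srcPt ω q - srcPt ω q') * conj (srcPt ω y - srcPt ω o) =
      -((srcPt ω q' - srcPt ω q) * conj (srcPt ω y - srcPt ω o)) := by ring
    have e2 : (tgtPt ω q - tgtPt ω q') * conj (tgtPt ω y - tgtPt ω o) =
      -((tgtPt ω q' - tgtPt ω q) * conj (tgtPt ω y - tgtPt ω o)) := by ring
    rw [e1, e2, Complex.neg_im, Complex.neg_im] at S2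
    rw [h0, abs_zero]
    rw [chart_sub_im] at h0
    have z1 : ((srcPt ω q' - srcPt ω q) * conj (srcPt ω y - srcPt ω o)).im = 0 := by
      by_contra hne
      rcases lt_or_gt_of_ne hne with hl | hl
      · linarith [S2 (by linarith)]
      · linarith [S1 hl]
    rw [z1, abs_zero] at A
    rw [z1, zero_add] at h0
    rw [h0, abs_zero] at B
    linarith
  · have := h.order_pos ho hoy hq hqo hq' hqo' h0
    rw [chart_sub_im] at h0 ⊢
    rw [abs_of_pos h0]; linarith [this.1, this.2]

lemma chart_slit (h : OTData R d c ω D V₁ V₂ y) (ho : o ∈ closure D) (hoy : R / 2 ≤ ‖y - o‖)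
    {q ζ : ℂ} (hq : q ∈ frontier D) (hqo : ‖q - o‖ < R / 4) (hζ : ζ ∈ D) :
    chart ω y o ζ - chart ω y o q ∈ Complex.slitPlane := by
  rw [Complex.mem_slitPlane_iff]
  by_contra! hc
  obtain ⟨hre, him⟩ := hc
  have chi := abs_le.1 (h.abs_chi_le ho hoy hq hqo hζ)
  have hs := h.src_slit ho hoy hq hqo hζ
  have ht := h.tgt_slit ho hoy hq hqo hζ
  have hb := h.re_base_pos ho hoy
  have hne := h.base_ne_zero ho hoy
  have hθ := abs_lt.1 (Complex.abs_arg_lt_pi_div_two_iff.2 (Or.inl hb))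
  rw [chart_sub_re] at hre
  rw [chart_sub_im] at him
  set X := srcPt ω ζ - srcPt ω q
  set P := tgtPt ω ζ - tgtPt ω q
  set h₁ := srcPt ω y - srcPt ω o
  set h₂ := tgtPt ω y - tgtPt ω o
  have pp := Real.pi_pos
  have e0 : h₁ * conj h₂ ≠ 0 := mul_ne_zero hne.1 ((map_ne_zero _).2 hne.2)
  have conjarg : (conj (h₁ * conj h₂)).arg = -(h₁ * conj h₂).arg := by
    rw [Complex.arg_conj, if_neg]; linarith [hθ.2]
  have n1 : 0 < ‖h₁‖ ^ 2 := by have := norm_pos_iff.2 hne.1; positivity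
  have n2 : 0 < ‖h₂‖ ^ 2 := by have := norm_pos_iff.2 hne.2; positivity
  have key : |(X * conj h₁).arg + (h₁ * conj h₂).arg| < Real.pi / 2 ∧
      |(P * conj h₂).arg - (h₁ * conj h₂).arg| < Real.pi / 2 := by
    rcases lt_trichotomy (X * conj h₁).im 0 with h0 | h0 | h0
    · have i1 := Complex.arg_neg_iff.2 h0
      have i2 : 0 < (P * conj h₂).arg := lt_of_le_of_ne (Complex.arg_nonneg_iff.2 (by linarith))
        (fun hz => by
          have := (Complex.arg_eq_zero_iff.1 hz.symm).2
          linarith)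
      rw [abs_lt, abs_lt]
      refine ⟨⟨?_, ?_⟩, ⟨?_, ?_⟩⟩ <;> linarith [chi.1, hθ.1, hθ.2]
    · have h0' : (P * conj h₂).im = 0 := by linarith
      have i1 : (X * conj h₁).arg = 0 := by
        rw [Complex.arg_eq_zero_iff]
        exact ⟨by
          rcases Complex.mem_slitPlane_iff.1 hs with h | h
          · exact h.le
          · exact absurd h0 h, h0⟩
      have i2 : (P * conj h₂).arg = 0 := by
        rw [Complex.arg_eq_zero_iff]
        exact ⟨by
          rcases Complex.mem_slitPlane_iff.1 ht with h | h
          · exact h.le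
          · exact absurd h0' h, h0'⟩
      rw [i1, i2, zero_add, zero_sub, abs_neg]
      exact ⟨abs_lt.2 hθ, abs_lt.2 hθ⟩
    · have i1 : 0 < (X * conj h₁).arg := lt_of_le_of_ne (Complex.arg_nonneg_iff.2 h0.le)
        (fun hz => by
          have := (Complex.arg_eq_zero_iff.1 hz.symm).2
          linarith)
      have i2 := Complex.arg_neg_iff.2 (by linarith : (P * conj h₂).im < 0)
      rw [abs_lt, abs_lt]
      refine ⟨⟨?_, ?_⟩, ⟨?_, ?_⟩⟩ <;> linarith [chi.2, hθ.1, hθ.2]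
  have r1 := re_mul_pos_of_arg (Complex.slitPlane_ne_zero hs) e0 key.1
  have r2 := re_mul_pos_of_arg (Complex.slitPlane_ne_zero ht) ((map_ne_zero (starRingEnd ℂ)).2 e0)
    (by rw [conjarg, ← sub_eq_add_neg]; exact key.2)
  have f1 : (X * conj h₁ * (h₁ * conj h₂)).re = ‖h₁‖ ^ 2 * (X * conj h₂).re := by
    rw [Complex.sq_norm, Complex.normSq_apply]; simp; ring
  have f2 : (P * conj h₂ * conj (h₁ * conj h₂)).re = ‖h₂‖ ^ 2 * (P * conj h₁).re := by
    rw [Complex.sq_norm, Complex.normSq_apply]; simp; ring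
  rw [f1] at r1
  rw [f2] at r2
  have := pos_of_mul_pos_right r1 n1.le
  have := pos_of_mul_pos_right r2 n2.le
  linarith

end OTData

namespace OTData

variable {R d c : ℝ} {ω : ℂ → ℂ} {D V₁ V₂ : Set ℂ} {y o : ℂ}

/-- The image of `D` in a chart stays out of a downward cone at each boundary point. -/
lemma down_cone (h : OTData R d c ω D V₁ V₂ y) (ho : o ∈ closure D) (hoy : R / 2 ≤ ‖y - o‖)
    {q ζ : ℂ} (hq : q ∈ frontier D) (hqo : ‖q - o‖ < R / 8) (hζ : ζ ∈ D)
    (hw : ‖chart ω y o ζ - chart ω y o q‖ ≤ chartLow R d c * (R / 16)) :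
    R / (4 * d) * -(chart ω y o ζ - chart ω y o q).re ≤ |(chart ω y o ζ - chart ω y o q).im| := by
  set w := chart ω y o ζ - chart ω y o q with hwdef
  by_contra! hc
  have hR := h.R_pos
  have hd : 0 < d := by linarith [h.d_ge]
  have hm := h.chartLow_pos
  have hε : 0 < R / (4 * d) := by positivity
  have hre : w.re < 0 := by
    by_contra! hh
    nlinarith [abs_nonneg w.im]
  have hS := (convex_segment (𝕜 := ℝ) w (w.re : ℂ)).isPreconnected
  have hS' := hS.image (fun v => chart ω y o q + v) (by fun_prop)
  have ex : ∃ q' ∈ frontier D, chart ω y o q' ∈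
      (fun v => chart ω y o q + v) '' segment ℝ w (w.re : ℂ) := by
    by_contra! hne
    have h1 := h.lift_mem ho hoy hS' (w₀ := chart ω y o ζ)
      ⟨w, left_mem_segment _ _ _, by simp [hwdef]⟩ (by rwa [h.inv_chart ho hoy]) hne
      ⟨(w.re : ℂ), right_mem_segment _ _ _, rfl⟩
    have h2 := h.chart_slit ho hoy hq (by linarith) h1
    rw [h.chart_inv ho hoy, Complex.mem_slitPlane_iff] at h2
    simp at h2
    linarith
  obtain ⟨q', hq', v, ⟨a, b, ha, hb, hab, rfl⟩, hv⟩ := ex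
  have e : chart ω y o q' - chart ω y o q = a • w + b • (w.re : ℂ) := by rw [← hv]; simp
  have ere : (chart ω y o q' - chart ω y o q).re = w.re := by
    rw [e]; simp; rw [← add_mul, hab, one_mul]
  have eim : (chart ω y o q' - chart ω y o q).im = a * w.im := by
    rw [e]; simp
  have him : |(chart ω y o q' - chart ω y o q).im| ≤ |w.im| := by
    rw [eim, abs_mul, abs_of_nonneg ha]
    exact mul_le_of_le_one_left (abs_nonneg _) (by linarith)
  have hn : ‖chart ω y o q' - chart ω y o q‖ ≤ ‖w‖ := by
    rw [← sq_le_sq₀ (norm_nonneg _) (norm_nonneg _), Complex.sq_norm, Complex.sq_norm,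
      Complex.normSq_apply, Complex.normSq_apply, ere]
    nlinarith [abs_le_abs_of_nonneg (abs_nonneg _) him, sq_abs w.im,
      sq_abs (chart ω y o q' - chart ω y o q).im, abs_nonneg (chart ω y o q' - chart ω y o q).im]
  have h1 := h.le_chart ho hoy q' q
  have h2 : ‖q' - q‖ ≤ R / 16 := le_of_mul_le_mul_left (h1.trans (hn.trans hw)) hm
  have h3 : ‖q' - o‖ < R / 4 := by
    have : q' - o = (q' - q) + (q - o) := by ring
    rw [this]
    exact (norm_add_le _ _).trans_lt (by linarith)
  have h4 := h.order_abs ho hoy hq (by linarith) hq' h3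
  have h5 := h.chart_le ho q' q
  have h6 := Complex.abs_re_le_norm (chart ω y o q' - chart ω y o q)
  rw [ere, abs_of_neg hre] at h6
  have h7 : R / (4 * d) * -w.re ≤ R / (4 * d) * (d * ‖q' - q‖) :=
    mul_le_mul_of_nonneg_left (h6.trans h5) hε.le
  have h8 : R / (4 * d) * (d * ‖q' - q‖) = R / 4 * ‖q' - q‖ := by field_simp
  linarith

lemma up_mem (h : OTData R d c ω D V₁ V₂ y) (ho : o ∈ closure D) (hoy : R / 2 ≤ ‖y - o‖)
    {ζ v : ℂ} {t : ℝ} (hζ : ζ ∈ closure D) (hζo : ‖ζ - o‖ < R / 16) (ht : 0 < t)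
    (ht1 : t ≤ chartLow R d c * (R / 32)) (hv : ‖v - t‖ < R / (8 * d) * t) :
    chartInv ω y o (chart ω y o ζ + v) ∈ D := by
  have hR := h.R_pos
  have hR1 := h.R_le
  have hd1 := h.d_ge
  have hd : 0 < d := by linarith [h.d_ge]
  have hm := h.chartLow_pos
  have hε3 : R / (8 * d) ≤ 1 / 8 := by
    rw [div_le_div_iff₀ (by positivity) (by norm_num)]; nlinarith
  -- interior points first
  have main : ∀ ζ ∈ D, ‖ζ - o‖ < R / 16 → ∀ v : ℂ, ‖v - t‖ < R / (8 * d) * t →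
      chartInv ω y o (chart ω y o ζ + v) ∈ D := by
    intro ζ hζ hζo v hv
    have near : ∀ q v', chart ω y o q = chart ω y o ζ + v' → ‖v'‖ ≤ 2 * t → ‖q - o‖ < R / 8 := by
      intro q v' e hv'
      have h1 := h.le_chart ho hoy q ζ
      rw [e, add_sub_cancel_left] at h1
      have h2 : ‖q - ζ‖ ≤ R / 16 := by
        refine le_of_mul_le_mul_left (h1.trans (hv'.trans ?_)) hm
        linarith
      have : q - o = (q - ζ) + (ζ - o) := by ring
      rw [this]
      exact (norm_add_le _ _).trans_lt (by linarith)
    have step1 : chartInv ω y o (chart ω y o ζ + t) ∈ D := by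
      refine h.lift_mem ho hoy (S := (fun s : ℝ => chart ω y o ζ + s) '' Icc 0 t)
        (isPreconnected_Icc.image _ (by fun_prop)) (w₀ := chart ω y o ζ)
        ⟨0, ⟨le_rfl, ht.le⟩, by simp⟩ (by rwa [h.inv_chart ho hoy]) ?_ ⟨t, ⟨ht.le, le_rfl⟩, rfl⟩
      rintro q hq ⟨s, hs, e⟩
      have hn := near q s e.symm (by
        rw [Complex.norm_real, Real.norm_of_nonneg hs.1]; linarith [hs.2])
      have h2 := h.chart_slit ho hoy hq (by linarith) hζ
      rw [← e, Complex.mem_slitPlane_iff] at h2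
      simp at h2
      linarith [hs.1]
    refine h.lift_mem ho hoy (S := (fun s : ℂ => chart ω y o ζ + s) '' ball (t : ℂ) (R / (8 * d) * t))
      ((convex_ball _ _).isPreconnected.image _ (by fun_prop)) ⟨t, mem_ball_self (by positivity), rfl⟩
      step1 ?_ ⟨v, by rwa [mem_ball, dist_eq_norm], rfl⟩
    rintro q hq ⟨s, hs, e⟩
    simp only at e
    rw [mem_ball, dist_eq_norm] at hs
    have hs8 : R / (8 * d) * t ≤ 1 / 8 * t := by gcongr
    have hsn : ‖s‖ ≤ 2 * t := by
      have : s = (s - t) + t := by ring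
      rw [this]
      refine (norm_add_le _ _).trans ?_
      rw [Complex.norm_real, Real.norm_of_nonneg ht.le]; linarith
    have hn := near q s e.symm hsn
    have e' : chart ω y o ζ - chart ω y o q = -s := by rw [← e]; ring
    have h2 := h.down_cone ho hoy hq (by linarith) hζ (by
      rw [e', norm_neg]; linarith)
    rw [e'] at h2
    simp only [Complex.neg_re, neg_neg, Complex.neg_im, abs_neg] at h2
    have r1 := Complex.abs_re_le_norm (s - t)
    have r2 := Complex.abs_im_le_norm (s - t)
    simp only [Complex.sub_re, Complex.sub_im, Complex.ofReal_re, Complex.ofReal_im, sub_zero] at r1 r2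
    have r3 := (abs_le.1 r1).1
    have : R / (4 * d) = 2 * (R / (8 * d)) := by field_simp; norm_num
    rw [this] at h2
    have hp : 0 < R / (8 * d) := by positivity
    have : 2 * (R / (8 * d)) * (7 / 8 * t) ≤ 2 * (R / (8 * d)) * s.re := by
      gcongr; linarith
    nlinarith [mul_pos hp ht]
  have hcont : Filter.Tendsto (fun ζ' => ‖v + (chart ω y o ζ - chart ω y o ζ') - t‖)
      (nhdsWithin ζ D) (nhds ‖v - t‖) := by
    have hc := (h.continuous_chart (o := o))
    have : Continuous (fun ζ' => ‖v + (chart ω y o ζ - chart ω y o ζ') - t‖) := by fun_prop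
    have := (this.tendsto ζ).mono_left (nhdsWithin_le_nhds (s := D))
    simpa using this
  have hcont2 : Filter.Tendsto (fun ζ' => ‖ζ' - o‖) (nhdsWithin ζ D) (nhds ‖ζ - o‖) :=
    ((by fun_prop : Continuous (fun ζ' : ℂ => ‖ζ' - o‖)).tendsto ζ).mono_left
      (nhdsWithin_le_nhds (s := D))
  have := mem_closure_iff_nhdsWithin_neBot.1 hζ
  obtain ⟨ζ', h1, h2, h3⟩ := ((hcont.eventually_lt_const hv).and
    ((hcont2.eventually_lt_const hζo).and self_mem_nhdsWithin)).exists
  have := main ζ' h3 h2 _ h1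
  rwa [show chart ω y o ζ' + (v + (chart ω y o ζ - chart ω y o ζ')) = chart ω y o ζ + v by ring]
    at this

lemma up_ball (h : OTData R d c ω D V₁ V₂ y) (ho : o ∈ closure D) (hoy : R / 2 ≤ ‖y - o‖)
    {ζ : ℂ} {t : ℝ} (hζ : ζ ∈ closure D) (hζo : ‖ζ - o‖ < R / 16) (ht : 0 < t)
    (ht1 : t ≤ chartLow R d c * (R / 32)) :
    ball (chartInv ω y o (chart ω y o ζ + t)) (R / (8 * d ^ 2) * t) ⊆ D := by
  intro a ha
  have hd : 0 < d := by linarith [h.d_ge]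
  rw [mem_ball, dist_eq_norm] at ha
  have h1 := h.chart_le ho a (chartInv ω y o (chart ω y o ζ + t))
  rw [h.chart_inv ho hoy] at h1
  have h2 := h.up_mem ho hoy (v := chart ω y o a - chart ω y o ζ) hζ hζo ht ht1 (by
    rw [sub_sub]
    refine h1.trans_lt ?_
    calc d * _ < d * (R / (8 * d ^ 2) * t) := by gcongr
      _ = _ := by field_simp)
  rwa [add_sub_cancel, h.inv_chart ho hoy] at h2

end OTData

lemma chartLow_le_one {R d c : ℝ} {ω : ℂ → ℂ} {D V₁ V₂ : Set ℂ} {y : ℂ}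
    (h : OTData R d c ω D V₁ V₂ y) : chartLow R d c ≤ 1 := by
  have h1 := h.R_pos
  have h2 := h.R_le
  have h3 := h.d_ge
  have h4 := h.c_pos
  have h5 := h.deriv_le
  have h6 := norm_nonneg (deriv ω y)
  unfold chartLow
  rw [div_le_one (by linarith)]
  have : R ^ 2 ≤ 1 := by nlinarith
  nlinarith

/-- Interior positivity: away from the boundary `‖ω'‖` is quantitatively less than one. -/
lemma exists_deep_aux (R d c : ℝ) (n : ℕ) : ∀ r : ℝ, 0 < r → ∃ k > 0,
    ∀ (ω : ℂ → ℂ) (D V₁ V₂ : Set ℂ) (y : ℂ), OTData R d c ω D V₁ V₂ y → ∀ ζ ∈ D, ball ζ r ⊆ D →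
    (‖ζ - y‖ ^ 2 - ‖ω ζ - ω y‖ ^ 2) / 4 ≤
      n * (min (chartLow R d c * (R / 32)) (2 * chartLow R d c ^ 2) / 2) →
    k ≤ 1 - ‖deriv ω ζ‖ := by
  by_cases hdata : ∃ (ω : ℂ → ℂ) (D V₁ V₂ : Set ℂ) (y : ℂ), OTData R d c ω D V₁ V₂ y
  swap
  · intro r hr
    exact ⟨1, one_pos, fun ω D V₁ V₂ y h => (hdata ⟨ω, D, V₁, V₂, y, h⟩).elim⟩
  obtain ⟨ω₀, D₀, V₁₀, V₂₀, y₀, h₀⟩ := hdata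
  have hR := h₀.R_pos
  have hd1 := h₀.d_ge
  have hR1 := h₀.R_le
  have hc := h₀.c_pos
  have hd : 0 < d := by linarith
  have hm := h₀.chartLow_pos
  have hm1 := chartLow_le_one h₀
  set m := chartLow R d c with hmdef
  set s₁ := min (m * (R / 32)) (2 * m ^ 2) with hs₁
  have hs₁pos : 0 < s₁ := by rw [hs₁]; positivity
  have near : ∀ (ω : ℂ → ℂ) (D V₁ V₂ : Set ℂ) (y : ℂ), OTData R d c ω D V₁ V₂ y → ∀ ζ : ℂ,
      ‖ζ - y‖ < R / 2 → c / 3 ≤ 1 - ‖deriv ω ζ‖ := by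
    intro ω D V₁ V₂ y h ζ hζ
    have := (h.harnack_deriv y R hR h.ball_subset ζ (by rw [dist_eq_norm]; exact hζ.le)).2
    linarith [h.deriv_le]
  induction n with
  | zero =>
    intro r hr
    refine ⟨c / 3, by positivity, fun ω D V₁ V₂ y h ζ hζ hb hE => ?_⟩
    by_cases hn : ‖ζ - y‖ < R / 2
    · exact near ω D V₁ V₂ y h ζ hn
    · exfalso
      push Not at hn
      have h1 := h.contract_base (subset_closure hζ)
      rw [norm_sub_rev, norm_sub_rev y] at h1
      have h2 : 0 < c * R / (6 * d) := by positivity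
      have h3 : ‖ω ζ - ω y‖ < ‖ζ - y‖ := by nlinarith
      simp at hE
      nlinarith [norm_nonneg (ω ζ - ω y)]
  | succ n ih =>
    intro r hr
    obtain ⟨k₁, hk₁, H⟩ := ih (R / (8 * d ^ 2) * s₁) (by positivity)
    set ρ := R / (8 * d ^ 2) * (m * (min r 1 / 2)) with hρ
    have hr1 : 0 < min r 1 := by positivity
    have hρpos : 0 < ρ := by positivity
    obtain ⟨N, hN⟩ := exists_nat_ge (s₁ / m / (ρ / 2))
    refine ⟨min (c / 3) (k₁ / 3 ^ (N + 1)), by positivity, fun ω D V₁ V₂ y h ζ hζ hb hE => ?_⟩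
    by_cases hn : ‖ζ - y‖ < R / 2
    · exact (min_le_left _ _).trans (near ω D V₁ V₂ y h ζ hn)
    refine (min_le_right _ _).trans ?_
    push Not at hn
    have ho := subset_closure hζ
    have hoy : R / 2 ≤ ‖y - ζ‖ := by rwa [norm_sub_rev]
    set γ : ℝ → ℂ := fun t => chartInv ω y ζ (chart ω y ζ ζ + t) with hγ
    have hγ0 : γ 0 = ζ := by simp [hγ, h.inv_chart ho hoy]
    have hlip : ∀ s t : ℝ, m * dist (γ s) (γ t) ≤ |s - t| := by
      intro s t
      have := h.inv_le ho hoy (chart ω y ζ ζ + s) (chart ω y ζ ζ + t)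
      rw [dist_eq_norm]
      refine this.trans (le_of_eq ?_)
      rw [add_sub_add_left_eq_sub, ← Complex.ofReal_sub, Complex.norm_real, Real.norm_eq_abs]
    have hsmall : R / (8 * d ^ 2) ≤ 1 := by
      rw [div_le_one (by positivity)]; nlinarith
    have hball : ∀ t ∈ Icc 0 s₁, ball (γ t) ρ ⊆ D := by
      intro t ht
      by_cases htr : t < m * (min r 1 / 2)
      · refine Subset.trans ?_ hb
        refine ball_subset_ball' ?_
        have h1 := hlip t 0
        rw [hγ0, sub_zero, abs_of_nonneg ht.1] at h1
        have h2 : dist (γ t) ζ ≤ min r 1 / 2 := le_of_mul_le_mul_left (h1.trans htr.le) hm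
        have h3 : ρ ≤ 1 * (1 * (min r 1 / 2)) := by rw [hρ]; gcongr
        linarith [min_le_left r 1]
      · push Not at htr
        have := h.up_ball ho hoy (ζ := ζ) (t := t) ho (by simpa using by linarith)
          (lt_of_lt_of_le (by positivity) htr) (ht.2.trans (min_le_left _ _))
        refine (ball_subset_ball ?_).trans this
        rw [hρ]; gcongr
    have hfin := h.up_ball ho hoy (ζ := ζ) (t := s₁) ho (by simpa using by linarith) hs₁pos
      (min_le_left _ _)
    have hs1mem : γ s₁ ∈ D := hfin (mem_ball_self (by positivity))
    have hν := fun ζ => sub_nonneg.2 (h.norm_deriv_le ζ)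
    have chain := Harnack.chain h.harnack_deriv (γ := γ) hρpos (L := 1 / m) N 0 s₁ hs₁pos.le
      hball (fun s _ t _ => by
        rw [one_div, ← div_eq_inv_mul, le_div_iff₀ hm, mul_comm]; exact hlip s t)
      (by
        rw [div_le_iff₀ (by positivity)] at hN
        calc 1 / m * (s₁ - 0) = s₁ / m := by ring
          _ ≤ _ := hN) (by rw [hγ0]; exact hν ζ) (hν _)
    have hk := H ω D V₁ V₂ y h (γ s₁) hs1mem hfin (by
      have e1 := re_srcPt_mul_tgtPt ω (γ s₁) ζ
      have e2 := re_srcPt_mul_tgtPt ω (γ s₁) y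
      have e3 := re_srcPt_mul_tgtPt ω ζ y
      have e4 := chart_sub_re ω y ζ (γ s₁) ζ
      rw [h.chart_inv ho hoy, add_sub_cancel_left, Complex.ofReal_re] at e4
      have e5 := hlip s₁ 0
      rw [hγ0, sub_zero, abs_of_pos hs₁pos, dist_eq_norm] at e5
      have e6 : ‖γ s₁ - ζ‖ ^ 2 ≤ 2 * s₁ := by
        have a1 : (m * ‖γ s₁ - ζ‖) ^ 2 ≤ s₁ ^ 2 := by gcongr
        have a2 : s₁ ≤ 2 * m ^ 2 := min_le_right _ _
        have a3 : m ^ 2 * ‖γ s₁ - ζ‖ ^ 2 ≤ m ^ 2 * (2 * s₁) := by nlinarith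
        exact le_of_mul_le_mul_left a3 (by positivity)
      push_cast at hE
      have e7 := sq_nonneg ‖ω (γ s₁) - ω ζ‖
      simp only [Complex.mul_re, Complex.conj_re, Complex.conj_im, Complex.sub_re,
        Complex.sub_im] at e1 e2 e3 e4
      nlinarith)
    rw [hγ0] at chain
    rw [div_le_iff₀ (by positivity)]
    linarith [chain.2]

lemma exists_deep (R d c r : ℝ) (hr : 0 < r) : ∃ k > 0,
    ∀ (ω : ℂ → ℂ) (D V₁ V₂ : Set ℂ) (y : ℂ), OTData R d c ω D V₁ V₂ y → ∀ ζ ∈ D, ball ζ r ⊆ D →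
    k ≤ 1 - ‖deriv ω ζ‖ := by
  by_cases hs : 0 < min (chartLow R d c * (R / 32)) (2 * chartLow R d c ^ 2) / 2
  · obtain ⟨n, hn⟩ := exists_nat_ge (d ^ 2 / (min (chartLow R d c * (R / 32)) (2 * chartLow R d c ^ 2) / 2))
    obtain ⟨k, hk, H⟩ := exists_deep_aux R d c n r hr
    refine ⟨k, hk, fun ω D V₁ V₂ y h ζ hζ hb => H ω D V₁ V₂ y h ζ hζ hb ?_⟩
    rw [div_le_iff₀ hs] at hn
    have h1 := h.bdd ζ hζ
    have : ‖ζ - y‖ ^ 2 ≤ d ^ 2 := by gcongr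
    nlinarith [sq_nonneg ‖ω ζ - ω y‖, sq_nonneg ‖ζ - y‖]
  · refine ⟨1, one_pos, fun ω D V₁ V₂ y h => (hs ?_).elim⟩
    have := h.chartLow_pos
    have := h.R_pos
    positivity

/-- A normalized local chart at a boundary point `b`, with all constants merged into `ε`. -/
structure LocalChart (ε : ℝ) (ω f g : ℂ → ℂ) (D V₁ V₂ : Set ℂ) (b h₁ h₂ : ℂ) : Prop where
  pos : 0 < ε
  le_quarter : ε ≤ 1 / 4
  isOpen : IsOpen D
  bdd : Bornology.IsBounded D
  lip : ∀ a a', ‖ω a - ω a'‖ ≤ ‖a - a'‖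
  holo : DifferentiableOn ℂ ω D
  chart_cont : Continuous f
  chart_holo : DifferentiableOn ℂ f D
  base_mem : b ∈ frontier D
  chart_base : f b = 0
  chart_inv : ∀ v, f (g v) = v
  chart_le : ∀ a a', ε * ‖f a - f a'‖ ≤ ‖a - a'‖
  le_chart : ∀ a a', ε * ‖a - a'‖ ≤ ‖f a - f a'‖
  strict : ∀ ζ ∈ D, ‖ω ζ - ω b‖ < ‖ζ - b‖
  slit : ∀ ζ ∈ D, ‖f ζ‖ ≤ ε → f ζ ∈ Complex.slitPlane
  cone : ∀ ζ ∈ D, ‖f ζ‖ ≤ ε → ε * -(f ζ).re ≤ |(f ζ).im|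
  boundary : ∀ q ∈ frontier D, ‖f q‖ ≤ ε → ε * ‖q - b‖ ≤ |(f q).im|
  order_pos : ∀ q ∈ frontier D, ‖f q‖ ≤ ε → 0 < (f q).im →
    ε * ‖srcPt ω q - srcPt ω b‖ ≤ ((srcPt ω q - srcPt ω b) * conj h₁).im ∧
    ε * ‖tgtPt ω q - tgtPt ω b‖ ≤ ((tgtPt ω q - tgtPt ω b) * conj h₂).im
  order_neg : ∀ q ∈ frontier D, ‖f q‖ ≤ ε → (f q).im < 0 →
    ε * ‖srcPt ω q - srcPt ω b‖ ≤ -((srcPt ω q - srcPt ω b) * conj h₁).im ∧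
    ε * ‖tgtPt ω q - tgtPt ω b‖ ≤ -((tgtPt ω q - tgtPt ω b) * conj h₂).im
  up : ∀ t : ℝ, 0 < t → t ≤ ε → ball (g t) (ε * t) ⊆ D
  norm_le : ε * ‖h₁‖ ≤ 1 ∧ ε * ‖h₂‖ ≤ 1
  conv₁ : Convex ℝ V₁
  conv₂ : Convex ℝ V₂
  src_fr : ∀ ζ ∈ frontier D, srcPt ω ζ ∈ closure V₁ ∧ srcPt ω ζ ∉ V₁
  tgt_fr : ∀ ζ ∈ frontier D, tgtPt ω ζ ∈ closure V₂ ∧ tgtPt ω ζ ∉ V₂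
  cone₁ : ∀ a ∈ closure V₁, ‖a - srcPt ω b‖ ≤ ε → ∀ s : ℝ, 0 < s → s ≤ 1 → a + s * h₁ ∈ V₁
  cone₂ : ∀ a ∈ closure V₂, ‖a - tgtPt ω b‖ ≤ ε → ∀ s : ℝ, 0 < s → s ≤ 1 → a + s * h₂ ∈ V₂

/-- The merged constant for the local charts. -/
def chartEps (R d c : ℝ) : ℝ := chartLow R d c * R / (32 * d ^ 2)

lemma OTData.chartEps_pos {R d c : ℝ} {ω : ℂ → ℂ} {D V₁ V₂ : Set ℂ} {y : ℂ}
    (h : OTData R d c ω D V₁ V₂ y) : 0 < chartEps R d c := by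
  have := h.chartLow_pos; have := h.R_pos; have := h.d_ge
  unfold chartEps; positivity

lemma OTData.localChart {R d c : ℝ} {ω : ℂ → ℂ} {D V₁ V₂ : Set ℂ} {y o b : ℂ}
    (h : OTData R d c ω D V₁ V₂ y) (ho : o ∈ closure D) (hoy : R / 2 ≤ ‖y - o‖)
    (hb : b ∈ frontier D) (hbo : ‖b - o‖ < R / 32) :
    LocalChart (chartEps R d c) ω (fun ζ => chart ω y o ζ - chart ω y o b)
      (fun v => chartInv ω y o (chart ω y o b + v)) D V₁ V₂ b
      (srcPt ω y - srcPt ω o) (tgtPt ω y - tgtPt ω o) := by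
  have hR := h.R_pos
  have hR1 := h.R_le
  have hd1 := h.d_ge
  have hd : 0 < d := by linarith
  have hm := h.chartLow_pos
  have hm1 := chartLow_le_one h
  have hε := h.chartEps_pos
  have hdd : 1 ≤ d ^ 2 := by nlinarith
  have hmR : chartLow R d c * R ≤ 1 := by nlinarith
  set ε := chartEps R d c with hεdef
  have e1 : ε * (32 * d ^ 2) = chartLow R d c * R := by rw [hεdef, chartEps]; field_simp
  have l1 : ε * 32 ≤ chartLow R d c * R := by nlinarith
  have l2 : ε * (32 * d) ≤ 1 := by nlinarith
  have l3 : ε * (32 * d ^ 2) ≤ R := by nlinarith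
  have l4 : ε ≤ chartLow R d c := by nlinarith
  have l5 : ε * 32 ≤ R := by nlinarith
  have l6 : ε * (32 * d) ≤ R := by nlinarith
  have near : ∀ q, ‖chart ω y o q - chart ω y o b‖ ≤ ε → ‖q - o‖ < R / 16 := by
    intro q hq
    have h1 := h.le_chart ho hoy q b
    have h2 : ‖q - b‖ ≤ R / 32 := le_of_mul_le_mul_left (h1.trans (hq.trans (by linarith))) hm
    have : q - o = (q - b) + (b - o) := by ring
    rw [this]
    exact (norm_add_le _ _).trans_lt (by linarith)
  have hbdd : Bornology.IsBounded D := isBounded_iff_forall_norm_le.2 ⟨d + ‖y‖, fun ζ hζ => by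
    have := h.bdd ζ hζ
    have e : ζ = (ζ - y) + y := by ring
    rw [e]
    exact (norm_add_le _ _).trans (by linarith)⟩
  have hoyd : ‖y - o‖ ≤ d := by
    rw [norm_sub_rev]; exact h.bdd_closure ho
  refine
    { pos := hε
      le_quarter := by nlinarith
      isOpen := h.isOpen
      bdd := hbdd
      lip := h.lip
      holo := h.holo
      chart_cont := h.continuous_chart.sub continuous_const
      chart_holo := ?_
      base_mem := hb
      chart_base := sub_self _
      chart_inv := fun v => by rw [h.chart_inv ho hoy]; ring
      chart_le := fun a a' => ?_
      le_chart := fun a a' => ?_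
      strict := fun ζ hζ => ?_
      slit := fun ζ hζ _ => h.chart_slit ho hoy hb (by linarith) hζ
      cone := fun ζ hζ hw => ?_
      boundary := fun q hq hw => ?_
      order_pos := fun q hq hw hi => ?_
      order_neg := fun q hq hw hi => ?_
      up := fun t ht ht1 => ?_
      norm_le := ⟨?_, ?_⟩
      conv₁ := h.conv₁
      conv₂ := h.conv₂
      src_fr := fun ζ hζ => ⟨frontier_subset_closure (h.src_fr ζ hζ), h.src_notMem hζ⟩
      tgt_fr := fun ζ hζ => ⟨frontier_subset_closure (h.tgt_fr ζ hζ), h.tgt_notMem hζ⟩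
      cone₁ := fun a ha hab s hs hs1 => ?_
      cone₂ := fun a ha hab s hs hs1 => ?_ }
  · have := h.holo
    unfold chart
    fun_prop
  · rw [sub_sub_sub_cancel_right]
    have h1 := h.chart_le ho a a'
    have h2 := norm_nonneg (a - a')
    calc ε * ‖chart ω y o a - chart ω y o a'‖ ≤ ε * (d * ‖a - a'‖) := by gcongr
      _ = (ε * d) * ‖a - a'‖ := by ring
      _ ≤ 1 * ‖a - a'‖ := by gcongr; nlinarith
      _ = _ := one_mul _
  · rw [sub_sub_sub_cancel_right]
    refine le_trans ?_ (h.le_chart ho hoy a a')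
    gcongr
  · obtain ⟨r, hr, hrb⟩ := Metric.isOpen_iff.1 h.isOpen ζ hζ
    obtain ⟨k, hk, H⟩ := exists_deep R d c r hr
    have h1 := h.contract hr hrb (H ω D V₁ V₂ y h ζ hζ hrb) b
    have hne : b ≠ ζ := by
      rintro rfl
      rw [h.isOpen.frontier_eq] at hb
      exact hb.2 hζ
    have h2 : 0 < ‖b - ζ‖ := norm_pos_iff.2 (sub_ne_zero.2 hne)
    rw [norm_sub_rev, norm_sub_rev ζ]
    have : 0 < k / 3 * min ‖b - ζ‖ (r / 2) := by positivity
    linarith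
  · by_cases hre : 0 ≤ -(chart ω y o ζ - chart ω y o b).re
    · refine le_trans ?_ (h.down_cone ho hoy hb (by linarith) hζ (hw.trans (by linarith)))
      gcongr
      rw [le_div_iff₀ (by positivity)]; nlinarith
    · push Not at hre
      nlinarith [abs_nonneg (chart ω y o ζ - chart ω y o b).im]
  · refine le_trans ?_ (h.order_abs ho hoy hb (by linarith) hq (by linarith [near q hw]))
    gcongr; linarith
  · have := h.order_pos ho hoy hb (by linarith) hq (by linarith [near q hw]) hi
    have hh : ε ≤ R / 4 := by linarith
    exact ⟨(by gcongr : _ ≤ _).trans this.1, (by gcongr : _ ≤ _).trans this.2⟩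
  · have := h.order_neg ho hoy hb (by linarith) hq (by linarith [near q hw]) hi
    have hh : ε ≤ R / 4 := by linarith
    exact ⟨(by gcongr : _ ≤ _).trans this.1, (by gcongr : _ ≤ _).trans this.2⟩
  · refine (ball_subset_ball ?_).trans (h.up_ball ho hoy (frontier_subset_closure hb)
      (by linarith) ht (by linarith))
    gcongr
    rw [le_div_iff₀ (by positivity)]; nlinarith
  · have := h.src_lip y o
    nlinarith [norm_nonneg (srcPt ω y - srcPt ω o)]
  · have := h.tgt_lip y o
    nlinarith [norm_nonneg (tgtPt ω y - tgtPt ω o)]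
  · refine cone_mem h.conv₁ h.open₁ ha h.ball₁ (o := srcPt ω o) ?_ (by simpa using by linarith) hs hs1
    have := h.src_lip b o
    have e : a - srcPt ω o = (a - srcPt ω b) + (srcPt ω b - srcPt ω o) := by ring
    rw [e]
    exact (norm_add_le _ _).trans_lt (by linarith)
  · refine cone_mem h.conv₂ h.open₂ ha h.ball₂ (o := tgtPt ω o) ?_ (by simpa using by linarith) hs hs1
    have := h.tgt_lip b o
    have e : a - tgtPt ω o = (a - tgtPt ω b) + (tgtPt ω b - tgtPt ω o) := by ring
    rw [e]
    exact (norm_add_le _ _).trans_lt (by linarith)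

/-- The components of a displacement in the frame `e`: `frameZ = x₁ + i p₂`. -/
def frameZ (ω : ℂ → ℂ) (b e ζ : ℂ) : ℂ := ((ζ - b) * conj e + (ω ζ - ω b) * e) / 2

/-- The components of a displacement in the frame `e`: `framePi = p₁ + i x₂`. -/
def framePi (ω : ℂ → ℂ) (b e ζ : ℂ) : ℂ := ((ζ - b) * conj e - (ω ζ - ω b) * e) / 2

/-- The quotient of the two frame components. -/
def frameU (ω : ℂ → ℂ) (b e ζ : ℂ) : ℂ := frameZ ω b e ζ / framePi ω b e ζ

lemma re_frame {ω : ℂ → ℂ} {b e : ℂ} (he : ‖e‖ = 1) (ζ : ℂ) :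
    (frameZ ω b e ζ * conj (framePi ω b e ζ)).re = (‖ζ - b‖ ^ 2 - ‖ω ζ - ω b‖ ^ 2) / 4 := by
  have h1 : e.re * e.re + e.im * e.im = 1 := by
    rw [← Complex.normSq_apply, ← Complex.sq_norm, he]; norm_num
  rw [Complex.sq_norm, Complex.sq_norm, Complex.normSq_apply, Complex.normSq_apply]
  simp only [frameZ, framePi, Complex.mul_re, Complex.conj_re, Complex.conj_im,
    Complex.div_ofNat_re, Complex.div_ofNat_im, Complex.add_re, Complex.add_im, Complex.mul_im,
    Complex.sub_re, Complex.sub_im]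
  linear_combination ((ζ.re - b.re)^2 + (ζ.im - b.im)^2 - ((ω ζ).re - (ω b).re)^2 -
    ((ω ζ).im - (ω b).im)^2) / 4 * h1

lemma re_div_eq (z p : ℂ) : (z / p).re = (z * conj p).re / Complex.normSq p := by
  rw [Complex.div_re]; simp; ring

lemma frame_add (ω : ℂ → ℂ) {b e : ℂ} (he : ‖e‖ = 1) (ζ : ℂ) :
    ‖frameZ ω b e ζ + framePi ω b e ζ‖ = ‖ζ - b‖ := by
  have : frameZ ω b e ζ + framePi ω b e ζ = (ζ - b) * conj e := by
    simp only [frameZ, framePi]; ring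
  rw [this, norm_mul, RCLike.norm_conj, he, mul_one]

namespace LocalChart

variable {ε : ℝ} {ω f g : ℂ → ℂ} {D V₁ V₂ : Set ℂ} {b h₁ h₂ e : ℂ}

lemma continuous (L : LocalChart ε ω f g D V₁ V₂ b h₁ h₂) : Continuous ω := by
  refine (LipschitzWith.of_dist_le_mul (K := 1) fun a a' => ?_).continuous
  simpa [dist_eq_norm] using L.lip a a'

lemma continuous_frameZ (L : LocalChart ε ω f g D V₁ V₂ b h₁ h₂) : Continuous (frameZ ω b e) := by
  have := L.continuous
  unfold frameZ; fun_prop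

lemma continuous_framePi (L : LocalChart ε ω f g D V₁ V₂ b h₁ h₂) :
    Continuous (framePi ω b e) := by
  have := L.continuous
  unfold framePi; fun_prop

lemma re_frame_pos (L : LocalChart ε ω f g D V₁ V₂ b h₁ h₂) (he : ‖e‖ = 1) {ζ : ℂ} (hζ : ζ ∈ D) :
    0 < (frameZ ω b e ζ * conj (framePi ω b e ζ)).re := by
  rw [re_frame he]
  have := L.strict ζ hζ
  nlinarith [norm_nonneg (ω ζ - ω b)]

lemma framePi_ne (L : LocalChart ε ω f g D V₁ V₂ b h₁ h₂) (he : ‖e‖ = 1) {ζ : ℂ} (hζ : ζ ∈ D) :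
    framePi ω b e ζ ≠ 0 := by
  intro h0
  have := L.re_frame_pos he hζ
  simp [h0] at this

lemma frameU_re_pos (L : LocalChart ε ω f g D V₁ V₂ b h₁ h₂) (he : ‖e‖ = 1) {ζ : ℂ} (hζ : ζ ∈ D) :
    0 < (frameU ω b e ζ).re := by
  rw [frameU, re_div_eq]
  exact div_pos (L.re_frame_pos he hζ) (Complex.normSq_pos.2 (L.framePi_ne he hζ))

lemma frameU_holo (L : LocalChart ε ω f g D V₁ V₂ b h₁ h₂) (he : ‖e‖ = 1) :
    DifferentiableOn ℂ (frameU ω b e) D := by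
  have := L.holo
  unfold frameU
  refine DifferentiableOn.div ?_ ?_ fun ζ hζ => L.framePi_ne he hζ
  · unfold frameZ; fun_prop
  · unfold framePi; fun_prop

lemma harnack_frameU (L : LocalChart ε ω f g D V₁ V₂ b h₁ h₂) (he : ‖e‖ = 1) :
    Harnack D (fun ζ => ‖frameU ω b e ζ‖) :=
  harnack_norm (L.frameU_holo he) fun _ hζ => (L.frameU_re_pos he hζ).le

lemma up_mem (L : LocalChart ε ω f g D V₁ V₂ b h₁ h₂) {t : ℝ} (ht : 0 < t) (ht1 : t ≤ ε) :
    g t ∈ D := L.up t ht ht1 (mem_ball_self (mul_pos L.pos ht))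

end LocalChart

lemma abs_arg_add_le {u : ℂ} {τ : ℝ} (hu : 0 ≤ u.re) (hτ : 0 < τ) :
    |(u + τ).arg| ≤ Real.pi / 2 := by
  rw [Complex.abs_arg_le_pi_div_two_iff]
  simp; linarith

lemma norm_le_norm_add {u : ℂ} {τ : ℝ} (hu : 0 ≤ u.re) (hτ : 0 ≤ τ) :
    ‖u‖ ≤ ‖u + τ‖ ∧ τ ≤ ‖u + τ‖ := by
  constructor
  · rw [← sq_le_sq₀ (norm_nonneg _) (norm_nonneg _), Complex.sq_norm, Complex.sq_norm,
      Complex.normSq_apply, Complex.normSq_apply]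
    simp; nlinarith
  · have := Complex.re_le_norm (u + τ)
    simp at this; linarith

/-- The imaginary part relation on the level line bounds each of its terms. -/
lemma window_im {κ l s t A τ : ℝ} {w u : ℂ} (hκ : 0 ≤ κ) (hl : 0 ≤ l) (hs : 0 < s) (ht : 0 ≤ t)
    (hA : |A| ≤ 1 / 4) (hτ : 0 < τ) (hu : 0 ≤ u.re)
    (him : A - t * w.im / ‖w‖ ^ 2 - l * w.im / s - κ * w.arg + (u + τ).arg = 0) :
    t * |w.im| / ‖w‖ ^ 2 ≤ 2 ∧ l * |w.im| / s ≤ 2 := by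
  have h1 := abs_le.1 (abs_arg_add_le hu hτ)
  have h2 := abs_le.1 hA
  have h3 := Real.pi_lt_d2
  rcases le_or_gt 0 w.im with hi | hi
  · have h4 : 0 ≤ κ * w.arg := mul_nonneg hκ (Complex.arg_nonneg_iff.2 hi)
    rw [abs_of_nonneg hi]
    have h5 : 0 ≤ t * w.im / ‖w‖ ^ 2 := by positivity
    have h6 : 0 ≤ l * w.im / s := by positivity
    constructor <;> linarith
  · have h4 : κ * w.arg ≤ 0 := mul_nonpos_of_nonneg_of_nonpos hκ (Complex.arg_neg_iff.2 hi).le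
    rw [abs_of_neg hi]
    have h5 : 0 ≤ t * -w.im / ‖w‖ ^ 2 := by have : 0 ≤ -w.im := by linarith
                                            positivity
    have h6 : 0 ≤ l * -w.im / s := by have : 0 ≤ -w.im := by linarith
                                      positivity
    have e5 : t * -w.im / ‖w‖ ^ 2 = -(t * w.im / ‖w‖ ^ 2) := by ring
    have e6 : l * -w.im / s = -(l * w.im / s) := by ring
    constructor <;> linarith

lemma re_ge_half {ε : ℝ} {w : ℂ} (hε : 0 < ε) (hε1 : ε ≤ 1 / 4)
    (hcone : ε * -w.re ≤ |w.im|) (hi : |w.im| < ε ^ 2 / 4 * ‖w‖) : ‖w‖ / 2 ≤ w.re := by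
  have h1 := Complex.norm_le_abs_re_add_abs_im w
  have hw : 0 < ‖w‖ := by
    by_contra! h0
    have : ε ^ 2 / 4 * ‖w‖ ≤ 0 := mul_nonpos_of_nonneg_of_nonpos (by positivity) h0
    linarith [abs_nonneg w.im]
  have hre : 0 ≤ w.re := by
    by_contra! h0
    rw [abs_of_neg h0] at h1
    have k1 : ε * ‖w‖ ≤ (1 + ε) * |w.im| := by nlinarith
    have k2 : (1 + ε) * |w.im| ≤ 2 * (ε ^ 2 / 4 * ‖w‖) :=
      mul_le_mul (by linarith) hi.le (abs_nonneg _) (by norm_num)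
    have k3 : ε * ‖w‖ * ε ≤ ε * ‖w‖ * (1 / 4) := by gcongr
    have k4 : 0 < ε * ‖w‖ := by positivity
    nlinarith
  rw [abs_of_nonneg hre] at h1
  have k1 : ε ^ 2 / 4 * ‖w‖ ≤ 1 / 4 * ‖w‖ := by
    gcongr
    nlinarith
  linarith

/-- Estimates along the level line in one window. -/
lemma window_point {ε κ ρ s t A τ : ℝ} {w u : ℂ} (hε : 0 < ε) (hε1 : ε ≤ 1 / 4) (hκ : 0 < κ)
    (ht : 0 < t) (hts : t ≤ s) (hρ : s ≤ ρ * t) (hw : ‖w‖ ≤ s)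
    (hws : w ≠ 0) (hcone : ε * -w.re ≤ |w.im|) (hu : 0 ≤ u.re)
    (hτ : 0 < τ) (hA : |A| ≤ 1 / 4)
    (him : A - t * w.im / ‖w‖ ^ 2 - 12 / ε ^ 2 * w.im / s - κ * w.arg + (u + τ).arg = 0)
    (hre : t * w.re / ‖w‖ ^ 2 - 12 / ε ^ 2 * w.re / s - κ * Real.log ‖w‖ + Real.log ‖u + τ‖ ≤
      1 - κ * Real.log t + Real.log (2 * τ)) :
    ε ^ 2 / 40 * t ≤ ‖w‖ ∧
      Real.log ‖u + τ‖ ≤ 1 + 52 / ε ^ 2 + κ * Real.log ρ + Real.log (2 * τ) := by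
  have hs : 0 < s := by linarith
  have hwp : 0 < ‖w‖ := norm_pos_iff.2 hws
  have hi := (window_im hκ.le (by positivity) hs ht.le hA hτ hu him).1
  have hε2 : 0 < ε ^ 2 := by positivity
  have hlast : 12 / ε ^ 2 * w.re / s ≤ 12 / ε ^ 2 := by
    rw [div_le_iff₀ hs]
    have := Complex.re_le_norm w
    have : w.re ≤ s := by linarith
    gcongr
  have low : ε ^ 2 / 40 * t ≤ ‖w‖ := by
    by_contra! hc
    have hwt : ‖w‖ < t := hc.trans_le (by
      have : ε ^ 2 ≤ 1 := by nlinarith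
      nlinarith)
    rcases le_or_gt (ε ^ 2 / 4 * ‖w‖) |w.im| with hcase | hcase
    · rw [div_le_iff₀ (by positivity)] at hi
      have : t * (ε ^ 2 / 4 * ‖w‖) ≤ 2 * ‖w‖ ^ 2 := le_trans (by gcongr) hi
      have : t * (ε ^ 2 / 4) ≤ 2 * ‖w‖ := by
        refine le_of_mul_le_mul_right ?_ hwp; nlinarith
      nlinarith
    · have h1 := re_ge_half hε hε1 hcone hcase
      have h2 : t / (2 * ‖w‖) ≤ t * w.re / ‖w‖ ^ 2 := by
        rw [div_le_div_iff₀ (by positivity) (by positivity)]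
        have : t * ‖w‖ * ‖w‖ ≤ t * (2 * w.re) * ‖w‖ := by gcongr; linarith
        nlinarith
      have h3 : Real.log (2 * τ) ≤ Real.log ‖u + τ‖ + Real.log 2 := by
        rw [Real.log_mul (by norm_num) hτ.ne']
        have := Real.log_le_log hτ (norm_le_norm_add hu hτ.le).2
        linarith
      have h4 : κ * Real.log ‖w‖ ≤ κ * Real.log t := by
        gcongr
      have h5 := Real.log_two_lt_d9
      have h6 : t / (2 * ‖w‖) ≤ 2 + 12 / ε ^ 2 := by linarith
      rw [div_le_iff₀ (by positivity)] at h6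
      have h7 : (2 + 12 / ε ^ 2) * (2 * ‖w‖) ≤ (2 + 12 / ε ^ 2) * (2 * (ε ^ 2 / 40 * t)) := by
        gcongr
      have h8 : (2 + 12 / ε ^ 2) * (2 * (ε ^ 2 / 40 * t)) = (ε ^ 2 / 10 + 24 / 40) * t := by
        field_simp; ring
      have : ε ^ 2 ≤ 1 := by nlinarith
      nlinarith
  refine ⟨low, ?_⟩
  have h1 : -(40 / ε ^ 2) ≤ t * w.re / ‖w‖ ^ 2 := by
    have h2 := (abs_le.1 (Complex.abs_re_le_norm w)).1
    rw [← neg_div, div_le_div_iff₀ (by positivity) (by positivity)]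
    have h3 : t * ε ^ 2 ≤ 40 * ‖w‖ := by linarith
    have h4 : t * (-‖w‖) * ε ^ 2 ≤ t * w.re * ε ^ 2 := by gcongr
    nlinarith
  have h2 : κ * Real.log ‖w‖ ≤ κ * (Real.log ρ + Real.log t) := by
    rw [← Real.log_mul (by rintro rfl; linarith) ht.ne']
    gcongr
    linarith
  have : 52 / ε ^ 2 = 40 / ε ^ 2 + 12 / ε ^ 2 := by ring
  linarith

lemma abs_arg_le_of_small {u : ℂ} {τ μ : ℝ} (hu : 0 ≤ u.re) (hτ : 0 < τ) (hn : ‖u‖ ≤ μ * τ) :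
    |(u + τ).arg| ≤ 2 * μ := by
  have h1 := abs_arg_add_le hu hτ
  have h2 := Real.mul_abs_le_abs_sin h1
  rw [Complex.sin_arg] at h2
  have h3 : |(u + τ).im / ‖u + τ‖| ≤ μ := by
    have hp := (norm_le_norm_add hu hτ.le).2
    rw [abs_div, abs_of_nonneg (norm_nonneg _), div_le_iff₀ (by linarith)]
    have h4 := Complex.abs_im_le_norm u
    have hμ : 0 ≤ μ := by
      by_contra! hc
      nlinarith [norm_nonneg u]
    simp only [Complex.add_im, Complex.ofReal_im, add_zero]
    nlinarith
  have h5 := Real.pi_lt_four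
  have h6 : 1 / 2 ≤ 2 / Real.pi := by
    rw [div_le_div_iff₀ (by norm_num) Real.pi_pos]; linarith
  nlinarith [abs_nonneg (u + τ).arg]

lemma im_ge_of_arg_ge {v : ℂ} {T : ℝ} (hre : 0 < v.re) (hT : 0 < T) (ha : T ≤ v.arg) :
    T * v.re ≤ v.im := by
  have h1 : v.arg < Real.pi / 2 := (abs_lt.1 (Complex.abs_arg_lt_pi_div_two_iff.2 (Or.inl hre))).2
  have h2 := Real.le_tan (x := v.arg) (by linarith) h1
  rw [Complex.tan_arg, le_div_iff₀ hre] at h2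
  nlinarith

lemma im_le_of_arg_le {v : ℂ} {T : ℝ} (hre : 0 < v.re) (hT : 0 < T) (ha : v.arg ≤ -T) :
    T * v.re ≤ -v.im := by
  have h0 : v.arg ≠ Real.pi := by linarith [Real.pi_pos]
  have := im_ge_of_arg_ge (v := conj v) (T := T) (by simpa) hT (by
    rw [Complex.arg_conj, if_neg h0]; linarith)
  simpa using this

/-- `sin` of the argument is dominated by the argument. -/
lemma im_div_le_arg {w : ℂ} (hi : 0 ≤ w.im) : w.im / ‖w‖ ≤ w.arg := by
  rw [← Complex.sin_arg]
  exact Real.sin_le (Complex.arg_nonneg_iff.2 hi)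

lemma arg_le_im_div {w : ℂ} (hi : w.im < 0) : w.arg ≤ w.im / ‖w‖ := by
  rw [← Complex.sin_arg]
  have := Real.sin_le (x := -w.arg) (by linarith [Complex.arg_neg_iff.2 hi])
  rw [Real.sin_neg] at this
  linarith

/-- The level function in one window. -/
def windowFun (κ s t A τ l : ℝ) (w u : ℂ) : ℂ :=
  A * Complex.I + t / w - (l / s : ℝ) * w - κ * Complex.log w + Complex.log (u + τ)

lemma windowFun_im (κ s t A τ l : ℝ) (w u : ℂ) : (windowFun κ s t A τ l w u).im =
    A - t * w.im / ‖w‖ ^ 2 - l * w.im / s - κ * w.arg + (u + τ).arg := by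
  simp only [windowFun, Complex.add_im, Complex.sub_im, Complex.im_ofReal_mul,
    Complex.log_im, Complex.I_im, Complex.div_im, Complex.ofReal_re, Complex.ofReal_im, Complex.sq_norm]
  ring

lemma windowFun_re (κ s t A τ l : ℝ) (w u : ℂ) : (windowFun κ s t A τ l w u).re =
    t * w.re / ‖w‖ ^ 2 - l * w.re / s - κ * Real.log ‖w‖ + Real.log ‖u + τ‖ := by
  simp only [windowFun, Complex.add_re, Complex.sub_re, Complex.re_ofReal_mul,
    Complex.log_re, Complex.I_re, Complex.div_re, Complex.ofReal_re, Complex.ofReal_im, Complex.sq_norm]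
  ring

lemma norm_sub_norm_le_im {w : ℂ} (h : 0 ≤ w.re) : ‖w - ‖w‖‖ ≤ 2 * |w.im| := by
  have h1 := Complex.norm_le_abs_re_add_abs_im w
  have h2 := Complex.norm_le_abs_re_add_abs_im (w - ‖w‖)
  have h3 := Complex.re_le_norm w
  simp only [Complex.sub_re, Complex.sub_im, Complex.ofReal_re, Complex.ofReal_im, sub_zero] at h2
  rw [abs_of_nonpos (by linarith)] at h2
  rw [abs_of_nonneg h] at h1
  linarith

namespace LocalChart

variable {ε : ℝ} {ω f g : ℂ → ℂ} {D V₁ V₂ : Set ℂ} {b h₁ h₂ e : ℂ}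

set_option maxHeartbeats 800000 in
/-- One window of the iteration: a drop of `frameU` from scale `s` to scale `s / ρ` forces a
boundary point where the frame components are nearly degenerate. -/
lemma window (L : LocalChart ε ω f g D V₁ V₂ b h₁ h₂) (he : ‖e‖ = 1) {κ ρ s τ : ℝ} (hκ : 0 < κ)
    (hκ1 : κ ≤ 1) (hρ : 1 < ρ) (hs : 0 < s) (hsε : s ≤ ε) (hτ : 0 < τ)
    (hU : 6 * (Real.exp (1 + 12 / ε ^ 2 + κ * Real.log ρ) * τ) < ‖frameU ω b e (g s)‖)
    (hu₀ : ‖frameU ω b e (g (s / ρ : ℝ))‖ ≤ κ * ε ^ 2 / 10 * τ) :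
    ∃ q ∈ frontier D, ε ^ 2 / 40 * (s / ρ) ≤ ‖f q‖ ∧ ‖f q‖ ≤ s ∧ ∃ u : ℂ,
      frameZ ω b e q = u * framePi ω b e q ∧ 0 ≤ u.re ∧
      ‖u‖ ≤ 2 * (Real.exp (1 + 52 / ε ^ 2 + κ * Real.log ρ) * τ) ∧
      (0 < (f q).im ∧ κ * ε ^ 2 / 2 * (u.re + τ) ≤ u.im ∨
        (f q).im < 0 ∧ κ * ε ^ 2 / 2 * (u.re + τ) ≤ -u.im) := by
  have hε := L.pos
  have hε1 := L.le_quarter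
  set t := s / ρ with ht
  have hρ0 : 0 < ρ := by linarith
  have htp : 0 < t := by positivity
  have hts : t < s := div_lt_self hs hρ
  have hρt : s = ρ * t := by rw [ht]; field_simp
  set ζ₀ := g (t : ℝ) with hζ₀
  have hζ₀D : ζ₀ ∈ D := L.up_mem htp (by linarith)
  set u := frameU ω b e with hu
  set A := -(u ζ₀ + τ).arg with hA
  have hε2 : ε ^ 2 ≤ 1 / 16 := by nlinarith
  have hε2p : 0 < ε ^ 2 := by positivity
  have hAle : |A| ≤ κ * ε ^ 2 / 5 := by
    rw [hA, abs_neg]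
    refine (abs_arg_le_of_small (L.frameU_re_pos he hζ₀D).le hτ hu₀).trans (by linarith)
  have hA4 : |A| ≤ 1 / 4 := hAle.trans (by nlinarith)
  set F : ℂ → ℂ := fun ζ => windowFun κ s t A τ (12 / ε ^ 2) (f ζ) (u ζ) with hF
  set O : Set ℂ := D ∩ {ζ | ‖f ζ‖ < s} with hO
  have hOopen : IsOpen O := L.isOpen.inter (isOpen_lt L.chart_cont.norm continuous_const)
  have hdiff : DifferentiableOn ℂ F O := by
    have d1 := L.chart_holo.mono (inter_subset_left : O ⊆ D)
    have d2 := (L.frameU_holo he).mono (inter_subset_left : O ⊆ D)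
    have k1 : ∀ ζ ∈ O, f ζ ∈ Complex.slitPlane := fun ζ hζ => L.slit ζ hζ.1 (by
      have : ‖f ζ‖ < s := hζ.2
      linarith)
    have k2 : ∀ ζ ∈ O, u ζ + τ ∈ Complex.slitPlane := fun ζ hζ =>
      Complex.mem_slitPlane_iff.2 (Or.inl (by
        have := L.frameU_re_pos he hζ.1
        simp; linarith))
    simp only [hF, windowFun]
    refine DifferentiableOn.add (DifferentiableOn.sub (DifferentiableOn.sub
      (DifferentiableOn.add (differentiableOn_const _) ?_) ?_) ?_) ?_
    · exact (differentiableOn_const _).div d1 fun ζ hζ => Complex.slitPlane_ne_zero (k1 ζ hζ)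
    · exact d1.const_mul _
    · exact (d1.clog k1).const_mul _
    · exact (d2.add_const _).clog k2
  have hfζ₀ : f ζ₀ = t := L.chart_inv _
  have hζ₀O : ζ₀ ∈ O := ⟨hζ₀D, by
    change ‖f ζ₀‖ < s
    rw [hfζ₀, Complex.norm_real, Real.norm_of_nonneg htp.le]; exact hts⟩
  have him₀ : (F ζ₀).im = 0 := by
    simp only [hF, windowFun_im, hfζ₀]
    rw [Complex.arg_ofReal_of_nonneg htp.le]
    simp [hA]
  have hre₀ : (F ζ₀).re ≤ 1 - κ * Real.log t + Real.log (2 * τ) := by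
    simp only [hF, windowFun_re, hfζ₀]
    rw [Complex.norm_real, Real.norm_of_nonneg htp.le, Complex.ofReal_re]
    have e1 : t * t / t ^ 2 = 1 := by field_simp
    have e2 : 0 ≤ 12 / ε ^ 2 * t / s := by positivity
    have e3 : Real.log ‖u ζ₀ + τ‖ ≤ Real.log (2 * τ) := by
      have := (norm_le_norm_add (L.frameU_re_pos he hζ₀D).le hτ.le).2
      refine Real.log_le_log (by linarith) ((norm_add_le _ _).trans ?_)
      rw [Complex.norm_real, Real.norm_of_nonneg hτ.le]
      have : κ * ε ^ 2 / 10 ≤ 1 := by nlinarith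
      nlinarith
    linarith
  obtain ⟨q, hqO, hqS⟩ := exists_level_ray_exit hOopen (L.bdd.subset inter_subset_left) hdiff
    hζ₀O him₀
  set S := {z | z ∈ O ∧ (F z).im = 0 ∧ (F z).re ≤ (F ζ₀).re} with hS
  have pt : ∀ ζ ∈ S, ε ^ 2 / 40 * t ≤ ‖f ζ‖ ∧
      Real.log ‖u ζ + τ‖ ≤ 1 + 52 / ε ^ 2 + κ * Real.log ρ + Real.log (2 * τ) := by
    rintro ζ ⟨hζO, hi, hr⟩
    have hfs : ‖f ζ‖ < s := hζO.2
    have a1 := hr.trans hre₀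
    simp only [hF, windowFun_im] at hi
    simp only [hF, windowFun_re] at a1
    exact window_point hε hε1 hκ htp hts.le hρt.le hfs.le
      (Complex.slitPlane_ne_zero (L.slit ζ hζO.1 (by linarith))) (L.cone ζ hζO.1 (by linarith))
      (L.frameU_re_pos he hζO.1).le hτ hA4 hi a1
  set B := 2 * (Real.exp (1 + 52 / ε ^ 2 + κ * Real.log ρ) * τ) with hB
  have hBlog : ∀ v : ℂ, 0 ≤ v.re →
      Real.log ‖v + τ‖ ≤ 1 + 52 / ε ^ 2 + κ * Real.log ρ + Real.log (2 * τ) → ‖v‖ ≤ B := by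
    intro v hv hl
    have n1 := norm_le_norm_add hv hτ.le
    refine n1.1.trans ?_
    rw [Real.log_le_iff_le_exp (by linarith), Real.exp_add, Real.exp_log (by linarith)] at hl
    rw [hB]; linarith
  -- closed conditions pass to the exit point
  have c1 : ε ^ 2 / 40 * t ≤ ‖f q‖ := closure_minimal
    (s := S) (t := {ζ | ε ^ 2 / 40 * t ≤ ‖f ζ‖}) (fun ζ hζ => (pt ζ hζ).1)
    (isClosed_le continuous_const L.chart_cont.norm) hqS
  have c2 : ‖f q‖ ≤ s := closure_minimal
    (s := S) (t := {ζ | ‖f ζ‖ ≤ s}) (fun ζ hζ => show ‖f ζ‖ ≤ s from le_of_lt hζ.1.2)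
    (isClosed_le L.chart_cont.norm continuous_const) hqS
  have cZ := L.continuous_frameZ (e := e)
  have cP := L.continuous_framePi (e := e)
  have c3 : ‖frameZ ω b e q‖ ≤ B * ‖framePi ω b e q‖ := closure_minimal
    (s := S) (t := {ζ | ‖frameZ ω b e ζ‖ ≤ B * ‖framePi ω b e ζ‖}) (fun ζ hζ => by
      have h1 := hBlog (u ζ) (L.frameU_re_pos he hζ.1.1).le (pt ζ hζ).2
      have h2 := norm_pos_iff.2 (L.framePi_ne he hζ.1.1)
      rwa [hu, frameU, norm_div, div_le_iff₀ h2] at h1)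
    (isClosed_le cZ.norm (continuous_const.mul cP.norm)) hqS
  have c4 : 0 ≤ (frameZ ω b e q * conj (framePi ω b e q)).re := closure_minimal
    (s := S) (t := {ζ | 0 ≤ (frameZ ω b e ζ * conj (framePi ω b e ζ)).re})
    (fun ζ hζ => (L.re_frame_pos he hζ.1.1).le)
    (isClosed_le continuous_const (by fun_prop)) hqS
  have hfq : 0 < ‖f q‖ := lt_of_lt_of_le (by positivity) c1
  have hqb : 0 < ‖q - b‖ := by
    have := L.chart_le q b
    rw [L.chart_base, sub_zero] at this
    exact lt_of_lt_of_le (by positivity) this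
  have hPq : framePi ω b e q ≠ 0 := by
    intro h0
    have h1 := frame_add ω (b := b) he q
    rw [h0, norm_zero, mul_zero] at c3
    rw [norm_le_zero_iff.1 c3, h0] at h1
    simp at h1
    linarith
  have huq : 0 ≤ (u q).re := by
    rw [hu, frameU, re_div_eq]; exact div_nonneg c4 (Complex.normSq_nonneg _)
  have hcl : q ∈ closure D := closure_mono (fun ζ hζ => hζ.1.1) hqS
  -- the exit point satisfies the level relations once the chart value is in the slit plane
  have level : f q ∈ Complex.slitPlane → (F q).im = 0 ∧ (F q).re ≤ (F ζ₀).re := by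
    intro hsl
    have k2 : u q + τ ∈ Complex.slitPlane := Complex.mem_slitPlane_iff.2 (Or.inl (by simp; linarith))
    have hcf : ContinuousAt f q := L.chart_cont.continuousAt
    have hcu : ContinuousAt u q := cZ.continuousAt.div cP.continuousAt hPq
    have hc : ContinuousAt F q := by
      simp only [hF, windowFun]
      refine ContinuousAt.add (ContinuousAt.sub (ContinuousAt.sub
        (ContinuousAt.add continuousAt_const ?_) ?_) ?_) ?_
      · exact continuousAt_const.div hcf (Complex.slitPlane_ne_zero hsl)
      · exact continuousAt_const.mul hcf
      · exact continuousAt_const.mul (hcf.clog hsl)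
      · exact (hcu.add continuousAt_const).clog k2
    have := mem_closure_iff_nhdsWithin_neBot.1 hqS
    have hc' := Filter.Tendsto.mono_left hc (nhdsWithin_le_nhds (s := S))
    constructor
    · refine tendsto_nhds_unique ((Complex.continuous_im.tendsto _).comp hc') ?_
      refine tendsto_const_nhds.congr' ?_
      filter_upwards [self_mem_nhdsWithin] with ζ hζ using hζ.2.1.symm
    · refine le_of_tendsto ((Complex.continuous_re.tendsto _).comp hc') ?_
      filter_upwards [self_mem_nhdsWithin] with ζ hζ using hζ.2.2
  by_cases hqD : q ∈ D
  · exfalso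
    have hfs : ‖f q‖ = s := by
      refine le_antisymm c2 ?_
      by_contra! hlt
      rw [hOopen.frontier_eq] at hqO
      exact hqO.2 ⟨hqD, hlt⟩
    obtain ⟨li, lr⟩ := level (L.slit q hqD (by linarith))
    have lr' := lr.trans hre₀
    simp only [hF, windowFun_im] at li
    simp only [hF, windowFun_re] at lr'
    have wi := (window_im hκ.le (by positivity) hs htp.le hA4 hτ huq li).2
    have hcore : |(f q).im| < ε ^ 2 / 4 * ‖f q‖ := by
      by_contra! hc
      rw [hfs] at hc
      rw [div_le_iff₀ hs] at wi
      have : 12 / ε ^ 2 * (ε ^ 2 / 4 * s) ≤ 2 * s := le_trans (by gcongr) wi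
      have e : 12 / ε ^ 2 * (ε ^ 2 / 4 * s) = 3 * s := by field_simp; norm_num
      linarith
    have hre := re_ge_half hε hε1 (L.cone q hqD (by linarith)) hcore
    have hdist : dist q (g s) ≤ ε * s / 2 := by
      have h1 := L.le_chart q (g s)
      rw [L.chart_inv] at h1
      have h2 := norm_sub_norm_le_im (w := f q) (by linarith)
      rw [hfs] at h2 hcore
      rw [dist_eq_norm]
      refine le_of_mul_le_mul_left ?_ hε
      nlinarith
    have hh := (L.harnack_frameU he (g s) (ε * s) (by positivity) (L.up s hs hsε) q hdist).2
    simp only at hh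
    have n1 := norm_le_norm_add huq hτ.le
    have hup : 0 < ‖u q‖ := by
      have : 0 < 6 * (Real.exp (1 + 12 / ε ^ 2 + κ * Real.log ρ) * τ) := by positivity
      linarith
    have g1 : Real.log ‖u q‖ ≤ Real.log ‖u q + τ‖ := Real.log_le_log hup n1.1
    have g2 : 0 ≤ t * (f q).re / ‖f q‖ ^ 2 := by
      have : 0 ≤ (f q).re := by linarith
      positivity
    have g3 : 12 / ε ^ 2 * (f q).re / s ≤ 12 / ε ^ 2 := by
      rw [div_le_iff₀ hs]
      have := Complex.re_le_norm (f q)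
      have : (f q).re ≤ s := by linarith
      gcongr
    have g4 : Real.log ‖f q‖ = Real.log ρ + Real.log t := by
      rw [hfs, ← Real.log_mul hρ0.ne' htp.ne', ← hρt]
    rw [g4] at lr'
    have g5 : Real.log ‖u q‖ ≤ 1 + 12 / ε ^ 2 + κ * Real.log ρ + Real.log (2 * τ) := by linarith
    rw [Real.log_le_iff_le_exp hup, Real.exp_add, Real.exp_log (by linarith)] at g5
    linarith
  · have hqF : q ∈ frontier D := by rw [L.isOpen.frontier_eq]; exact ⟨hcl, hqD⟩
    have hbd := L.boundary q hqF (c2.trans hsε)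
    have hbd' : ε ^ 2 * ‖f q‖ ≤ |(f q).im| := by
      have := L.chart_le q b
      rw [L.chart_base, sub_zero] at this
      nlinarith
    have hne : (f q).im ≠ 0 := by
      intro h0
      rw [h0, abs_zero] at hbd'
      have : 0 < ε ^ 2 * ‖f q‖ := by positivity
      linarith
    obtain ⟨li, lr⟩ := level (Complex.mem_slitPlane_iff.2 (Or.inr hne))
    have hvre : 0 < (u q + τ).re := by simp; linarith
    refine ⟨q, hqF, c1, c2, u q, ?_, huq, ?_, ?_⟩
    · rw [hu, frameU, div_mul_cancel₀ _ hPq]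
    · rw [hu, frameU, norm_div, div_le_iff₀ (norm_pos_iff.2 hPq)]
      exact c3
    · simp only [hF, windowFun_im] at li
      have hAb := abs_le.1 hAle
      have hkp : 0 < κ * ε ^ 2 := by positivity
      rcases lt_or_gt_of_ne hne with hi | hi
      · right
        refine ⟨hi, ?_⟩
        have a1 : κ * (f q).arg ≤ -(κ * ε ^ 2) := by
          have h2 : (f q).im / ‖f q‖ ≤ -ε ^ 2 := by
            rw [div_le_iff₀ hfq]; rw [abs_of_neg hi] at hbd'; linarith
          have := (arg_le_im_div hi).trans h2
          nlinarith
        have a2 : t * (f q).im / ‖f q‖ ^ 2 ≤ 0 :=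
          div_nonpos_of_nonpos_of_nonneg (mul_nonpos_of_nonneg_of_nonpos htp.le hi.le) (by positivity)
        have a3 : 12 / ε ^ 2 * (f q).im / s ≤ 0 :=
          div_nonpos_of_nonpos_of_nonneg
            (mul_nonpos_of_nonneg_of_nonpos (by positivity) hi.le) hs.le
        have := im_le_of_arg_le (T := κ * ε ^ 2 / 2) hvre (by positivity) (by linarith)
        simpa using this
      · left
        refine ⟨hi, ?_⟩
        have a1 : κ * ε ^ 2 ≤ κ * (f q).arg := by
          have h2 : ε ^ 2 ≤ (f q).im / ‖f q‖ := by
            rw [le_div_iff₀ hfq]; rwa [abs_of_pos hi] at hbd'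
          have := h2.trans (im_div_le_arg hi.le)
          nlinarith
        have a2 : 0 ≤ t * (f q).im / ‖f q‖ ^ 2 := by positivity
        have a3 : 0 ≤ 12 / ε ^ 2 * (f q).im / s := by positivity
        have := im_ge_of_arg_ge (T := κ * ε ^ 2 / 2) hvre (by positivity) (by linarith)
        simpa using this

end LocalChart

lemma frame_algebra {x₁ x₂ p₁ p₂ ξ η τ T B : ℝ} (hT : 0 < T) (hT1 : T ≤ 1)
    (hξ : 0 ≤ ξ) (hξB : ξ ≤ B) (hηB : η ≤ B) (hη : T * (ξ + τ) ≤ η) (hτ : 0 < τ)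
    (hB : B * (1 + 1 / T) ≤ 1)
    (h1 : x₁ = ξ * p₁ - η * x₂) (h2 : p₂ = ξ * x₂ + η * p₁) (hne : x₂ ≠ 0 ∨ p₁ ≠ 0) :
    (∃ a, T * τ ≤ a ∧ a ≤ B * (1 + 1 / T) ∧ x₁ = -a * x₂ ∧
      T * (|x₁| + |x₂| + |p₁| + |p₂|) ≤ 5 * |x₂|) ∨
    (∃ a, T * τ ≤ a ∧ a ≤ B * (1 + 1 / T) ∧ p₂ = a * p₁ ∧
      T * (|x₁| + |x₂| + |p₁| + |p₂|) ≤ 5 * |p₁|) := by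
  have hTi : 0 < 1 / T := by positivity
  have hη0 : 0 ≤ η := le_trans (by positivity) hη
  have hB0 : 0 ≤ B := hξ.trans hξB
  have hB1 : B ≤ 1 := by nlinarith
  have bound : ∀ r : ℝ, -T ≤ r → r ≤ 1 / T → T * τ ≤ η + ξ * r ∧ η + ξ * r ≤ B * (1 + 1 / T) := by
    intro r hr1 hr2
    constructor
    · nlinarith
    · have : ξ * r ≤ B * (1 / T) := (mul_le_mul_of_nonneg_left hr2 hξ).trans (by gcongr)
      linarith
  by_cases hc : (x₂ * p₁ ≤ 0 ∧ T * |p₁| ≤ |x₂|) ∨ (0 < x₂ * p₁ ∧ |p₁| < T * |x₂|)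
  · left
    have hx2 : x₂ ≠ 0 := by
      rintro rfl
      rcases hc with hc | hc
      · rw [abs_zero] at hc
        have : |p₁| ≤ 0 := by nlinarith [hc.2, abs_nonneg p₁]
        exact hne.elim (fun h => h rfl) (fun h => h (abs_nonpos_iff.1 this))
      · simp at hc
    have hx2p : 0 < |x₂| := abs_pos.2 hx2
    have hrr : T * |p₁| ≤ |x₂| := by
      rcases hc with hc | hc
      · exact hc.2
      · nlinarith [hc.2, abs_nonneg p₁]
    have hb := bound (-(p₁ / x₂)) (by
        rw [neg_le_neg_iff]
        rcases hc with hc | hc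
        · refine le_trans ?_ hT.le
          have : p₁ / x₂ = x₂ * p₁ / x₂ ^ 2 := by field_simp
          rw [this]
          exact div_nonpos_of_nonpos_of_nonneg hc.1 (by positivity)
        · refine (le_abs_self _).trans ?_
          rw [abs_div, div_le_iff₀ hx2p]; exact hc.2.le)
      (by
        refine (neg_le_abs _).trans ?_
        rw [abs_div, div_le_div_iff₀ hx2p hT]; linarith)
    refine ⟨_, hb.1, hb.2, ?_, ?_⟩
    · rw [h1]; field_simp; ring
    · have k1 : |x₁| ≤ |x₂| := by
        have : x₁ = -(η + ξ * -(p₁ / x₂)) * x₂ := by rw [h1]; field_simp; ring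
        rw [this, abs_mul, abs_neg, abs_of_nonneg (le_trans (by positivity) hb.1)]
        nlinarith [hb.2]
      have k2 : |p₂| ≤ |x₂| + |p₁| := by
        rw [h2]
        refine (abs_add_le _ _).trans ?_
        rw [abs_mul, abs_mul, abs_of_nonneg hξ, abs_of_nonneg hη0]
        nlinarith [abs_nonneg p₁]
      nlinarith
  · right
    push Not at hc
    have hq : T * |x₂| ≤ |p₁| := by
      rcases le_or_gt (x₂ * p₁) 0 with h0 | h0
      · have := hc.1 h0
        nlinarith [abs_nonneg x₂, abs_nonneg p₁]
      · exact hc.2 h0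
    have hp1 : p₁ ≠ 0 := by
      rintro rfl
      rw [abs_zero] at hq
      have : |x₂| ≤ 0 := by nlinarith [abs_nonneg x₂]
      exact hne.elim (fun h => h (abs_nonpos_iff.1 this)) (fun h => h rfl)
    have hp1p : 0 < |p₁| := abs_pos.2 hp1
    have hb := bound (x₂ / p₁) (by
        rcases le_or_gt (x₂ * p₁) 0 with h0 | h0
        · have := hc.1 h0
          refine le_trans ?_ (neg_abs_le _)
          rw [neg_le_neg_iff, abs_div, div_le_iff₀ hp1p]; exact this.le
        · have : x₂ / p₁ = x₂ * p₁ / p₁ ^ 2 := by field_simp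
          rw [this]
          refine le_trans (by linarith : -T ≤ 0) (by positivity))
      (by
        refine (le_abs_self _).trans ?_
        rw [abs_div, div_le_div_iff₀ hp1p hT]; linarith)
    refine ⟨_, hb.1, hb.2, ?_, ?_⟩
    · rw [h2]; field_simp; ring
    · have k1 : |p₂| ≤ |p₁| := by
        have : p₂ = (η + ξ * (x₂ / p₁)) * p₁ := by rw [h2]; field_simp; ring
        rw [this, abs_mul, abs_of_nonneg (le_trans (by positivity) hb.1)]
        nlinarith [hb.2]
      have k2 : |x₁| ≤ |p₁| + |x₂| := by
        rw [h1]
        refine (abs_sub _ _).trans ?_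
        rw [abs_mul, abs_mul, abs_of_nonneg hξ, abs_of_nonneg hη0]
        nlinarith [abs_nonneg x₂]
      nlinarith

lemma src_eq_frame {ω : ℂ → ℂ} {b e : ℂ} (he : ‖e‖ = 1) (q : ℂ) : srcPt ω q - srcPt ω b =
    e * ((frameZ ω b e q).re + (framePi ω b e q).im * Complex.I) := by
  have h1 : e.re * e.re + e.im * e.im = 1 := by
    rw [← Complex.normSq_apply, ← Complex.sq_norm, he]; norm_num
  apply Complex.ext
  · simp only [frameZ, framePi, Complex.mul_re, Complex.conj_re, Complex.conj_im,
      Complex.div_ofNat_re, Complex.div_ofNat_im, Complex.add_re, Complex.add_im, Complex.mul_im,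
      Complex.sub_re, Complex.sub_im, srcPt_re, Complex.I_re, Complex.I_im,
      Complex.ofReal_re, Complex.ofReal_im]
    linear_combination -(q.re - b.re + (ω q).re - (ω b).re) / 2 * h1
  · simp only [frameZ, framePi, Complex.mul_re, Complex.conj_re, Complex.conj_im,
      Complex.div_ofNat_re, Complex.div_ofNat_im, Complex.add_re, Complex.add_im, Complex.mul_im,
      Complex.sub_re, Complex.sub_im, srcPt_im, Complex.I_re, Complex.I_im,
      Complex.ofReal_re, Complex.ofReal_im]
    linear_combination -(q.im - b.im - (ω q).im + (ω b).im) / 2 * h1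

lemma tgt_eq_frame {ω : ℂ → ℂ} {b e : ℂ} (he : ‖e‖ = 1) (q : ℂ) : tgtPt ω q - tgtPt ω b =
    e * ((framePi ω b e q).re + (frameZ ω b e q).im * Complex.I) := by
  have h1 : e.re * e.re + e.im * e.im = 1 := by
    rw [← Complex.normSq_apply, ← Complex.sq_norm, he]; norm_num
  apply Complex.ext
  · simp only [frameZ, framePi, Complex.mul_re, Complex.conj_re, Complex.conj_im,
      Complex.div_ofNat_re, Complex.div_ofNat_im, Complex.add_re, Complex.add_im, Complex.mul_im,
      Complex.sub_re, Complex.sub_im, tgtPt_re, Complex.I_re, Complex.I_im,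
      Complex.ofReal_re, Complex.ofReal_im]
    linear_combination -(q.re - b.re - (ω q).re + (ω b).re) / 2 * h1
  · simp only [frameZ, framePi, Complex.mul_re, Complex.conj_re, Complex.conj_im,
      Complex.div_ofNat_re, Complex.div_ofNat_im, Complex.add_re, Complex.add_im, Complex.mul_im,
      Complex.sub_re, Complex.sub_im, tgtPt_im, Complex.I_re, Complex.I_im,
      Complex.ofReal_re, Complex.ofReal_im]
    linear_combination -(q.im - b.im + (ω q).im - (ω b).im) / 2 * h1

/-- The displacement `Y` to a boundary point on the side `σ` is nearly parallel to `v`,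
with slope in `[lo, hi]`. -/
def NearParallel (ε σ lo hi : ℝ) (v hv Y : ℂ) : Prop :=
  ε * ‖Y‖ ≤ σ * (Y * conj hv).im ∧
    ∃ a r : ℝ, lo ≤ a ∧ a ≤ hi ∧ Y = r * (v * (1 + σ * a * Complex.I))

set_option maxHeartbeats 1600000 in
/-- Slopes of nearly parallel boundary displacements of a convex set are monotone. -/
lemma NearParallel.slope_le {V : Set ℂ} (hV : Convex ℝ V) {ε σ lo hi lo' hi' : ℝ} {P h v Y Y' : ℂ}
    (hε : 0 < ε) (hσ : σ ^ 2 = 1) (hv : ‖v‖ = 1) (hP : P ∈ closure V)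
    (hY : P + Y ∈ closure V) (hY' : P + Y' ∉ V)
    (hcone : ∀ a ∈ closure V, ‖a - P‖ ≤ ε → ∀ s : ℝ, 0 < s → s ≤ 1 → a + s * h ∈ V)
    (hh : ε * ‖h‖ ≤ 1) (hlo : 0 ≤ lo) (hlo' : 0 ≤ lo') (hhi : hi < ε ^ 2) (hhi' : hi' < ε ^ 2)
    (hY0 : Y ≠ 0) (hY0' : Y' ≠ 0) (hle : ‖Y'‖ ≤ ε ^ 2 * ‖Y‖) (hYε : ‖Y‖ ≤ ε / 2)
    (H : NearParallel ε σ lo hi v h Y) (H' : NearParallel ε σ lo' hi' v h Y') : lo ≤ hi' := by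
  obtain ⟨ht, a, r, ha, ha2, e⟩ := H
  obtain ⟨ht', a', r', ha', ha2', e'⟩ := H'
  refine ha.trans (le_trans ?_ ha2')
  have hYp := norm_pos_iff.2 hY0
  have hYp' := norm_pos_iff.2 hY0'
  have hσ1 : |σ| = 1 := by rwa [← sq_eq_sq₀ (abs_nonneg _) zero_le_one, sq_abs, one_pow]
  set t := σ * (Y * conj h).im with htd
  set t' := σ * (Y' * conj h).im with htd'
  have tp : 0 < t := lt_of_lt_of_le (by positivity) ht
  have tp' : 0 < t' := lt_of_lt_of_le (by positivity) ht'
  have tle : ∀ Z : ℂ, σ * (Z * conj h).im ≤ ‖Z‖ * ‖h‖ := by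
    intro Z
    refine (le_abs_self _).trans ?_
    rw [abs_mul, hσ1, one_mul]
    refine (Complex.abs_im_le_norm _).trans ?_
    rw [norm_mul, RCLike.norm_conj]
  have hhε : ε ≤ ‖h‖ := le_of_mul_le_mul_left (by linarith [tle Y, ht] : ‖Y‖ * ε ≤ ‖Y‖ * ‖h‖) hYp
  have hhp : 0 < ‖h‖ := by linarith
  have htt : t' ≤ t := by
    have h1 := tle Y'
    have h2 : ‖Y'‖ * ‖h‖ ≤ ε ^ 2 * ‖Y‖ * ‖h‖ := by gcongr
    have h3 : ε ^ 2 * ‖Y‖ * ‖h‖ ≤ ε * ‖Y‖ := by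
      have : ε * ‖Y‖ * (ε * ‖h‖) ≤ ε * ‖Y‖ * 1 := by gcongr
      nlinarith
    linarith
  set ρ := t' / t with hρ
  have hρ0 : 0 < ρ := by positivity
  have hρ1 : ρ ≤ 1 := by rw [hρ, div_le_one tp]; exact htt
  set Z := Y' - ρ * Y with hZ
  have hZim : (Z * conj h).im = 0 := by
    have h1 : σ * (Z * conj h).im = t' - ρ * t := by
      rw [hZ, htd, htd', sub_mul, Complex.sub_im, mul_assoc, Complex.im_ofReal_mul]; ring
    rw [hρ, div_mul_cancel₀ _ tp.ne', sub_self] at h1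
    rcases mul_eq_zero.1 h1 with h2 | h2
    · rw [h2] at hσ1; simp at hσ1
    · exact h2
  set k := (Z * conj h).re / ‖h‖ ^ 2 with hk
  have hZk : Z = k * h := by
    have h0 : h ≠ 0 := norm_pos_iff.1 hhp
    have h1 : Z * conj h = ((Z * conj h).re : ℂ) := by
      apply Complex.ext <;> simp [hZim]
    have h2 : h * conj h = ((‖h‖ ^ 2 : ℝ) : ℂ) := by
      rw [Complex.mul_conj, Complex.normSq_eq_norm_sq]
    have h3 : conj h ≠ 0 := (map_ne_zero _).2 h0
    refine mul_right_cancel₀ h3 ?_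
    rw [mul_assoc, h2, h1, hk, ← Complex.ofReal_mul, div_mul_cancel₀ _ (by positivity)]
  have hk0 : k ≤ 0 := by
    by_contra! hkp
    have hk1 : k ≤ 1 := by
      have h1 : ‖Z‖ ≤ ‖Y'‖ + ‖Y‖ := by
        refine (norm_sub_le _ _).trans ?_
        rw [norm_mul, Complex.norm_real, Real.norm_of_nonneg hρ0.le]
        nlinarith
      rw [hZk, norm_mul, Complex.norm_real, Real.norm_of_nonneg hkp.le] at h1
      by_contra! hc
      nlinarith
    have hmem : P + ρ * Y ∈ closure V := by
      have := hV.closure hP hY (by linarith : 0 ≤ 1 - ρ) hρ0.le (by ring)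
      have e : (1 - ρ) • P + ρ • (P + Y) = P + ρ * Y := by
        simp only [Complex.real_smul]; push_cast; ring
      rwa [e] at this
    have := hcone _ hmem (by
      rw [add_sub_cancel_left, norm_mul, Complex.norm_real, Real.norm_of_nonneg hρ0.le]
      nlinarith) k hkp hk1
    rw [← hZk, hZ] at this
    exact hY' (by convert this using 1; ring)
  have hw : σ * (Y' * conj Y).im = -k * t := by
    have : Y' = ρ * Y + k * h := by rw [← hZk, hZ]; ring
    rw [this, htd]
    simp only [Complex.mul_re, Complex.mul_im, Complex.add_re, Complex.add_im, Complex.conj_re,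
      Complex.conj_im, Complex.ofReal_re, Complex.ofReal_im]
    ring
  have hv1 : v.re * v.re + v.im * v.im = 1 := by
    rw [← Complex.normSq_apply, ← Complex.sq_norm, hv]; norm_num
  have hw2 : σ * (Y' * conj Y).im = r' * r * (a' - a) := by
    rw [e, e']
    simp only [Complex.mul_re, Complex.mul_im, Complex.add_re, Complex.add_im, Complex.conj_re,
      Complex.conj_im, Complex.ofReal_re, Complex.ofReal_im, Complex.I_re, Complex.I_im,
      Complex.one_re, Complex.one_im]
    linear_combination r' * r * (a' - a) * hv1 * σ ^ 2 + r' * r * (a' - a) * hσ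
  have sgn : ∀ (Y : ℂ) (a r : ℝ), Y = r * (v * (1 + σ * a * Complex.I)) → 0 ≤ a → a < ε ^ 2 →
      ε * ‖Y‖ ≤ σ * (Y * conj h).im → Y ≠ 0 → 0 < r * (σ * (v * conj h).im) := by
    intro Y a r e ha0 ha ht h0
    have hr : r ≠ 0 := by rintro rfl; simp at e; exact h0 e
    have h1 : σ * (Y * conj h).im = r * (σ * (v * conj h).im) + r * (a * (v * conj h).re) := by
      rw [e]
      simp only [Complex.mul_re, Complex.mul_im, Complex.add_re, Complex.add_im, Complex.conj_re,
        Complex.conj_im, Complex.ofReal_re, Complex.ofReal_im, Complex.I_re, Complex.I_im,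
        Complex.one_re, Complex.one_im]
      linear_combination r * a * (v.re * h.re + v.im * h.im) * hσ
    have h2 : |r| ≤ ‖Y‖ := by
      rw [e, norm_mul, norm_mul, hv, one_mul, Complex.norm_real, Real.norm_eq_abs]
      have : (1 : ℝ) ≤ ‖(1 + σ * a * Complex.I : ℂ)‖ := by
        have := Complex.re_le_norm (1 + σ * a * Complex.I : ℂ)
        simpa using this
      nlinarith [abs_nonneg r]
    have h3 : |(v * conj h).re| ≤ ‖h‖ := by
      refine (Complex.abs_re_le_norm _).trans ?_
      rw [norm_mul, RCLike.norm_conj, hv, one_mul]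
    have hrp : 0 < |r| := abs_pos.2 hr
    have h4 : r * (a * (v * conj h).re) < ε * |r| := by
      refine (le_abs_self _).trans_lt ?_
      rw [abs_mul, abs_mul, abs_of_nonneg ha0, mul_comm]
      refine mul_lt_mul_of_pos_right ?_ hrp
      calc a * |(v * conj h).re| ≤ a * ‖h‖ := by gcongr
        _ < ε ^ 2 * ‖h‖ := by gcongr
        _ = ε * (ε * ‖h‖) := by ring
        _ ≤ ε * 1 := by gcongr
        _ = ε := mul_one _
    have h5 : ε * |r| ≤ ε * ‖Y‖ := by gcongr
    linarith
  have s1 := sgn Y a r e (hlo.trans ha) (ha2.trans_lt hhi) ht hY0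
  have s2 := sgn Y' a' r' e' (hlo'.trans ha') (ha2'.trans_lt hhi') ht' hY0'
  have hrr : 0 < r' * r := by
    set z := σ * (v * conj h).im
    have : 0 < (r' * r) * z ^ 2 := by nlinarith
    exact pos_of_mul_pos_left this (sq_nonneg _)
  have h3 : 0 ≤ r' * r * (a' - a) := by
    rw [← hw2, hw]; nlinarith
  have := nonneg_of_mul_nonneg_right h3 hrr
  linarith

/-- Growth estimate for a sequence whose exceptional steps are controlled by types. -/
lemma iterate_types {ι : Type*} [DecidableEq ι] {m : ℕ → ℝ} {A B K : ℝ} {bad : ℕ → ι → Prop}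
    (hA1 : 1 ≤ A) (hB1 : 1 ≤ B) (hK1 : 1 ≤ K) (hm : ∀ n, 0 < m n)
    (hA : ∀ n, m (n + 1) ≤ A * m n) (hB : ∀ n, (∀ i, ¬ bad n i) → m (n + 1) ≤ B * m n)
    (hK : ∀ k l i, k + 2 ≤ l → bad k i → bad l i → m l ≤ K * m k) (S : Finset ι) :
    ∀ N i j : ℕ, j ≤ i + N → i ≤ j → (∀ k, i ≤ k → k < j → ∀ τ, bad k τ → τ ∈ S) →
      m j ≤ m i * B ^ (j - i) * (A ^ 2 * K) ^ S.card := by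
  have hQ : 1 ≤ A ^ 2 * K := one_le_mul_of_one_le_of_one_le (one_le_pow₀ hA1) hK1
  induction S using Finset.strongInduction with
  | H S ihS =>
  intro N
  induction N with
  | zero =>
    intro i j hj hij _
    obtain rfl : i = j := by omega
    simp only [Nat.sub_self, pow_zero, mul_one]
    exact le_mul_of_one_le_right (hm i).le (one_le_pow₀ hQ)
  | succ N ihN =>
    intro i j hj hij hS
    rcases hij.eq_or_lt with rfl | hlt
    · simp only [Nat.sub_self, pow_zero, mul_one]
      exact le_mul_of_one_le_right (hm i).le (one_le_pow₀ hQ)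
    by_cases hbad : ∀ τ, ¬ bad i τ
    · have h1 := ihN (i + 1) j (by omega) (by omega) fun k hk => hS k (by omega)
      have h2 := hB i hbad
      have e : j - i = (j - (i + 1)) + 1 := by omega
      rw [e, pow_succ]
      calc m j ≤ _ := h1
        _ ≤ (B * m i) * B ^ (j - (i + 1)) * (A ^ 2 * K) ^ S.card := by gcongr
        _ = _ := by ring
    · push Not at hbad
      obtain ⟨τ, hτ⟩ := hbad
      have hτS := hS i le_rfl hlt τ hτ
      obtain ⟨l, hl, hmax⟩ : ∃ l, (i ≤ l ∧ l < j ∧ bad l τ) ∧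
          ∀ k, l < k → k < j → ¬ bad k τ := by
        classical
        have hne : ((Finset.range j).filter fun l => i ≤ l ∧ bad l τ).Nonempty :=
          ⟨i, by simp [hlt, hτ]⟩
        refine ⟨Finset.max' _ hne, ?_, fun k hk1 hk2 hb => ?_⟩
        · have := Finset.max'_mem _ hne
          simp only [Finset.mem_filter, Finset.mem_range] at this
          tauto
        · have h0 := Finset.max'_mem _ hne
          simp only [Finset.mem_filter, Finset.mem_range] at h0
          have := Finset.le_max' ((Finset.range j).filter fun l => i ≤ l ∧ bad l τ) k (by
            simp only [Finset.mem_filter, Finset.mem_range]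
            exact ⟨hk2, by omega, hb⟩)
          omega
      obtain ⟨hil, hlj, hbl⟩ := hl
      have hstep : m (l + 1) ≤ A ^ 2 * K * m i := by
        have h0 := (hm i).le
        have hAA : A ≤ A ^ 2 := by nlinarith
        rcases Nat.lt_or_ge l (i + 2) with h2 | h2
        · have : m (l + 1) ≤ A ^ 2 * m i := by
            obtain rfl | rfl : l = i ∨ l = i + 1 := by omega
            · exact (hA l).trans (by gcongr)
            · refine (hA (i + 1)).trans ?_
              have := hA i
              calc A * m (i + 1) ≤ A * (A * m i) := by gcongr
                _ = _ := by ring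
          refine this.trans ?_
          rw [mul_right_comm]
          exact le_mul_of_one_le_right (by positivity) hK1
        · calc m (l + 1) ≤ A * m l := hA l
            _ ≤ A ^ 2 * (K * m i) := by
                have := hK i l τ h2 hτ hbl
                have := (hm l).le
                gcongr
            _ = _ := by ring
      have h1 := ihS (S.erase τ) (Finset.erase_ssubset hτS) (j - (l + 1)) (l + 1) j (by omega)
        (by omega) fun k hk1 hk2 τ' hb => by
          refine Finset.mem_erase.2 ⟨?_, hS k (by omega) hk2 τ' hb⟩
          rintro rfl
          exact hmax k (by omega) hk2 hb
      rw [Finset.card_erase_of_mem hτS] at h1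
      have hc : S.card = (S.card - 1) + 1 := by
        have := Finset.card_pos.2 ⟨τ, hτS⟩
        omega
      rw [hc, pow_succ]
      calc m j ≤ _ := h1
        _ ≤ (A ^ 2 * K * m i) * B ^ (j - i) * (A ^ 2 * K) ^ (S.card - 1) := by
            have := hm i
            gcongr
            omega
        _ = _ := by ring

/-- The displacement from `b` to `q` in the source (`true`) or the target (`false`). -/
def disp (ω : ℂ → ℂ) (b : ℂ) (i : Bool) (q : ℂ) : ℂ :=
  cond i (srcPt ω q - srcPt ω b) (tgtPt ω q - tgtPt ω b)

/-- The frame direction to which bad displacements are nearly parallel. -/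
def badDir (e : ℂ) (i : Bool) : ℂ := cond i (Complex.I * e) e

/-- The sign of a side of the base point. -/
def sideSign (j : Bool) : ℝ := cond j 1 (-1)

/-- There is a boundary point whose displacement of size in `[rlo, rhi]` is nearly parallel to
the frame direction of type `ty`, with slope in `[lo, hi]`. -/
def BadAt (ε : ℝ) (ω : ℂ → ℂ) (D : Set ℂ) (b h₁ h₂ e : ℂ) (ty : Bool × Bool)
    (lo hi rlo rhi : ℝ) : Prop :=
  ∃ q ∈ frontier D, rlo ≤ ‖disp ω b ty.1 q‖ ∧ ‖disp ω b ty.1 q‖ ≤ rhi ∧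
    NearParallel ε (sideSign ty.2) lo hi (badDir e ty.1) (cond ty.1 h₁ h₂) (disp ω b ty.1 q)

namespace LocalChart

variable {ε : ℝ} {ω f g : ℂ → ℂ} {D V₁ V₂ : Set ℂ} {b h₁ h₂ e : ℂ}

lemma norm_disp_le (L : LocalChart ε ω f g D V₁ V₂ b h₁ h₂) (i : Bool) (q : ℂ) :
    ‖disp ω b i q‖ ≤ ‖q - b‖ := by
  have h0 := L.lip q b
  have key : ∀ z : ℂ, ‖z‖ ≤ ‖q - b‖ + ‖ω q - ω b‖ → ‖z / 2‖ ≤ ‖q - b‖ := by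
    intro z hz
    rw [norm_div]; norm_num; linarith
  cases i
  · have e : disp ω b false q = ((q - b) - conj (ω q - ω b)) / 2 := by
      simp only [disp, cond_false, tgtPt, map_sub]; ring
    rw [e]
    refine key _ ((norm_sub_le _ _).trans ?_)
    rw [RCLike.norm_conj]
  · have e : disp ω b true q = ((q - b) + conj (ω q - ω b)) / 2 := by
      simp only [disp, cond_true, srcPt, map_sub]; ring
    rw [e]
    refine key _ ((norm_add_le _ _).trans ?_)
    rw [RCLike.norm_conj]

lemma badAt_of_slope (L : LocalChart ε ω f g D V₁ V₂ b h₁ h₂) (he : ‖e‖ = 1) {T τ B r s σ : ℝ}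
    {j : Bool} (hj : sideSign j = σ) {q u : ℂ} (hq : q ∈ frontier D)
    (hr : 0 < r) (hrq : r ≤ ‖q - b‖) (hs : ‖q - b‖ ≤ s)
    (hT : 0 < T) (hT1 : T ≤ 1) (hτ : 0 < τ) (hB : B * (1 + 1 / T) ≤ 1)
    (hu : frameZ ω b e q = u * framePi ω b e q) (hure : 0 ≤ u.re) (huB : ‖u‖ ≤ B)
    (hs1 : σ ^ 2 = 1)
    (ho : ∀ i, ε * ‖disp ω b i q‖ ≤ σ * (disp ω b i q * conj (cond i h₁ h₂)).im)
    (him : T * (u.re + τ) ≤ σ * u.im) :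
    ∃ ty, BadAt ε ω D b h₁ h₂ e ty (T * τ) (B * (1 + 1 / T)) (T / 5 * r) s := by
  set Z := frameZ ω b e q with hZ
  set Pi := framePi ω b e q with hPi
  have hadd : ‖Z + Pi‖ = ‖q - b‖ := frame_add ω he q
  have hX : srcPt ω q - srcPt ω b = e * (Z.re + Pi.im * Complex.I) := src_eq_frame he q
  have hP : tgtPt ω q - tgtPt ω b = e * (Pi.re + Z.im * Complex.I) := tgt_eq_frame he q
  have hqs : ‖q - b‖ ≤ |Z.re| + |Pi.im| + |Pi.re| + |Z.im| := by
    rw [← hadd]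
    have h1 := norm_add_le Z Pi
    have h2 := Complex.norm_le_abs_re_add_abs_im Z
    have h3 := Complex.norm_le_abs_re_add_abs_im Pi
    linarith
  have hσa : |σ| = 1 := by rwa [← sq_eq_sq₀ (abs_nonneg _) zero_le_one, sq_abs, one_pow]
  have hσ0 : σ ≠ 0 := by rintro rfl; simp at hs1
  have hne : σ * Pi.im ≠ 0 ∨ Pi.re ≠ 0 := by
    by_contra! hc
    have h0 : Pi = 0 := Complex.ext hc.2 (by simpa [hσ0] using hc.1)
    rw [hu, h0] at hadd
    simp only [mul_zero, add_zero, norm_zero] at hadd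
    linarith
  have h1 : Z.re = u.re * Pi.re - (σ * u.im) * (σ * Pi.im) := by
    rw [hu, Complex.mul_re]; linear_combination u.im * Pi.im * hs1
  have h2 : σ * Z.im = u.re * (σ * Pi.im) + (σ * u.im) * Pi.re := by
    rw [hu, Complex.mul_im]; ring
  have key := frame_algebra (B := B) hT hT1 hure ((Complex.re_le_norm u).trans huB) (by
    refine (le_abs_self _).trans ?_
    rw [abs_mul, hσa, one_mul]
    exact (Complex.abs_im_le_norm u).trans huB) him hτ hB h1 h2 hne
  simp only [abs_mul, hσa, one_mul] at key
  have hTr : T * r ≤ T * (|Z.re| + |Pi.im| + |Pi.re| + |Z.im|) := by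
    gcongr; linarith
  rcases key with ⟨a, ha1, ha2, hxa, hlow⟩ | ⟨a, ha1, ha2, hxa, hlow⟩
  · refine ⟨(true, j), q, hq, ?_, (L.norm_disp_le _ _).trans hs, ?_, a, Pi.im, ha1, ha2, ?_⟩
    · have : |Pi.im| ≤ ‖disp ω b true q‖ := by
        simp only [disp, cond_true]
        rw [hX, norm_mul, he, one_mul]
        have := Complex.abs_im_le_norm ((Z.re : ℂ) + Pi.im * Complex.I)
        simpa using this
      simp only at this ⊢
      linarith
    · rw [hj]; exact ho true
    · simp only [disp, cond_true, badDir, hj]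
      rw [hX, hxa]
      push_cast
      linear_combination (-e * Pi.im * σ * a) * Complex.I_mul_I
  · refine ⟨(false, j), q, hq, ?_, (L.norm_disp_le _ _).trans hs, ?_, a, Pi.re, ha1, ha2, ?_⟩
    · have : |Pi.re| ≤ ‖disp ω b false q‖ := by
        simp only [disp, cond_false]
        rw [hP, norm_mul, he, one_mul]
        have := Complex.abs_re_le_norm ((Pi.re : ℂ) + Z.im * Complex.I)
        simpa using this
      simp only at this ⊢
      linarith
    · rw [hj]; exact ho false
    · simp only [disp, cond_false, badDir, hj]
      have : Z.im = σ * a * Pi.re := by linear_combination σ * hxa - Z.im * hs1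
      rw [hP, this]
      push_cast
      ring

/-- Either the quotient keeps its size on the next scale, or there is a bad boundary point. -/
lemma step_or_badAt (L : LocalChart ε ω f g D V₁ V₂ b h₁ h₂) (he : ‖e‖ = 1) {κ ρ s τ T B : ℝ}
    (hκ : 0 < κ) (hκ1 : κ ≤ 1) (hρ : 1 < ρ) (hs : 0 < s) (hsε : s ≤ ε) (hτ : 0 < τ)
    (hT : T = κ * ε ^ 2 / 2) (hBd : B = 2 * (Real.exp (1 + 52 / ε ^ 2 + κ * Real.log ρ) * τ))
    (hB : B * (1 + 1 / T) ≤ 1)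
    (hU : 6 * (Real.exp (1 + 12 / ε ^ 2 + κ * Real.log ρ) * τ) < ‖frameU ω b e (g s)‖) :
    κ * ε ^ 2 / 10 * τ < ‖frameU ω b e (g (s / ρ : ℝ))‖ ∨
    ∃ ty, BadAt ε ω D b h₁ h₂ e ty (T * τ) (B * (1 + 1 / T))
      (T / 5 * (ε * (ε ^ 2 / 40 * (s / ρ)))) (s / ε) := by
  by_cases hc : κ * ε ^ 2 / 10 * τ < ‖frameU ω b e (g (s / ρ : ℝ))‖
  · exact Or.inl hc
  right
  push Not at hc
  have hε := L.pos
  have hε4 := L.le_quarter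
  have hTp : 0 < T := by rw [hT]; positivity
  have hT1 : T ≤ 1 := by rw [hT]; nlinarith
  obtain ⟨q, hq, hq1, hq2, u, hu, hure, hun, him⟩ := L.window he hκ hκ1 hρ hs hsε hτ hU hc
  rw [← hBd] at hun
  rw [← hT] at him
  have hb0 := L.chart_base
  have k1 : ε * ‖f q‖ ≤ ‖q - b‖ := by simpa [hb0] using L.chart_le q b
  have k2 : ‖q - b‖ ≤ s / ε := by
    rw [le_div_iff₀ hε, mul_comm]
    have := L.le_chart q b
    rw [hb0, sub_zero] at this
    linarith
  have k3 : ε * (ε ^ 2 / 40 * (s / ρ)) ≤ ‖q - b‖ := le_trans (by gcongr) k1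
  have hrp : 0 < ε * (ε ^ 2 / 40 * (s / ρ)) := by positivity
  have hqε : ‖f q‖ ≤ ε := hq2.trans hsε
  rcases him with ⟨hi, him⟩ | ⟨hi, him⟩
  · refine L.badAt_of_slope he (j := true) (σ := 1) rfl hq hrp k3 k2 hTp hT1 hτ hB hu hure hun
      (by norm_num) (fun i => ?_) (by linarith)
    have := L.order_pos q hq hqε hi
    cases i
    · simpa [disp] using this.2
    · simpa [disp] using this.1
  · refine L.badAt_of_slope he (j := false) (σ := -1) rfl hq hrp k3 k2 hTp hT1 hτ hB hu hure hun
      (by norm_num) (fun i => ?_) (by linarith)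
    have := L.order_neg q hq hqε hi
    cases i
    · simpa [disp] using this.2
    · simpa [disp] using this.1

lemma slope_le_of_badAt (L : LocalChart ε ω f g D V₁ V₂ b h₁ h₂) (he : ‖e‖ = 1)
    {ty : Bool × Bool} {lo hi rlo rhi lo' hi' rlo' rhi' : ℝ}
    (H : BadAt ε ω D b h₁ h₂ e ty lo hi rlo rhi) (H' : BadAt ε ω D b h₁ h₂ e ty lo' hi' rlo' rhi')
    (hlo : 0 ≤ lo) (hlo' : 0 ≤ lo') (hhi : hi < ε ^ 2) (hhi' : hi' < ε ^ 2)
    (hr : 0 < rlo) (hr' : 0 < rlo') (hrr : rhi' ≤ ε ^ 2 * rlo) (hrε : rhi ≤ ε / 2) :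
    lo ≤ hi' := by
  obtain ⟨q, hq, q1, q2, N⟩ := H
  obtain ⟨q', hq', q1', q2', N'⟩ := H'
  obtain ⟨i, j⟩ := ty
  simp only at *
  have hσ : sideSign j ^ 2 = 1 := by cases j <;> simp [sideSign]
  have hdir : ‖badDir e i‖ = 1 := by cases i <;> simp [badDir, he]
  have hε := L.pos
  have hY0 : disp ω b i q ≠ 0 := norm_pos_iff.1 (hr.trans_le q1)
  have hY0' : disp ω b i q' ≠ 0 := norm_pos_iff.1 (hr'.trans_le q1')
  have hle : ‖disp ω b i q'‖ ≤ ε ^ 2 * ‖disp ω b i q‖ :=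
    (q2'.trans hrr).trans (by gcongr)
  have hb := L.base_mem
  cases i
  · refine N.slope_le L.conv₂ hε hσ hdir (P := tgtPt ω b) (L.tgt_fr b hb).1 ?_ ?_ L.cone₂ L.norm_le.2
      hlo hlo' hhi hhi' hY0 hY0' hle (q2.trans hrε) N'
    · simpa [disp] using (L.tgt_fr q hq).1
    · simpa [disp] using (L.tgt_fr q' hq').2
  · refine N.slope_le L.conv₁ hε hσ hdir (P := srcPt ω b) (L.src_fr b hb).1 ?_ ?_ L.cone₁ L.norm_le.1
      hlo hlo' hhi hhi' hY0 hY0' hle (q2.trans hrε) N'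
    · simpa [disp] using (L.src_fr q hq).1
    · simpa [disp] using (L.src_fr q' hq').2

end LocalChart

namespace LocalChart

lemma harnack_step {ε : ℝ} {ω f g : ℂ → ℂ} {D V₁ V₂ : Set ℂ} {b h₁ h₂ : ℂ}
    (L : LocalChart ε ω f g D V₁ V₂ b h₁ h₂) {ν : ℂ → ℝ} (hν : Harnack D ν) (hν0 : ∀ z, 0 ≤ ν z)
    {ρ s : ℝ} (hρ : 1 < ρ) (hs : 0 < s) (hsε : s ≤ ε) {N : ℕ} (hN : 2 * ρ / ε ^ 2 ≤ N) :
    ν (g (s / ρ : ℝ)) ≤ 3 ^ (N + 1) * ν (g s) ∧ ν (g s) ≤ 3 ^ (N + 1) * ν (g (s / ρ : ℝ)) := by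
  have hε := L.pos
  have hρ0 : 0 < ρ := by linarith
  refine hν.chain (γ := fun t : ℝ => g t) (ρ := ε * (s / ρ)) (L := 1 / ε)
    (by positivity) N (s / ρ) s (div_le_self hs.le hρ.le) (fun t ht => ?_) (fun t _ t' _ => ?_) ?_
    (hν0 _) (hν0 _)
  · refine (ball_subset_ball ?_).trans (L.up t ((by positivity : 0 < s / ρ).trans_le ht.1)
      (ht.2.trans hsε))
    have := ht.1
    gcongr
  · have := L.le_chart (g t) (g t')
    rw [L.chart_inv, L.chart_inv, ← Complex.ofReal_sub, Complex.norm_real, Real.norm_eq_abs] at this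
    rw [dist_eq_norm, div_mul_eq_mul_div, one_mul, le_div_iff₀ hε]
    linarith
  · rw [div_le_iff₀ (by positivity)] at hN
    have h1 : 1 / ε * (s - s / ρ) ≤ 1 / ε * s := by
      gcongr
      have : 0 < s / ρ := by positivity
      linarith
    refine h1.trans ?_
    rw [one_div, inv_mul_le_iff₀ hε]
    have e : ε * (N * (ε * (s / ρ) / 2)) = N * ε ^ 2 * s / (2 * ρ) := by field_simp
    rw [e, le_div_iff₀ (by positivity)]
    nlinarith

set_option maxHeartbeats 1600000 in
/-- The quotient along the vertical ray decays at most like a small power. -/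
theorem exists_frameU_lower {ε κ : ℝ} (hε : 0 < ε) (hε4 : ε ≤ 1 / 4) (hκ : 0 < κ) (hκ1 : κ ≤ 1) :
    ∃ ρ : ℝ, 1 < ρ ∧ ∀ k₀ : ℝ, 0 < k₀ → ∃ c : ℝ, 0 < c ∧
      ∀ (ω f g : ℂ → ℂ) (D V₁ V₂ : Set ℂ) (b h₁ h₂ e : ℂ), LocalChart ε ω f g D V₁ V₂ b h₁ h₂ →
      ‖e‖ = 1 → ∀ s : ℝ, 0 < s → s ≤ ε ^ 2 / 2 → k₀ ≤ ‖frameU ω b e (g s)‖ →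
      ∀ n : ℕ, c ≤ (ρ ^ (2 * κ)) ^ n * ‖frameU ω b e (g (s / ρ ^ n : ℝ))‖ := by
  set T := κ * ε ^ 2 / 2 with hT
  have hTp : 0 < T := by positivity
  set E₁ := Real.exp (1 + 12 / ε ^ 2) with hE₁
  set E₂ := Real.exp (1 + 52 / ε ^ 2) with hE₂
  have hE₁p : 1 ≤ E₁ := Real.one_le_exp (by positivity)
  have hE₂p : 0 < E₂ := Real.exp_pos _
  set μ := κ * ε ^ 2 / 10 with hμ
  have hμp : 0 < μ := by positivity
  have hμ1 : μ ≤ 1 := by rw [hμ]; nlinarith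
  obtain ⟨ρ, hρ1, hρμ, hρT⟩ : ∃ ρ : ℝ, 1 < ρ ∧ 7 * E₁ / μ ≤ ρ ^ κ ∧ 200 / (ε ^ 6 * T) ≤ ρ := by
    refine ⟨max 2 (max ((7 * E₁ / μ) ^ (1 / κ)) (200 / (ε ^ 6 * T))), ?_, ?_, ?_⟩
    · exact lt_of_lt_of_le (by norm_num) (le_max_left _ _)
    · have h1 : (0 : ℝ) ≤ 7 * E₁ / μ := by positivity
      calc 7 * E₁ / μ = ((7 * E₁ / μ) ^ (1 / κ)) ^ κ := by
            rw [← Real.rpow_mul h1, one_div_mul_cancel hκ.ne', Real.rpow_one]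
        _ ≤ _ := Real.rpow_le_rpow (by positivity)
            ((le_max_left _ _).trans (le_max_right _ _)) hκ.le
    · exact (le_max_right _ _).trans (le_max_right _ _)
  have hρ0 : 0 < ρ := by linarith
  refine ⟨ρ, hρ1, fun k₀ hk₀ => ?_⟩
  set Q := ρ ^ κ with hQ
  have hQp : 0 < Q := by positivity
  have hQ1 : 1 ≤ Q := Real.one_le_rpow hρ1.le hκ.le
  have hQ2 : ρ ^ (2 * κ) = Q * Q := by rw [two_mul, Real.rpow_add hρ0]
  have hexp : Real.exp (κ * Real.log ρ) = Q := by
    rw [hQ, Real.rpow_def_of_pos hρ0, mul_comm]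
  set K' := 7 * (E₁ * Q) with hK'
  have hK'p : 0 < K' := by positivity
  set K₅ := 2 * E₂ * (1 + 1 / T) / (7 * E₁) with hK₅
  have hK₅p : 0 < K₅ := by positivity
  set M₀ := 2 * K₅ / ε ^ 2 + 1 / k₀ with hM₀
  have hM₀p : 0 < M₀ := by positivity
  obtain ⟨N, hN⟩ := exists_nat_ge (2 * ρ / ε ^ 2)
  set A : ℝ := 3 ^ (N + 1) with hA
  have hA1 : 1 ≤ A := one_le_pow₀ (by norm_num)
  set K := max 1 (K₅ * K' / T) with hK
  have hK1 : 1 ≤ K := le_max_left _ _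
  have hQKA : 0 < (A ^ 2 * K) ^ 4 := by positivity
  refine ⟨1 / (M₀ * (A ^ 2 * K) ^ 4), by positivity, ?_⟩
  intro ω f g D V₁ V₂ b h₁ h₂ e L he s hs hsε hk n
  rw [hQ2]
  have hs_pos : ∀ n : ℕ, 0 < s / ρ ^ n := fun n => by positivity
  have hs_le : ∀ n : ℕ, s / ρ ^ n ≤ ε ^ 2 / 2 := fun n =>
    (div_le_self hs.le (one_le_pow₀ hρ1.le)).trans hsε
  have hs_le' : ∀ n : ℕ, s / ρ ^ n ≤ ε := fun n => (hs_le n).trans (by nlinarith)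
  have hs_succ : ∀ n : ℕ, s / ρ ^ n / ρ = s / ρ ^ (n + 1) := fun n => by rw [pow_succ]; field_simp
  set U : ℕ → ℝ := fun n => ‖frameU ω b e (g (s / ρ ^ n : ℝ))‖ with hU
  have hUp : ∀ n, 0 < U n := fun n => norm_pos_iff.2 fun h0 => by
    have := L.frameU_re_pos he (L.up_mem (hs_pos n) (hs_le' n))
    rw [h0] at this; simp at this
  set m : ℕ → ℝ := fun n => max M₀ (1 / U n) with hm
  have hmM : ∀ n, M₀ ≤ m n := fun n => le_max_left _ _
  have hmp : ∀ n, 0 < m n := fun n => hM₀p.trans_le (hmM n)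
  have hmU : ∀ n, 1 / m n ≤ U n := fun n => by
    rw [one_div_le (hmp n) (hUp n)]; exact le_max_right _ _
  have hAstep : ∀ n, m (n + 1) ≤ A * m n := by
    intro n
    refine max_le ((hmM n).trans (le_mul_of_one_le_left (hmp n).le hA1)) ?_
    have h1 := (L.harnack_step (L.harnack_frameU he) (fun _ => norm_nonneg _) hρ1 (hs_pos n)
      (hs_le' n) hN).2
    rw [hs_succ] at h1
    change U n ≤ A * U (n + 1) at h1
    have h2 : 1 / U (n + 1) ≤ A * (1 / U n) := by
      rw [mul_one_div, div_le_div_iff₀ (hUp _) (hUp _)]; linarith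
    exact h2.trans (by gcongr; exact le_max_right _ _)
  set bad : ℕ → Bool × Bool → Prop := fun n ty => BadAt ε ω D b h₁ h₂ e ty (T * (1 / (K' * m n)))
    (K₅ / m n) (T / 5 * (ε * (ε ^ 2 / 40 * (s / ρ ^ n / ρ)))) (s / ρ ^ n / ε) with hbad
  have hK₅m : ∀ n, K₅ / m n ≤ ε ^ 2 / 2 := fun n => by
    rw [div_le_iff₀ (hmp n)]
    have h1 : ε ^ 2 / 2 * (2 * K₅ / ε ^ 2) = K₅ := by field_simp
    have h2 : 2 * K₅ / ε ^ 2 ≤ m n := le_trans (by rw [hM₀]; linarith [one_div_pos.2 hk₀]) (hmM n)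
    rw [← h1]; gcongr
  have hBstep : ∀ n, (∀ i, ¬ bad n i) → m (n + 1) ≤ Q * Q * m n := by
    intro n hn
    have hB : 2 * (Real.exp (1 + 52 / ε ^ 2 + κ * Real.log ρ) * (1 / (K' * m n))) * (1 + 1 / T)
        = K₅ / m n := by
      rw [Real.exp_add, hexp, ← hE₂, hK₅, hK']
      have := hmp n
      field_simp
    have step := L.step_or_badAt he hκ hκ1 hρ1 (hs_pos n) (hs_le' n)
      (τ := 1 / (K' * m n)) (by have := hmp n; positivity) hT rfl (by
        rw [hB]; exact (hK₅m n).trans (by nlinarith)) (by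
        refine lt_of_lt_of_le ?_ (hmU n)
        rw [Real.exp_add, hexp, ← hE₁]
        have := hmp n
        have e : 6 * (E₁ * Q * (1 / (K' * m n))) = 6 / 7 * (1 / m n) := by rw [hK']; field_simp
        rw [e]
        have : 0 < 1 / m n := by positivity
        linarith)
    rw [hB, hs_succ] at step
    rcases step with h1 | ⟨ty, h1⟩
    · change μ * (1 / (K' * m n)) < U (n + 1) at h1
      have hfac : K' / μ ≤ Q * Q := by
        rw [hK']
        calc 7 * (E₁ * Q) / μ = 7 * E₁ / μ * Q := by ring
          _ ≤ Q * Q := by gcongr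
      have hmn := hmp n
      refine max_le ((hmM n).trans (le_mul_of_one_le_left (hmp n).le ?_)) ?_
      · exact one_le_mul_of_one_le_of_one_le hQ1 hQ1
      · refine le_trans ?_ (mul_le_mul_of_nonneg_right hfac hmn.le)
        rw [one_div_le (hUp _) (by positivity)]
        refine le_trans (le_of_eq ?_) h1.le
        field_simp
    · refine absurd ?_ (hn ty)
      simp only [hbad]
      rw [hs_succ]
      exact h1
  have hKstep : ∀ k l i, k + 2 ≤ l → bad k i → bad l i → m l ≤ K * m k := by
    intro k l i hkl hbk hbl
    have hmk := hmp k
    have hml := hmp l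
    have hε2 : 0 < ε ^ 2 := by positivity
    have h1 := L.slope_le_of_badAt he hbk hbl (by positivity) (by positivity)
      ((hK₅m k).trans_lt (by linarith)) ((hK₅m l).trans_lt (by linarith)) (by positivity)
      (by positivity) (by
        have hl : s / ρ ^ l ≤ s / ρ ^ k / ρ / ρ := by
          rw [hs_succ, hs_succ]
          gcongr
          · exact hρ1.le
        rw [div_le_iff₀ (by positivity)] at hρT
        have hx : 0 < s / ρ ^ k / ρ := by positivity
        rw [div_le_iff₀ hε]
        refine hl.trans ?_
        rw [div_le_iff₀ hρ0]
        nlinarith)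
      (by rw [div_le_iff₀ hε]; have := hs_le k; nlinarith)
    have h2 : m l ≤ K₅ * K' / T * m k := by
      rw [mul_one_div, div_le_div_iff₀ (by positivity) hml] at h1
      rw [div_mul_eq_mul_div, le_div_iff₀ hTp]
      linarith
    exact h2.trans (by gcongr; exact le_max_right _ _)
  have main := iterate_types hA1 (one_le_mul_of_one_le_of_one_le hQ1 hQ1) hK1 hmp hAstep hBstep
    hKstep Finset.univ n 0 n (by omega) (by omega) (fun _ _ _ _ _ => Finset.mem_univ _)
  have hc4 : (Finset.univ : Finset (Bool × Bool)).card = 4 := rfl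
  have hm0 : m 0 = M₀ := by
    refine max_eq_left ?_
    have : k₀ ≤ U 0 := by simpa [hU] using hk
    calc 1 / U 0 ≤ 1 / k₀ := by gcongr
      _ ≤ M₀ := by rw [hM₀]; have : 0 < 2 * K₅ / ε ^ 2 := by positivity
                   linarith
  rw [hc4, hm0, Nat.sub_zero] at main
  have hUn := hmU n
  change _ ≤ (Q * Q) ^ n * U n
  have hmn := hmp n
  calc 1 / (M₀ * (A ^ 2 * K) ^ 4) = (Q * Q) ^ n * (1 / (M₀ * (Q * Q) ^ n * (A ^ 2 * K) ^ 4)) := by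
        field_simp
    _ ≤ (Q * Q) ^ n * (1 / m n) := by gcongr
    _ ≤ _ := by gcongr

end LocalChart

/-- A frame adapted to the displacements `z` and `w`. -/
lemma exists_adapted_frame (z w : ℂ) : ∃ e : ℂ, ‖e‖ = 1 ∧
    ‖z‖ * ‖z * conj e + w * e‖ = ‖z‖ * |‖z‖ - ‖w‖| ∧
    ‖z‖ * ‖z * conj e - w * e‖ = ‖z‖ * (‖z‖ + ‖w‖) := by
  obtain ⟨k, hk, hka⟩ := exists_unimodular (w * conj z)
  obtain ⟨e, he⟩ := IsAlgClosed.exists_pow_nat_eq (-k) (n := 2) (by norm_num)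
  have he1 : ‖e‖ = 1 := by
    have : ‖e‖ ^ 2 = 1 := by rw [← norm_pow, he, norm_neg, hk]
    exact (pow_eq_one_iff_of_nonneg (norm_nonneg _) two_ne_zero).1 this
  have hee : conj e * e = 1 := by rw [Complex.conj_mul', he1]; simp
  have hz : conj z * z = ((‖z‖ ^ 2 : ℝ) : ℂ) := by rw [Complex.conj_mul']; push_cast; rfl
  have ha : ‖w * conj z‖ = ‖w‖ * ‖z‖ := by rw [norm_mul, RCLike.norm_conj]
  have key : ∀ s : ℂ, ‖z‖ * ‖z * conj e + s * (w * e)‖ = ‖((‖z‖ ^ 2 : ℝ) : ℂ) - s * (‖w‖ * ‖z‖ : ℝ)‖ := by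
    intro s
    have h1 : conj z * e * (z * conj e + s * (w * e)) =
        ((‖z‖ ^ 2 : ℝ) : ℂ) - s * (‖w‖ * ‖z‖ : ℝ) := by
      rw [← ha, ← hka, ← hz]
      linear_combination conj z * z * hee + s * conj z * w * he
    rw [← h1, norm_mul, norm_mul, RCLike.norm_conj, he1, mul_one]
  refine ⟨e, he1, ?_, ?_⟩
  · have := key 1
    rw [one_mul, one_mul, ← Complex.ofReal_sub, Complex.norm_real, Real.norm_eq_abs] at this
    rw [this, show ‖z‖ ^ 2 - ‖w‖ * ‖z‖ = ‖z‖ * (‖z‖ - ‖w‖) by ring, abs_mul, abs_norm]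
  · have := key (-1)
    rw [show z * conj e + -1 * (w * e) = z * conj e - w * e by ring] at this
    rw [this]
    rw [show ((‖z‖ ^ 2 : ℝ) : ℂ) - -1 * (‖w‖ * ‖z‖ : ℝ) = ((‖z‖ * (‖z‖ + ‖w‖) : ℝ) : ℂ) by
      push_cast; ring]
    rw [Complex.norm_real, Real.norm_of_nonneg (by positivity)]

lemma exists_frameU_eq {ω : ℂ → ℂ} {b ζ : ℂ} (hζ : ζ ≠ b) (hlip : ‖ω ζ - ω b‖ ≤ ‖ζ - b‖) :
    ∃ e : ℂ, ‖e‖ = 1 ∧ ‖ω ζ - ω b‖ ≤ (1 - ‖frameU ω b e ζ‖) * ‖ζ - b‖ := by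
  obtain ⟨e, he, h1, h2⟩ := exists_adapted_frame (ζ - b) (ω ζ - ω b)
  have hz : 0 < ‖ζ - b‖ := norm_pos_iff.2 (sub_ne_zero.2 hζ)
  refine ⟨e, he, ?_⟩
  have e1 := mul_left_cancel₀ hz.ne' h1
  have e2 := mul_left_cancel₀ hz.ne' h2
  rw [abs_of_nonneg (by linarith)] at e1
  have hU : ‖frameU ω b e ζ‖ = (‖ζ - b‖ - ‖ω ζ - ω b‖) / (‖ζ - b‖ + ‖ω ζ - ω b‖) := by
    rw [frameU, frameZ, framePi, norm_div, norm_div, norm_div, e1, e2]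
    norm_num
    rw [div_div_div_cancel_right₀ (by norm_num)]
  have : ‖frameU ω b e ζ‖ * ‖ζ - b‖ ≤ ‖ζ - b‖ - ‖ω ζ - ω b‖ := by
    rw [hU, div_mul_eq_mul_div, div_le_iff₀ (by positivity)]
    nlinarith [norm_nonneg (ω ζ - ω b)]
  linarith

lemma le_norm_frameU {ω : ℂ → ℂ} {b e ζ : ℂ} {k : ℝ} (he : ‖e‖ = 1) (hζ : framePi ω b e ζ ≠ 0)
    (hlip : ‖ω ζ - ω b‖ ≤ ‖ζ - b‖)
    (hk : ‖ω ζ - ω b‖ ≤ (1 - k) * ‖ζ - b‖) : k / 2 ≤ ‖frameU ω b e ζ‖ := by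
  have hP : ‖framePi ω b e ζ‖ ≤ ‖ζ - b‖ := by
    rw [framePi, norm_div]
    have := norm_sub_le ((ζ - b) * conj e) ((ω ζ - ω b) * e)
    rw [norm_mul, norm_mul, RCLike.norm_conj, he] at this
    norm_num
    linarith
  have hZ : k * ‖ζ - b‖ / 2 ≤ ‖frameZ ω b e ζ‖ := by
    rw [frameZ, norm_div]
    have := norm_sub_norm_le ((ζ - b) * conj e) (-((ω ζ - ω b) * e))
    rw [norm_neg, sub_neg_eq_add, norm_mul, norm_mul, RCLike.norm_conj, he] at this
    norm_num
    linarith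
  have hPp := norm_pos_iff.2 hζ
  rw [frameU, norm_div, le_div_iff₀ hPp]
  rcases le_or_gt 0 k with h0 | h0
  · nlinarith
  · nlinarith [norm_nonneg (frameZ ω b e ζ)]

/-- Strict contraction along the vertical rays, at a rate of a small power. -/
theorem exists_ray_lower (R d c : ℝ) {ε κ : ℝ} (hε : 0 < ε) (hε4 : ε ≤ 1 / 4) (hκ : 0 < κ)
    (hκ1 : κ ≤ 1) : ∃ c₁ : ℝ, 0 < c₁ ∧ ∀ (ω : ℂ → ℂ) (D V₁ V₂ : Set ℂ) (y : ℂ),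
      OTData R d c ω D V₁ V₂ y → ∀ (f g : ℂ → ℂ) (b h₁ h₂ : ℂ),
      LocalChart ε ω f g D V₁ V₂ b h₁ h₂ → ∀ t : ℝ, 0 < t → t ≤ ε ^ 2 / 2 →
      ‖ω (g t) - ω b‖ ≤ (1 - c₁ * t ^ (2 * κ)) * ‖g t - b‖ := by
  obtain ⟨ρ, hρ, H⟩ := LocalChart.exists_frameU_lower hε hε4 hκ hκ1
  have hρ0 : 0 < ρ := by linarith
  set r := ε * (ε ^ 2 / 2 / ρ) with hr
  have hrp : 0 < r := by positivity
  obtain ⟨k, hk, Hk⟩ := exists_deep R d c r hrp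
  obtain ⟨c₁, hc₁, H⟩ := H (k * r / 12) (by positivity)
  refine ⟨c₁, hc₁, ?_⟩
  intro ω D V₁ V₂ y hO f g b h₁ h₂ L t ht htε
  have hst : 1 ≤ ε ^ 2 / 2 / t := by rw [le_div_iff₀ ht]; linarith
  obtain ⟨n, hn1, hn2⟩ := exists_nat_pow_near hst hρ
  rw [le_div_iff₀ ht] at hn1
  rw [div_lt_iff₀ ht] at hn2
  set s := ρ ^ n * t with hs
  have hsp : 0 < s := by positivity
  have hsε : s ≤ ε := hn1.trans (by nlinarith)
  have hslow : ε ^ 2 / 2 / ρ ≤ s := by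
    rw [div_le_iff₀ hρ0]
    refine hn2.le.trans (le_of_eq ?_)
    rw [hs, pow_succ]; ring
  have hbD : b ∉ D := by
    have := L.base_mem
    rw [L.isOpen.frontier_eq] at this
    exact this.2
  have hne : ∀ t : ℝ, 0 < t → t ≤ ε → g t ≠ b := fun t h0 h1 h => hbD (h ▸ L.up_mem h0 h1)
  obtain ⟨e, he, hfin⟩ := exists_frameU_eq (hne t ht (htε.trans (by nlinarith))) (L.lip (g t) b)
  have init : k * r / 12 ≤ ‖frameU ω b e (g s)‖ := by
    have hball : ball (g s) r ⊆ D := (ball_subset_ball (by rw [hr]; gcongr)).trans (L.up s hsp hsε)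
    have h1 := hO.contract hrp hball (Hk ω D V₁ V₂ y hO (g s) (hball (mem_ball_self hrp)) hball) b
    have h2 : r ≤ ‖b - g s‖ := by
      by_contra! hc
      exact hbD (hball (by rwa [mem_ball, dist_eq_norm]))
    have h3 : ‖b - g s‖ ≤ 1 := by
      have := L.le_chart b (g s)
      rw [L.chart_inv, L.chart_base, zero_sub, norm_neg, Complex.norm_real,
        Real.norm_of_nonneg hsp.le] at this
      have h4 : ε * ‖b - g s‖ ≤ ε * 1 := by linarith
      exact le_of_mul_le_mul_left h4 hε
    rw [min_eq_right (by linarith)] at h1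
    have h4 := le_norm_frameU (k := k * r / 6) he (L.framePi_ne he (L.up_mem hsp hsε))
      (L.lip (g s) b) (by
        rw [norm_sub_rev (ω (g s)), norm_sub_rev (g s)]
        have : k * r / 6 * ‖b - g s‖ ≤ k * r / 6 * 1 := by gcongr
        linarith)
    linarith
  have h5 := H ω f g D V₁ V₂ b h₁ h₂ e L he s hsp hn1 init n
  have hsn : s / ρ ^ n = t := by rw [hs]; field_simp
  rw [hsn] at h5
  have h6 : (ρ ^ (2 * κ)) ^ n * t ^ (2 * κ) ≤ 1 := by
    rw [← Real.rpow_natCast, ← Real.rpow_mul hρ0.le, mul_comm (2 * κ), Real.rpow_mul hρ0.le,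
      Real.rpow_natCast, ← Real.mul_rpow (by positivity) ht.le]
    exact Real.rpow_le_one hsp.le (by nlinarith) (by positivity)
  have h7 : c₁ * t ^ (2 * κ) ≤ ‖frameU ω b e (g t)‖ := by
    calc c₁ * t ^ (2 * κ) ≤ (ρ ^ (2 * κ)) ^ n * ‖frameU ω b e (g t)‖ * t ^ (2 * κ) := by gcongr
      _ = ((ρ ^ (2 * κ)) ^ n * t ^ (2 * κ)) * ‖frameU ω b e (g t)‖ := by ring
      _ ≤ 1 * ‖frameU ω b e (g t)‖ := by gcongr
      _ = _ := one_mul _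
  refine hfin.trans ?_
  gcongr

lemma OTData.chartEps_bounds {R d c : ℝ} {ω : ℂ → ℂ} {D V₁ V₂ : Set ℂ} {y : ℂ}
    (h : OTData R d c ω D V₁ V₂ y) :
    chartEps R d c ≤ 1 / 4 ∧ chartEps R d c * 32 ≤ chartLow R d c * R := by
  have hR := h.R_pos
  have hR1 := h.R_le
  have hd1 := h.d_ge
  have hm := h.chartLow_pos
  have hm1 := chartLow_le_one h
  have hε := h.chartEps_pos
  have e1 : chartEps R d c * (32 * d ^ 2) = chartLow R d c * R := by
    rw [chartEps]; field_simp
  have hdd : 1 ≤ d ^ 2 := by nlinarith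
  constructor <;> nlinarith

/-- Below every point near the boundary there is a boundary point in the chart. -/
lemma OTData.exists_below {R d c : ℝ} {ω : ℂ → ℂ} {D V₁ V₂ : Set ℂ} {y o q : ℂ} {r₀ : ℝ}
    (h : OTData R d c ω D V₁ V₂ y) (ho : o ∈ D) (hoy : R / 2 ≤ ‖y - o‖)
    (hq : q ∈ frontier D) (hr₀ : 0 < r₀) (hqo : ‖q - o‖ ≤ r₀)
    (hsmall : (d + 8 * d ^ 2 / R) * r₀ ≤ chartEps R d c ^ 2 / 2) :
    ∃ b ∈ frontier D, ∃ t : ℝ, 0 < t ∧ t ≤ chartEps R d c ^ 2 / 2 ∧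
      chart ω y o o - chart ω y o b = t := by
  have hR := h.R_pos
  have hR1 := h.R_le
  have hd1 := h.d_ge
  have hm := h.chartLow_pos
  have hm1 := chartLow_le_one h
  have hε := h.chartEps_pos
  obtain ⟨hε4, hεm⟩ := h.chartEps_bounds
  have hoc := subset_closure ho
  set ε := chartEps R d c with hεd
  set s := (d + 8 * d ^ 2 / R) * r₀ with hs
  have hdR : 0 < 8 * d ^ 2 / R := by positivity
  have hdr : d * r₀ ≤ s := by rw [hs]; nlinarith
  have hrs : r₀ ≤ s := le_trans (by nlinarith) hdr
  have hsp : 0 < s := by linarith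
  have hmR : ε / 8 ≤ chartLow R d c * R / 256 := by linarith
  have hsm : s ≤ chartLow R d c * R / 256 := by nlinarith
  have hsR : s ≤ R / 256 := by nlinarith
  have hnot : chartInv ω y o (chart ω y o o - s) ∉ D := by
    intro hD
    have h1 := h.chart_le hoc o q
    have h1' : ‖chart ω y o o - chart ω y o q‖ ≤ d * r₀ := by
      refine h1.trans ?_
      rw [norm_sub_rev]; gcongr
    have h2 := h.down_cone hoc hoy hq (by linarith) hD
    rw [h.chart_inv hoc hoy] at h2
    have e : chart ω y o o - s - chart ω y o q = (chart ω y o o - chart ω y o q) - s := by ring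
    rw [e] at h2
    have h3 := h2 (by
      refine (norm_sub_le _ _).trans ?_
      rw [Complex.norm_real, Real.norm_of_nonneg hsp.le]
      nlinarith)
    rw [Complex.sub_re, Complex.sub_im, Complex.ofReal_re, Complex.ofReal_im, sub_zero] at h3
    have h4 := (Complex.abs_im_le_norm (chart ω y o o - chart ω y o q)).trans h1'
    have h5 := (Complex.re_le_norm (chart ω y o o - chart ω y o q)).trans h1'
    have h6 : R / (4 * d) * (8 * d ^ 2 / R * r₀) ≤ d * r₀ := by
      refine le_trans ?_ (h3.trans h4)
      gcongr
      rw [neg_sub]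
      have : s = d * r₀ + 8 * d ^ 2 / R * r₀ := by rw [hs]; ring
      linarith
    have e2 : R / (4 * d) * (8 * d ^ 2 / R * r₀) = 2 * (d * r₀) := by field_simp; ring
    rw [e2] at h6
    nlinarith
  have hseg : IsPreconnected ((fun t : ℝ => chart ω y o o - t) '' Icc 0 s) :=
    isPreconnected_Icc.image _ (by fun_prop)
  by_contra! hc
  refine hnot (h.lift_mem hoc hoy hseg (w₀ := chart ω y o o) ⟨0, ⟨le_rfl, hsp.le⟩, by simp⟩
    (by rwa [h.inv_chart hoc hoy]) (fun b hb hbS => ?_) ⟨s, ⟨hsp.le, le_rfl⟩, rfl⟩)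
  obtain ⟨t, ⟨ht0, hts⟩, hbt⟩ := hbS
  rcases ht0.eq_or_lt with rfl | ht0
  · have h1 := h.le_chart hoc hoy o b
    rw [← hbt] at h1
    simp only [Complex.ofReal_zero, sub_zero, sub_self, norm_zero] at h1
    have h2 : ‖o - b‖ = 0 := by
      have := norm_nonneg (o - b)
      nlinarith
    rw [norm_sub_eq_zero_iff] at h2
    rw [h.isOpen.frontier_eq] at hb
    exact hb.2 (h2 ▸ ho)
  · exact hc b hb t ht0 (hts.trans hsmall) (by rw [← hbt]; ring)

lemma norm_dslope_le {ω : ℂ → ℂ} (hlip : ∀ a b, ‖ω a - ω b‖ ≤ ‖a - b‖) (a z : ℂ) :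
    ‖dslope ω a z‖ ≤ 1 := by
  rcases eq_or_ne z a with rfl | hz
  · rw [dslope_same]
    exact norm_deriv_le_of_lip' (C := 1) zero_le_one
      (Filter.Eventually.of_forall fun b => by simpa using hlip b z)
  · rw [dslope_of_ne _ hz, slope_def_field, norm_div]
    exact div_le_one_of_le₀ (hlip z a) (norm_nonneg _)

lemma norm_sub_eq_dslope (ω : ℂ → ℂ) (a z : ℂ) : ‖ω z - ω a‖ = ‖dslope ω a z‖ * ‖z - a‖ := by
  rw [← sub_smul_dslope, norm_smul, mul_comm]

/-- Comparison of the chord bound to a boundary point with the derivative. -/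
lemma LocalChart.le_deriv {ε : ℝ} {ω f g : ℂ → ℂ} {D V₁ V₂ : Set ℂ} {b h₁ h₂ : ℂ}
    (L : LocalChart ε ω f g D V₁ V₂ b h₁ h₂) {t k : ℝ} (ht : 0 < t) (htε : t ≤ ε)
    {N : ℕ} (hN : 2 * 2 / ε ^ 2 ≤ N)
    (hk : ‖ω (g t) - ω b‖ ≤ (1 - k) * ‖g t - b‖) (K : ℕ) :
    k ≤ (3 ^ (N + 1)) ^ K * (1 - ‖deriv ω (g t)‖) * (1 + 1 / ε ^ 2) + 2 / ε ^ 2 / 2 ^ K := by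
  have hε := L.pos
  set ζ := g t with hζ
  have hζD : ζ ∈ D := L.up_mem ht htε
  have hH : Harnack D (fun z => 1 - ‖dslope ω ζ z‖) :=
    harnack_one_sub_norm ((Complex.differentiableOn_dslope (L.isOpen.mem_nhds hζD)).2 L.holo)
      fun z _ => norm_dslope_le L.lip ζ z
  have hnn : ∀ z, 0 ≤ 1 - ‖dslope ω ζ z‖ := fun z => by linarith [norm_dslope_le L.lip ζ z]
  have chain : ∀ K : ℕ, 1 - ‖dslope ω ζ (g (t / 2 ^ K : ℝ))‖ ≤
      (3 ^ (N + 1)) ^ K * (1 - ‖deriv ω ζ‖) := by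
    intro K
    induction K with
    | zero => simp [← hζ]
    | succ K ih =>
      have h1 := (L.harnack_step hH hnn one_lt_two (by positivity : 0 < t / 2 ^ K)
        ((div_le_self ht.le (one_le_pow₀ one_le_two)).trans htε) hN).1
      rw [show t / 2 ^ K / 2 = t / 2 ^ (K + 1) by rw [pow_succ]; field_simp] at h1
      refine h1.trans ?_
      rw [pow_succ' (3 ^ (N + 1) : ℝ), mul_assoc]
      gcongr
  set δ := (3 ^ (N + 1)) ^ K * (1 - ‖deriv ω ζ‖) with hδ
  set z := g (t / 2 ^ K : ℝ) with hz
  set τ := t / 2 ^ K / ε with hτ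
  have hτp : 0 < τ := by positivity
  have hzb : ‖z - b‖ ≤ τ := by
    have := L.le_chart z b
    rw [hz, L.chart_inv, L.chart_base, sub_zero, Complex.norm_real,
      Real.norm_of_nonneg (by positivity)] at this
    rw [hτ, le_div_iff₀ hε]; linarith
  have hℓ : ε * t ≤ ‖ζ - b‖ := by
    have := L.chart_le ζ b
    rwa [hζ, L.chart_inv, L.chart_base, sub_zero, Complex.norm_real,
      Real.norm_of_nonneg ht.le] at this
  have hδ0 : 0 ≤ δ := (hnn z).trans (chain K)
  have h1 : ‖z - ζ‖ * (1 - δ) ≤ ‖ω z - ω ζ‖ := by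
    rw [norm_sub_eq_dslope ω]
    nlinarith [chain K, norm_nonneg (z - ζ)]
  have h2 : ‖ω z - ω ζ‖ ≤ (1 - k) * ‖ζ - b‖ + τ := by
    have := norm_sub_le_norm_sub_add_norm_sub (ω z) (ω b) (ω ζ)
    rw [norm_sub_rev (ω b)] at this
    linarith [L.lip z b]
  have h3 : ‖z - ζ‖ ≤ ‖ζ - b‖ + τ := by
    have := norm_sub_le_norm_sub_add_norm_sub z b ζ
    rw [norm_sub_rev b] at this
    linarith
  have h4 : ‖ζ - b‖ ≤ ‖z - ζ‖ + τ := by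
    have := norm_sub_le_norm_sub_add_norm_sub ζ z b
    rw [norm_sub_rev ζ z] at this
    linarith
  have hℓp : 0 < ‖ζ - b‖ := lt_of_lt_of_le (by positivity) hℓ
  have h5 : k * ‖ζ - b‖ ≤ δ * (‖ζ - b‖ + τ) + 2 * τ := by nlinarith
  have h6 : τ ≤ 1 / ε ^ 2 / 2 ^ K * ‖ζ - b‖ := by
    calc τ = 1 / ε ^ 2 / 2 ^ K * (ε * t) := by rw [hτ]; field_simp
      _ ≤ _ := by gcongr
  have h7 : τ ≤ 1 / ε ^ 2 * ‖ζ - b‖ := by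
    exact h6.trans (mul_le_mul_of_nonneg_right
      (div_le_self (by positivity) (one_le_pow₀ one_le_two)) hℓp.le)
  refine le_of_mul_le_mul_right (h5.trans ?_) hℓp
  have h8 : δ * τ ≤ δ * (1 / ε ^ 2 * ‖ζ - b‖) := by gcongr
  calc δ * (‖ζ - b‖ + τ) + 2 * τ ≤ δ * ‖ζ - b‖ + δ * (1 / ε ^ 2 * ‖ζ - b‖) +
        2 * (1 / ε ^ 2 / 2 ^ K * ‖ζ - b‖) := by linarith
    _ = _ := by ring

/-- Optimizing the number of halvings. -/
lemma exists_power_lower {A E c₁ θ : ℝ} (hA : 1 ≤ A) (hE : 1 ≤ E) (hc₁ : 0 < c₁) (hθ : 0 < θ) :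
    ∃ c₂ : ℝ, 0 < c₂ ∧ ∀ t δ : ℝ, 0 < t → t ≤ 1 → 0 ≤ δ →
      (∀ K : ℕ, c₁ * t ^ θ ≤ A ^ K * δ * E + E / 2 ^ K) →
      c₂ * t ^ (θ * (1 + Real.logb 2 A)) ≤ δ := by
  set a := Real.logb 2 A with ha
  have ha0 : 0 ≤ a := Real.logb_nonneg one_lt_two hA
  set c' := min c₁ 1 with hc'
  have hc'p : 0 < c' := lt_min hc₁ one_pos
  set B := 2 * E / c' with hB
  have hB1 : 1 ≤ B := by
    rw [hB, le_div_iff₀ hc'p]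
    have : c' ≤ 1 := min_le_right _ _
    linarith
  refine ⟨c' / (2 * E * A * B ^ a), by positivity, ?_⟩
  intro t δ ht ht1 hδ H
  have htθ : t ^ θ ≤ 1 := Real.rpow_le_one ht.le ht1 hθ.le
  have htp : 0 < t ^ θ := by positivity
  have hX : 1 ≤ B / t ^ θ := by
    rw [le_div_iff₀ htp]; linarith
  obtain ⟨n, hn1, hn2⟩ := exists_nat_pow_near hX one_lt_two
  have h1 := H (n + 1)
  have h2 : E / 2 ^ (n + 1) ≤ c' * t ^ θ / 2 := by
    rw [div_lt_iff₀ htp, hB, div_lt_iff₀ hc'p] at hn2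
    rw [div_le_iff₀ (by positivity)]
    linarith
  have h3 : A ^ (n + 1) ≤ A * (B ^ a / t ^ (θ * a)) := by
    rw [pow_succ']
    gcongr
    have hAa : A = (2 : ℝ) ^ a := by
      rw [ha, Real.rpow_logb two_pos (by norm_num) (by linarith)]
    calc A ^ n = ((2 : ℝ) ^ n) ^ a := by
          rw [hAa, ← Real.rpow_natCast, ← Real.rpow_mul two_pos.le, mul_comm,
            Real.rpow_mul two_pos.le, Real.rpow_natCast]
      _ ≤ (B / t ^ θ) ^ a := Real.rpow_le_rpow (by positivity) hn1 ha0
      _ = _ := by rw [Real.div_rpow (by positivity) htp.le, ← Real.rpow_mul ht.le]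
  have h4 : c' * t ^ θ ≤ c₁ * t ^ θ := by gcongr; exact min_le_left _ _
  have h5 : c' * t ^ θ / 2 ≤ A * (B ^ a / t ^ (θ * a)) * δ * E := by
    refine le_trans ?_ (by gcongr : A ^ (n + 1) * δ * E ≤ _)
    linarith
  have hta : 0 < t ^ (θ * a) := by positivity
  have e : t ^ (θ * (1 + a)) = t ^ θ * t ^ (θ * a) := by
    rw [← Real.rpow_add ht]; ring_nf
  rw [e]
  have hBa : 0 < B ^ a := by positivity
  rw [div_mul_eq_mul_div, div_le_iff₀ (by positivity)]
  have h6 : A * (B ^ a / t ^ (θ * a)) * δ * E * t ^ (θ * a) = A * B ^ a * δ * E := by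
    field_simp
  nlinarith [mul_le_mul_of_nonneg_right h5 hta.le]

/-- The derivative of the holomorphic map stays away from the unit circle, up to a small power of
the distance to the boundary. -/
theorem exists_deriv_lower (R d c κ : ℝ) (hκ : 0 < κ) (hκ1 : κ ≤ 1) :
    ∃ c₀ : ℝ, 0 < c₀ ∧ ∀ (ω : ℂ → ℂ) (D V₁ V₂ : Set ℂ) (y : ℂ), OTData R d c ω D V₁ V₂ y →
      ∀ ζ ∈ D, ∀ r : ℝ, 0 < r → r ≤ 1 → ball ζ r ⊆ D → c₀ * r ^ κ ≤ 1 - ‖deriv ω ζ‖ := by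
  set ε := chartEps R d c with hεd
  by_cases hpos : 0 < ε ∧ ε ≤ 1 / 4 ∧ 0 < R ∧ 1 ≤ d
  swap
  · exact ⟨1, one_pos, fun ω D V₁ V₂ y h =>
      (hpos ⟨h.chartEps_pos, h.chartEps_bounds.1, h.R_pos, h.d_ge⟩).elim⟩
  obtain ⟨hε, hε4, hR, hd1⟩ := hpos
  obtain ⟨N, hN⟩ := exists_nat_ge (2 * 2 / ε ^ 2)
  set A : ℝ := 3 ^ (N + 1) with hA
  have hA1 : 1 ≤ A := one_le_pow₀ (by norm_num)
  set a := Real.logb 2 A with ha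
  have ha0 : 0 ≤ a := Real.logb_nonneg one_lt_two hA1
  set θ := κ / (1 + a) with hθ
  have hθp : 0 < θ := by positivity
  have hθκ : θ * (1 + a) = κ := by rw [hθ]; field_simp
  have hθ1 : θ ≤ 1 := by nlinarith
  obtain ⟨c₁, hc₁, H₁⟩ := exists_ray_lower R d c (ε := ε) (κ := θ / 2) hε hε4 (by positivity)
    (by linarith)
  have hε2 : 0 < ε ^ 2 := by positivity
  obtain ⟨c₂, hc₂, H₂⟩ := exists_power_lower (A := A) (E := 1 + 2 / ε ^ 2) (θ := θ) hA1
    (by have : 0 < 2 / ε ^ 2 := by positivity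
        linarith) hc₁ hθp
  set r₀ := ε ^ 2 / 2 / (d + 8 * d ^ 2 / R) with hr₀
  have hr₀p : 0 < r₀ := by positivity
  obtain ⟨k, hk, Hk⟩ := exists_deep R d c r₀ hr₀p
  refine ⟨min k (c₂ * ε ^ κ), by positivity, ?_⟩
  intro ω D V₁ V₂ y h ζ hζ r hr hr1 hball
  have hrκ : r ^ κ ≤ 1 := Real.rpow_le_one hr.le hr1 hκ.le
  by_cases hdeep : ball ζ r₀ ⊆ D
  · refine le_trans ?_ (Hk ω D V₁ V₂ y h ζ hζ hdeep)
    calc min k (c₂ * ε ^ κ) * r ^ κ ≤ k * 1 := by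
          gcongr
          exact min_le_left _ _
      _ = k := mul_one k
  obtain ⟨q, hqb, hq⟩ : ∃ q ∈ ball ζ r₀, q ∈ frontier D := by
    by_contra! hc
    exact hdeep (subset_of_disjoint_frontier (convex_ball ζ r₀).isPreconnected h.isOpen
      ⟨ζ, mem_ball_self hr₀p, hζ⟩ hc)
  rw [mem_ball, dist_eq_norm] at hqb
  have hsmall : (d + 8 * d ^ 2 / R) * r₀ ≤ ε ^ 2 / 2 := by rw [hr₀]; field_simp; rfl
  have hr₀R : r₀ ≤ R / 256 := by
    have h1 := h.chartEps_bounds.2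
    have h2 := chartLow_le_one h
    have h3 : r₀ ≤ (d + 8 * d ^ 2 / R) * r₀ := by
      have : 0 < 8 * d ^ 2 / R := by positivity
      nlinarith
    nlinarith
  have hoy : R / 2 ≤ ‖y - ζ‖ := by
    by_contra! hc
    rw [h.isOpen.frontier_eq] at hq
    refine hq.2 (h.ball_subset ?_)
    rw [mem_ball, dist_eq_norm]
    have := norm_sub_le_norm_sub_add_norm_sub q ζ y
    rw [norm_sub_rev ζ] at this
    linarith
  have hζc := subset_closure hζ
  obtain ⟨b, hb, t, ht, htε, hbt⟩ := h.exists_below hζ hoy hq hr₀p hqb.le hsmall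
  have hbζ : ‖b - ζ‖ < R / 32 := by
    have h1 := h.le_chart hζc hoy ζ b
    rw [hbt, Complex.norm_real, Real.norm_of_nonneg ht.le, norm_sub_rev] at h1
    have hm := h.chartLow_pos
    have h2 := h.chartEps_bounds.2
    have h3 : chartLow R d c * ‖b - ζ‖ < chartLow R d c * (R / 32) := by nlinarith
    exact lt_of_mul_lt_mul_left h3 hm.le
  have L := h.localChart hζc hoy hb hbζ
  have hg : chartInv ω y ζ (chart ω y ζ b + t) = ζ := by
    rw [← hbt, add_sub_cancel, h.inv_chart hζc hoy]
  have ht1 : t ≤ 1 := htε.trans (by nlinarith)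
  have h1 := H₁ ω D V₁ V₂ y h _ _ _ _ _ L t ht htε
  have h2 := L.le_deriv ht (htε.trans (by nlinarith)) hN h1
  simp only [hg] at h2
  have hδ0 : 0 ≤ 1 - ‖deriv ω ζ‖ := by linarith [h.norm_deriv_le ζ]
  have h3 := H₂ t (1 - ‖deriv ω ζ‖) ht ht1 hδ0 fun K => by
    have := h2 K
    rw [show 2 * (θ / 2) = θ by ring] at this
    refine this.trans ?_
    have hp : 0 < 1 / ε ^ 2 := by positivity
    have e2 : 2 / ε ^ 2 = 2 * (1 / ε ^ 2) := by ring
    gcongr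
    · linarith
    · linarith
  rw [hθκ] at h3
  have hrt : ε * r ≤ t := by
    have h4 := L.le_chart ζ b
    simp only [sub_self, sub_zero] at h4
    rw [hbt, Complex.norm_real, Real.norm_of_nonneg ht.le] at h4
    have h5 : r ≤ ‖ζ - b‖ := by
      by_contra! hc
      rw [h.isOpen.frontier_eq] at hb
      exact hb.2 (hball (by rwa [mem_ball, dist_comm, dist_eq_norm]))
    refine le_trans ?_ h4
    gcongr
  refine le_trans ?_ h3
  calc min k (c₂ * ε ^ κ) * r ^ κ ≤ c₂ * ε ^ κ * r ^ κ := by gcongr; exact min_le_right _ _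
    _ = c₂ * (ε * r) ^ κ := by rw [Real.mul_rpow hε.le hr.le, mul_assoc]
    _ ≤ _ := by gcongr

/-- An optimal transport potential on the complex plane together with its continuous
gradient map. -/
structure OTPot (U₁ U₂ : Set ℂ) (ψ : ℂ → ℝ) (T : ℂ → ℂ) : Prop where
  open₁ : IsOpen U₁
  open₂ : IsOpen U₂
  conv₁ : Convex ℝ U₁
  conv₂ : Convex ℝ U₂
  bdd₁ : Bornology.IsBounded U₁
  bdd₂ : Bornology.IsBounded U₂
  vol₁ : volume U₁ = 1
  vol₂ : volume U₂ = 1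
  cont : Continuous ψ
  cvx : ConvexOn ℝ univ ψ
  sub_mem : ∀ x p : ℂ, (∀ y, ψ x + ⟪p, y - x⟫ ≤ ψ y) → p ∈ closure U₂
  T_cont : ContinuousOn T U₁
  T_sub : ∀ x ∈ U₁, ∀ y, ψ x + ⟪T x, y - x⟫ ≤ ψ y
  map_eq : ∀ B, MeasurableSet B → volume (U₁ ∩ T ⁻¹' B) = volume (B ∩ U₂)

namespace OTPot

variable {U₁ U₂ : Set ℂ} {ψ : ℂ → ℝ} {T : ℂ → ℂ}

lemma nonempty₁ (h : OTPot U₁ U₂ ψ T) : U₁.Nonempty := by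
  by_contra hne
  have := h.vol₁
  rw [not_nonempty_iff_eq_empty.1 hne] at this
  simp at this

lemma exists_prox (h : OTPot U₁ U₂ ψ T) (ζ : ℂ) : ∃ x, ∀ y, ψ x + ⟪ζ - x, y - x⟫ ≤ ψ y := by
  obtain ⟨a, ha⟩ := h.nonempty₁
  have hc : Continuous fun y : ℂ => ψ y + ‖y‖ ^ 2 / 2 - ⟪ζ, y⟫ := by
    have := h.cont
    fun_prop
  obtain ⟨x, hx⟩ := hc.exists_forall_le' a (by
    set K := ψ a + ‖a‖ ^ 2 / 2 - ⟪ζ, a⟫ - ψ a + ⟪T a, a⟫ with hK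
    have := (tendsto_norm_cocompact_atTop (E := ℂ)).eventually
      (Filter.eventually_ge_atTop (2 * (‖T a - ζ‖ + |K| + 1)))
    filter_upwards [this] with y hy
    have h1 := h.T_sub a ha y
    have h2 : -(‖T a - ζ‖ * ‖y‖) ≤ ⟪T a - ζ, y⟫ := by
      have := abs_real_inner_le_norm (T a - ζ) y
      exact (abs_le.1 this).1
    rw [inner_sub_left] at h2
    rw [inner_sub_right] at h1
    have h3 : |K| ≤ ‖y‖ ^ 2 / 2 - ‖T a - ζ‖ * ‖y‖ := by
      have := norm_nonneg (T a - ζ)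
      have := abs_nonneg K
      nlinarith
    have := le_abs_self K
    linarith)
  refine ⟨x, fun y => ?_⟩
  by_contra hlt
  push Not at hlt
  set g := ψ x + ⟪ζ - x, y - x⟫ - ψ y with hg
  have hgp : 0 < g := by linarith
  have key : ∀ t : ℝ, 0 < t → t ≤ 1 → g ≤ t * (‖y - x‖ ^ 2 / 2) := by
    intro t ht ht1
    have h1 := hx (x + t • (y - x))
    have h2 := h.cvx.2 (mem_univ x) (mem_univ y) (by linarith : 0 ≤ 1 - t) ht.le (by ring)
    have e : (1 - t) • x + t • y = x + t • (y - x) := by simp only [smul_sub, sub_smul, one_smul]; ring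
    rw [e] at h2
    rw [norm_add_sq_real, inner_add_right, inner_smul_right, norm_smul, inner_smul_right,
      Real.norm_of_nonneg ht.le] at h1
    simp only [smul_eq_mul] at h2
    rw [inner_sub_left] at hg
    have : t * g ≤ t * (t * (‖y - x‖ ^ 2 / 2)) := by rw [hg]; nlinarith
    exact le_of_mul_le_mul_left this ht
  have hn : 0 ≤ ‖y - x‖ ^ 2 / 2 := by positivity
  have := key (min 1 (g / (‖y - x‖ ^ 2 / 2 + 1) / 2)) (by positivity) (min_le_left _ _)
  have h3 : min 1 (g / (‖y - x‖ ^ 2 / 2 + 1) / 2) * (‖y - x‖ ^ 2 / 2) ≤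
      g / (‖y - x‖ ^ 2 / 2 + 1) / 2 * (‖y - x‖ ^ 2 / 2 + 1) := by
    gcongr
    · exact min_le_right _ _
    · linarith
  have h4 : g / (‖y - x‖ ^ 2 / 2 + 1) / 2 * (‖y - x‖ ^ 2 / 2 + 1) = g / 2 := by field_simp
  linarith

/-- The resolvent of the subdifferential. -/
def prox (h : OTPot U₁ U₂ ψ T) (ζ : ℂ) : ℂ := (h.exists_prox ζ).choose

lemma prox_spec (h : OTPot U₁ U₂ ψ T) (ζ y : ℂ) :
    ψ (h.prox ζ) + ⟪ζ - h.prox ζ, y - h.prox ζ⟫ ≤ ψ y := (h.exists_prox ζ).choose_spec y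

lemma subgrad_mono {x x' p p' : ℂ} (hp : ∀ y, ψ x + ⟪p, y - x⟫ ≤ ψ y)
    (hp' : ∀ y, ψ x' + ⟪p', y - x'⟫ ≤ ψ y) : 0 ≤ ⟪x - x', p - p'⟫ := by
  have h1 := hp x'
  have h2 := hp' x
  have : ⟪x - x', p - p'⟫ = -⟪p, x' - x⟫ - ⟪p', x - x'⟫ := by
    simp only [inner_sub_left, inner_sub_right, real_inner_comm]; ring
  linarith

lemma prox_eq (h : OTPot U₁ U₂ ψ T) {x p : ℂ} (hp : ∀ y, ψ x + ⟪p, y - x⟫ ≤ ψ y) :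
    h.prox (x + p) = x := by
  have h1 := subgrad_mono hp (h.prox_spec (x + p))
  rw [show p - (x + p - h.prox (x + p)) = -(x - h.prox (x + p)) by ring, inner_neg_right,
    real_inner_self_eq_norm_sq] at h1
  have : ‖x - h.prox (x + p)‖ = 0 := by nlinarith [norm_nonneg (x - h.prox (x + p))]
  exact (sub_eq_zero.1 (norm_eq_zero.1 this)).symm

/-- The reflected resolvent, conjugated. -/
def refl (h : OTPot U₁ U₂ ψ T) (ζ : ℂ) : ℂ := conj (2 * h.prox ζ - ζ)

lemma srcPt_refl (h : OTPot U₁ U₂ ψ T) (ζ : ℂ) : srcPt h.refl ζ = h.prox ζ := by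
  simp [srcPt, refl]

lemma tgtPt_refl (h : OTPot U₁ U₂ ψ T) (ζ : ℂ) : tgtPt h.refl ζ = ζ - h.prox ζ := by
  simp [tgtPt, refl]; ring

lemma prox_inner_nonneg (h : OTPot U₁ U₂ ψ T) (a b : ℂ) :
    0 ≤ ⟪h.prox a - h.prox b, (a - h.prox a) - (b - h.prox b)⟫ :=
  subgrad_mono (h.prox_spec a) (h.prox_spec b)

lemma prox_firm (h : OTPot U₁ U₂ ψ T) (a b : ℂ) :
    ‖h.prox a - h.prox b‖ ^ 2 ≤ ⟪h.prox a - h.prox b, a - b⟫ := by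
  have := h.prox_inner_nonneg a b
  rw [show (a - h.prox a) - (b - h.prox b) = (a - b) - (h.prox a - h.prox b) by ring,
    inner_sub_right, real_inner_self_eq_norm_sq] at this
  linarith

lemma refl_lip (h : OTPot U₁ U₂ ψ T) (a b : ℂ) : ‖h.refl a - h.refl b‖ ≤ ‖a - b‖ := by
  have h1 := h.prox_firm a b
  rw [refl, refl, ← map_sub, RCLike.norm_conj,
    show 2 * h.prox a - a - (2 * h.prox b - b) = (2 : ℝ) • (h.prox a - h.prox b) - (a - b) by
      rw [Complex.real_smul]; push_cast; ring]
  refine le_of_sq_le_sq ?_ (norm_nonneg _)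
  rw [norm_sub_sq_real, real_inner_smul_left, norm_smul, Real.norm_ofNat]
  nlinarith

lemma prox_lip (h : OTPot U₁ U₂ ψ T) (a b : ℂ) : ‖h.prox a - h.prox b‖ ≤ ‖a - b‖ := by
  have h1 := h.prox_firm a b
  have h2 := real_inner_le_norm (h.prox a - h.prox b) (a - b)
  by_contra hlt
  push Not at hlt
  nlinarith [norm_nonneg (a - b)]

lemma prox_lipschitz (h : OTPot U₁ U₂ ψ T) : LipschitzWith 1 h.prox :=
  LipschitzWith.of_dist_le_mul fun a b => by
    simpa [dist_eq_norm] using h.prox_lip a b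

lemma refl_lipschitz (h : OTPot U₁ U₂ ψ T) : LipschitzWith 1 h.refl :=
  LipschitzWith.of_dist_le_mul fun a b => by
    simpa [dist_eq_norm] using h.refl_lip a b

lemma continuous_prox (h : OTPot U₁ U₂ ψ T) : Continuous h.prox := h.prox_lipschitz.continuous

lemma tgt_mem_closure (h : OTPot U₁ U₂ ψ T) (ζ : ℂ) : ζ - h.prox ζ ∈ closure U₂ :=
  h.sub_mem _ _ (h.prox_spec ζ)

lemma prox_add (h : OTPot U₁ U₂ ψ T) {u : ℂ} (hu : u ∈ U₁) : h.prox (u + T u) = u :=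
  h.prox_eq (h.T_sub u hu)

/-- The subdifferential is single-valued on `U₁`. -/
lemma T_unique (h : OTPot U₁ U₂ ψ T) {u p : ℂ} (hu : u ∈ U₁)
    (hp : ∀ y, ψ u + ⟪p, y - u⟫ ≤ ψ y) : p = T u := by
  set v := p - T u with hv
  have hc : ContinuousAt (fun t : ℝ => ⟪v, T (u + t • v) - p⟫) 0 := by
    have h1 : ContinuousAt T u := h.T_cont.continuousAt (h.open₁.mem_nhds hu)
    have h2 : ContinuousAt (fun t : ℝ => T (u + t • v)) 0 := by
      apply ContinuousAt.comp (g := T)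
      · simpa using h1
      · fun_prop
    exact continuousAt_const.inner (𝕜 := ℝ) (h2.sub continuousAt_const)
  have hmem : ∀ᶠ t : ℝ in nhds 0, u + t • v ∈ U₁ := by
    have : ContinuousAt (fun t : ℝ => u + t • v) 0 := by fun_prop
    exact this.eventually_mem (h.open₁.mem_nhds (by simpa using hu))
  have h3 : 0 ≤ ⟪v, T (u + (0 : ℝ) • v) - p⟫ := by
    refine ge_of_tendsto (hc.tendsto.mono_left (nhdsWithin_le_nhds (s := Ioi 0))) ?_
    filter_upwards [nhdsWithin_le_nhds hmem, self_mem_nhdsWithin] with t ht ht0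
    have := subgrad_mono (h.T_sub _ ht) hp
    rw [add_sub_cancel_left, inner_smul_left] at this
    exact nonneg_of_mul_nonneg_right this ht0
  rw [zero_smul, add_zero, show T u - p = -v by rw [hv]; ring, inner_neg_right,
    real_inner_self_eq_norm_sq] at h3
  have : ‖v‖ = 0 := by nlinarith [norm_nonneg v]
  exact sub_eq_zero.1 (norm_eq_zero.1 this)

lemma sub_prox_eq (h : OTPot U₁ U₂ ψ T) {ζ : ℂ} (hζ : h.prox ζ ∈ U₁) :
    ζ - h.prox ζ = T (h.prox ζ) := h.T_unique hζ (h.prox_spec ζ)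

/-- The image of `U₁` under `id + T`. -/
def dom (h : OTPot U₁ U₂ ψ T) : Set ℂ := h.prox ⁻¹' U₁

lemma dom_eq (h : OTPot U₁ U₂ ψ T) : h.dom = (fun u => u + T u) '' U₁ := by
  ext ζ
  constructor
  · intro hζ
    exact ⟨h.prox ζ, hζ, by simp [← h.sub_prox_eq hζ]⟩
  · rintro ⟨u, hu, rfl⟩
    simpa [dom, h.prox_add hu] using hu

lemma isOpen_dom (h : OTPot U₁ U₂ ψ T) : IsOpen h.dom := h.open₁.preimage h.continuous_prox

lemma isPreconnected_dom (h : OTPot U₁ U₂ ψ T) : IsPreconnected h.dom := by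
  rw [h.dom_eq]
  exact h.conv₁.isPreconnected.image _ (continuousOn_id.add h.T_cont)

/-- The resolvent is a gradient. -/
lemma hasFDerivAt_conjugate (h : OTPot U₁ U₂ ψ T) (ζ : ℂ) :
    HasFDerivAt (fun ζ => ⟪ζ, h.prox ζ⟫ - ψ (h.prox ζ) - ‖h.prox ζ‖ ^ 2 / 2)
      (innerSL ℝ (h.prox ζ)) ζ := by
  have key : ∀ a b : ℂ, ⟪a, h.prox b⟫ - ψ (h.prox b) - ‖h.prox b‖ ^ 2 / 2 ≤
      ⟪a, h.prox a⟫ - ψ (h.prox a) - ‖h.prox a‖ ^ 2 / 2 := by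
    intro a b
    have h1 := h.prox_spec a (h.prox b)
    have h2 := norm_sub_sq_real (h.prox b) (h.prox a)
    have h3 := sq_nonneg ‖h.prox b - h.prox a‖
    simp only [inner_sub_left, inner_sub_right, real_inner_self_eq_norm_sq,
      real_inner_comm (h.prox b) (h.prox a)] at h1 h2
    linarith
  rw [hasFDerivAt_iff_isLittleO]
  refine Asymptotics.IsBigO.trans_isLittleO (g := fun z => ‖z - ζ‖ ^ 2) ?_ ?_
  · refine Asymptotics.IsBigO.of_bound 1 (Filter.Eventually.of_forall fun z => ?_)
    have h1 := key z ζ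
    have h2 := key ζ z
    have h3 := (real_inner_le_norm (z - ζ) (h.prox z - h.prox ζ)).trans
      (mul_le_mul_of_nonneg_left (h.prox_lip z ζ) (norm_nonneg _))
    rw [innerSL_apply_apply, Real.norm_eq_abs, one_mul, Real.norm_of_nonneg (by positivity), abs_le]
    simp only [inner_sub_left, inner_sub_right] at h3 ⊢
    rw [real_inner_comm z (h.prox ζ), real_inner_comm ζ (h.prox ζ)]
    constructor <;> nlinarith
  · exact Asymptotics.isLittleO_pow_sub_sub ζ one_lt_two

end OTPot

lemma det_clm_complex (A : ℂ →L[ℝ] ℂ) :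
    A.det = (A 1).re * (A Complex.I).im - (A Complex.I).re * (A 1).im := by
  rw [ContinuousLinearMap.det, ← LinearMap.det_toMatrix Complex.basisOneI, Matrix.det_fin_two]
  simp [LinearMap.toMatrix_apply]

/-- Firmly nonexpansive maps of the plane. -/
def Firm (f : ℂ → ℂ) : Prop := ∀ a b, ‖f a - f b‖ ^ 2 ≤ ⟪f a - f b, a - b⟫

namespace Firm

variable {f : ℂ → ℂ}

lemma id_sub (hf : Firm f) : Firm fun z => z - f z := by
  intro a b
  have h := hf a b
  rw [show a - f a - (b - f b) = (a - b) - (f a - f b) by ring, norm_sub_sq_real,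
    inner_sub_left (a - b), real_inner_self_eq_norm_sq, real_inner_comm (f a - f b) (a - b)]
  linarith

lemma fderiv_le (hf : Firm f) {z : ℂ} (hd : DifferentiableAt ℝ f z) (v : ℂ) :
    ‖fderiv ℝ f z v‖ ^ 2 ≤ ⟪fderiv ℝ f z v, v⟫ := by
  have h1 : HasDerivAt (fun t : ℝ => f (z + t • v)) (fderiv ℝ f z v) 0 := by
    have h2 : HasDerivAt (fun t : ℝ => z + t • v) v 0 := by
      simpa using ((hasDerivAt_id (0 : ℝ)).smul_const v).const_add z
    have h3 : HasFDerivAt f (fderiv ℝ f z) (z + (0 : ℝ) • v) := by simpa using hd.hasFDerivAt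
    exact h3.comp_hasDerivAt (0 : ℝ) h2
  rw [hasDerivAt_iff_tendsto_slope_zero] at h1
  simp only [zero_add, zero_smul, add_zero] at h1
  refine le_of_tendsto_of_tendsto (h1.norm.pow 2) (h1.inner tendsto_const_nhds) ?_
  filter_upwards [self_mem_nhdsWithin] with t ht
  have h := hf (z + t • v) z
  rw [add_sub_cancel_left, real_inner_smul_right] at h
  rw [norm_smul, mul_pow, real_inner_smul_left, norm_inv, inv_pow, Real.norm_eq_abs, sq_abs]
  have ht' : t ≠ 0 := ht
  have ht2 : 0 < t ^ 2 := by positivity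
  rw [inv_mul_le_iff₀ ht2]
  calc _ ≤ _ := h
    _ = _ := by field_simp

lemma fderiv_id_sub {z : ℂ} (hd : DifferentiableAt ℝ f z) :
    fderiv ℝ (fun z => z - f z) z = ContinuousLinearMap.id ℝ ℂ - fderiv ℝ f z := by
  rw [fderiv_fun_sub differentiableAt_fun_id hd, fderiv_fun_id]

lemma eq_of_segment (hf : Firm f) {a b : ℂ} (hab : f a = f b) {t : ℝ} (ht0 : 0 ≤ t) (ht1 : t ≤ 1) :
    f (a + t • (b - a)) = f a := by
  have h1 := hf (a + t • (b - a)) a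
  have h2 := hf (a + t • (b - a)) b
  rw [add_sub_cancel_left, real_inner_smul_right] at h1
  rw [show a + t • (b - a) - b = -((1 - t) • (b - a)) by rw [sub_smul, one_smul]; ring,
    inner_neg_right, real_inner_smul_right, ← hab] at h2
  have h3 : ‖f (a + t • (b - a)) - f a‖ ^ 2 ≤ 0 := by
    rcases le_total 0 ⟪f (a + t • (b - a)) - f a, b - a⟫ with h | h <;> nlinarith
  have : ‖f (a + t • (b - a)) - f a‖ = 0 := by
    nlinarith [norm_nonneg (f (a + t • (b - a)) - f a)]
  exact sub_eq_zero.1 (norm_eq_zero.1 this)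

lemma eq_of_det_ne_zero (hf : Firm f) {a b : ℂ} (hd : DifferentiableAt ℝ f a)
    (hdet : (fderiv ℝ f a).det ≠ 0) (hab : f a = f b) : a = b := by
  by_contra hne
  have h1 : HasDerivWithinAt (fun t : ℝ => f (a + t • (b - a))) (fderiv ℝ f a (b - a)) (Ioi 0) 0 := by
    have h2 : HasDerivAt (fun t : ℝ => a + t • (b - a)) (b - a) 0 := by
      simpa using ((hasDerivAt_id (0 : ℝ)).smul_const (b - a)).const_add a
    have h3 : HasFDerivAt f (fderiv ℝ f a) (a + (0 : ℝ) • (b - a)) := by simpa using hd.hasFDerivAt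
    exact (h3.comp_hasDerivAt (0 : ℝ) h2).hasDerivWithinAt
  have h4 : HasDerivWithinAt (fun t : ℝ => f (a + t • (b - a))) 0 (Ioi 0) 0 := by
    refine (hasDerivWithinAt_const (0 : ℝ) (Ioi 0) (f a)).congr_of_eventuallyEq ?_ (by simp)
    filter_upwards [Ioc_mem_nhdsGT one_pos] with t ht
    exact hf.eq_of_segment hab ht.1.le ht.2
  have h5 := (uniqueDiffWithinAt_Ioi (0 : ℝ)).eq_deriv _ h1 h4
  apply hdet
  have : ¬ Function.Injective (fderiv ℝ f a : ℂ →ₗ[ℝ] ℂ) := fun hi =>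
    hne (sub_eq_zero.1 (hi (by simpa using h5))).symm
  by_contra hdet'
  exact this (LinearMap.equivOfDetNeZero _ hdet').injective

/-- Points where the derivative exists and is invertible. -/
def reg (f : ℂ → ℂ) : Set ℂ := {z | DifferentiableAt ℝ f z ∧ (fderiv ℝ f z).det ≠ 0}

lemma measurable_det (f : ℂ → ℂ) : Measurable fun z => (fderiv ℝ f z).det :=
  ContinuousLinearMap.continuous_det.measurable.comp (measurable_fderiv ℝ f)

lemma measurableSet_reg (f : ℂ → ℂ) : MeasurableSet (reg f) :=
  (measurableSet_of_differentiableAt ℝ f).inter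
    ((measurable_det f) (measurableSet_singleton (0 : ℝ)).compl)

lemma injOn_reg (hf : Firm f) : InjOn f (reg f) := fun _ ha _ _ h =>
  hf.eq_of_det_ne_zero ha.1 ha.2 h

lemma volume_image (hf : Firm f) {s : Set ℂ} (hs : MeasurableSet s) (hsr : s ⊆ reg f) :
    ∫⁻ z in s, ENNReal.ofReal |(fderiv ℝ f z).det| = volume (f '' s) :=
  lintegral_abs_det_fderiv_eq_addHaar_image volume hs
    (fun _ hz => (hsr hz).1.hasFDerivAt.hasFDerivWithinAt) (hf.injOn_reg.mono hsr)

lemma measurableSet_image (hf : Firm f) {s : Set ℂ} (hs : MeasurableSet s) (hsr : s ⊆ reg f) :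
    MeasurableSet (f '' s) :=
  measurable_image_of_fderivWithin hs
    (fun _ hz => (hsr hz).1.hasFDerivAt.hasFDerivWithinAt) (hf.injOn_reg.mono hsr)

lemma volume_eq_zero_of_image (hf : Firm f) {s : Set ℂ} (hs : MeasurableSet s) (hsr : s ⊆ reg f)
    (h0 : volume (f '' s) = 0) : volume s = 0 := by
  have hm : Measurable fun z => ENNReal.ofReal |(fderiv ℝ f z).det| :=
    ENNReal.measurable_ofReal.comp (continuous_abs.measurable.comp (measurable_det f))
  rw [← hf.volume_image hs hsr, setLIntegral_eq_zero_iff hs hm] at h0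
  rw [measure_eq_zero_iff_ae_notMem]
  filter_upwards [h0] with z hz' hz
  have := hz' hz
  rw [ENNReal.ofReal_eq_zero] at this
  exact (hsr hz).2 (abs_nonpos_iff.1 this)

lemma volume_image_sing {s : Set ℂ}
    (hs : ∀ z ∈ s, DifferentiableAt ℝ f z ∧ (fderiv ℝ f z).det = 0) : volume (f '' s) = 0 :=
  addHaar_image_eq_zero_of_det_fderivWithin_eq_zero volume
    (fun z hz => (hs z hz).1.hasFDerivAt.hasFDerivWithinAt) fun z hz => (hs z hz).2

/-- A symmetric derivative of a firmly nonexpansive map has nonnegative determinant. -/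
lemma det_nonneg {A : ℂ →L[ℝ] ℂ} (hA : ∀ v, ‖A v‖ ^ 2 ≤ ⟪A v, v⟫)
    (hsym : (A 1).im = (A Complex.I).re) : 0 ≤ A.det := by
  rw [det_clm_complex, hsym]
  set a := (A 1).re
  set b := (A Complex.I).re
  set c := (A Complex.I).im
  have hI : b ^ 2 + c ^ 2 ≤ c := by
    have := hA Complex.I
    rw [← Complex.normSq_eq_norm_sq, Complex.normSq_apply, Complex.inner] at this
    simp at this
    nlinarith
  have hv : 0 ≤ a * c ^ 2 - 2 * b ^ 2 * c + c * b ^ 2 := by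
    have h1 := (sq_nonneg _).trans (hA ((c : ℝ) • (1 : ℂ) + (-b : ℝ) • Complex.I))
    rw [map_add, map_smul, map_smul, Complex.inner] at h1
    simp at h1
    rw [hsym] at h1
    change 0 ≤ c * (c * a + -(b * b)) + b * (-(c * b) + b * c) at h1
    nlinarith
  rcases (show 0 ≤ c by nlinarith).eq_or_lt with h0 | hc
  · have : b = 0 := by nlinarith
    rw [← h0, this]; simp
  · have : 0 ≤ c * (a * c - b * b) := by nlinarith
    exact nonneg_of_mul_nonneg_right this hc

end Firm

namespace OTPot

variable {U₁ U₂ : Set ℂ} {ψ : ℂ → ℝ} {T : ℂ → ℂ}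

lemma firm (h : OTPot U₁ U₂ ψ T) : Firm h.prox := h.prox_firm

lemma fderiv_prox_symm (h : OTPot U₁ U₂ ψ T) {ζ : ℂ} (hd : DifferentiableAt ℝ h.prox ζ)
    (v w : ℂ) : ⟪fderiv ℝ h.prox ζ v, w⟫ = ⟪fderiv ℝ h.prox ζ w, v⟫ := by
  set B : ℂ →L[ℝ] ℂ →L[ℝ] ℝ :=
    (isBoundedBilinearMap_inner (𝕜 := ℝ) (E := ℂ)).toContinuousLinearMap with hB
  have h1 : ∀ y, HasFDerivAt (fun ζ => ⟪ζ, h.prox ζ⟫ - ψ (h.prox ζ) - ‖h.prox ζ‖ ^ 2 / 2)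
      (B (h.prox y)) y := fun y => h.hasFDerivAt_conjugate y
  exact second_derivative_symmetric h1 (B.hasFDerivAt.comp ζ hd.hasFDerivAt) v w

lemma fderiv_prox_im (h : OTPot U₁ U₂ ψ T) {ζ : ℂ} (hd : DifferentiableAt ℝ h.prox ζ) :
    (fderiv ℝ h.prox ζ 1).im = (fderiv ℝ h.prox ζ Complex.I).re := by
  have := h.fderiv_prox_symm hd 1 Complex.I
  simpa [Complex.inner] using this

lemma volume_inter_eq {U S : Set ℂ} (hU : Convex ℝ U) (hUo : IsOpen U) (hS : S ⊆ closure U) :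
    volume (S ∩ U) = volume S := by
  refine le_antisymm (measure_mono inter_subset_left) ?_
  calc volume S ≤ volume (S ∩ U ∪ frontier U) := measure_mono fun z hz => by
        by_cases hzU : z ∈ U
        · exact Or.inl ⟨hz, hzU⟩
        · right
          rw [hUo.frontier_eq]
          exact ⟨hS hz, hzU⟩
    _ ≤ volume (S ∩ U) + volume (frontier U) := measure_union_le _ _
    _ = _ := by rw [hU.addHaar_frontier volume, add_zero]

lemma volume_image_eq (h : OTPot U₁ U₂ ψ T) {s : Set ℂ} (hs : MeasurableSet s)
    (hsr : s ⊆ Firm.reg fun z => z - h.prox z) (hsE : ∀ z ∈ s, h.prox z ∈ closure U₁) :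
    volume (h.prox '' s) = volume ((fun z => z - h.prox z) '' s) := by
  have hm := h.firm.id_sub.measurableSet_image hs hsr
  have h1 := h.map_eq _ hm
  rw [volume_inter_eq h.conv₂ h.open₂ (by rintro _ ⟨z, -, rfl⟩; exact h.tgt_mem_closure z)] at h1
  rw [← h1, ← volume_inter_eq h.conv₁ h.open₁ (S := h.prox '' s)
    (by rintro _ ⟨z, hz, rfl⟩; exact hsE z hz)]
  congr 1
  ext u
  constructor
  · rintro ⟨⟨z, hz, rfl⟩, hu⟩
    exact ⟨hu, z, hz, h.sub_prox_eq hu⟩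
  · rintro ⟨hu, z, hz, hzu⟩
    have h2 : z = u + T u := h.firm.id_sub.eq_of_det_ne_zero (hsr hz).1 (hsr hz).2 (by
      simp only at hzu ⊢
      rw [hzu, h.prox_add hu]; ring)
    exact ⟨⟨z, hz, by rw [h2, h.prox_add hu]⟩, hu⟩

/-- The two Jacobians agree almost everywhere. -/
lemma ae_det_eq (h : OTPot U₁ U₂ ψ T) : ∀ᵐ z, h.prox z ∈ closure U₁ → DifferentiableAt ℝ h.prox z →
    |(fderiv ℝ h.prox z).det| = |(fderiv ℝ (fun z => z - h.prox z) z).det| := by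
  set Q : ℂ → ℂ := fun z => z - h.prox z with hQ
  set E : Set ℂ := h.prox ⁻¹' closure U₁ with hE
  have hEm : MeasurableSet E := (isClosed_closure.preimage h.continuous_prox).measurableSet
  have hQf : Firm Q := h.firm.id_sub
  have hQd : ∀ z, DifferentiableAt ℝ h.prox z → DifferentiableAt ℝ Q z :=
    fun z hz => differentiableAt_fun_id.sub hz
  have hxd : ∀ z, DifferentiableAt ℝ Q z → DifferentiableAt ℝ h.prox z := fun z hz => by
    have := differentiableAt_fun_id.sub hz
    simpa [hQ, sub_sub_cancel] using this
  have hrx := Firm.measurableSet_reg h.prox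
  have hrQ := Firm.measurableSet_reg Q
  have n1 : volume (E ∩ (Firm.reg h.prox \ Firm.reg Q)) = 0 := by
    refine h.firm.volume_eq_zero_of_image (hEm.inter (hrx.diff hrQ)) (fun z hz => hz.2.1) ?_
    set s := E ∩ (Firm.reg h.prox \ Firm.reg Q) with hs
    have h0 : volume (Q '' s) = 0 := Firm.volume_image_sing fun z hz => by
      refine ⟨hQd z hz.2.1.1, ?_⟩
      by_contra hne
      exact hz.2.2 ⟨hQd z hz.2.1.1, hne⟩
    rw [← volume_inter_eq h.conv₁ h.open₁ (S := h.prox '' s)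
      (by rintro _ ⟨z, hz, rfl⟩; exact hz.1)]
    refine measure_mono_null ?_ ((h.map_eq _ (measurableSet_toMeasurable volume (Q '' s))).trans
      (measure_mono_null inter_subset_left ((measure_toMeasurable _).trans h0)))
    rintro _ ⟨⟨z, hz, rfl⟩, hu⟩
    refine ⟨hu, subset_toMeasurable _ _ ⟨z, hz, h.sub_prox_eq hu⟩⟩
  have n2 : volume (E ∩ (Firm.reg Q \ Firm.reg h.prox)) = 0 := by
    refine hQf.volume_eq_zero_of_image (hEm.inter (hrQ.diff hrx)) (fun z hz => hz.2.1) ?_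
    rw [← h.volume_image_eq (hEm.inter (hrQ.diff hrx)) (fun z hz => hz.2.1) fun z hz => hz.1]
    refine Firm.volume_image_sing fun z hz => ⟨hxd z hz.2.1.1, ?_⟩
    by_contra hne
    exact hz.2.2 ⟨hxd z hz.2.1.1, hne⟩
  have hM : MeasurableSet (E ∩ (Firm.reg Q ∩ Firm.reg h.prox)) := hEm.inter (hrQ.inter hrx)
  have n3 : (fun z => ENNReal.ofReal |(fderiv ℝ h.prox z).det|)
      =ᵐ[volume.restrict (E ∩ (Firm.reg Q ∩ Firm.reg h.prox))]
      fun z => ENNReal.ofReal |(fderiv ℝ Q z).det| := by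
    refine ae_eq_of_forall_setLIntegral_eq_of_sigmaFinite
      (ENNReal.measurable_ofReal.comp (continuous_abs.measurable.comp (Firm.measurable_det _)))
      (ENNReal.measurable_ofReal.comp (continuous_abs.measurable.comp (Firm.measurable_det _)))
      fun s hs _ => ?_
    have hm := hs.inter hM
    rw [Measure.restrict_restrict hs, h.firm.volume_image hm fun z hz => hz.2.2.2,
      hQf.volume_image hm fun z hz => hz.2.2.1,
      h.volume_image_eq hm (fun z hz => hz.2.2.1) fun z hz => hz.2.1]
  rw [Filter.EventuallyEq, ae_restrict_iff' hM] at n3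
  have n1' := measure_eq_zero_iff_ae_notMem.1 n1
  have n2' := measure_eq_zero_iff_ae_notMem.1 n2
  filter_upwards [n3, n1', n2'] with z h3 h1 h2 hzE hzd
  by_cases ha : (fderiv ℝ h.prox z).det = 0 <;> by_cases hb : (fderiv ℝ Q z).det = 0
  · rw [ha, hb]
  · exact absurd ⟨hzE, ⟨hQd z hzd, hb⟩, fun hr => hr.2 ha⟩ h2
  · exact absurd ⟨hzE, ⟨hzd, ha⟩, fun hr => hr.2 hb⟩ h1
  · have := h3 ⟨hzE, ⟨hQd z hzd, hb⟩, hzd, ha⟩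
    rwa [ENNReal.ofReal_eq_ofReal_iff (abs_nonneg _) (abs_nonneg _)] at this

end OTPot

/-- A Lipschitz function which is almost everywhere complex differentiable is holomorphic. -/
lemma LipschitzWith.differentiableOn_of_ae {g : ℂ → ℂ} (hg : LipschitzWith 1 g) {O : Set ℂ}
    (hO : IsOpen O) (hd : ∀ᵐ z, z ∈ O → DifferentiableAt ℂ g z) : DifferentiableOn ℂ g O := by
  intro z₀ hz₀
  obtain ⟨r, hr, hrO⟩ := Metric.isOpen_iff.1 hO z₀ hz₀
  set ε : ℕ → ℝ := fun n => r / 2 / (n + 1) with hε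
  have hε0 : ∀ n, 0 < ε n := fun n => by positivity
  have hεr : ∀ n, ε n ≤ r / 2 := fun n => div_le_self (by positivity) (by
    have : (0 : ℝ) ≤ n := n.cast_nonneg
    linarith)
  have hεlim : Filter.Tendsto ε Filter.atTop (nhds 0) := by
    simpa [hε, div_eq_mul_inv] using
      (tendsto_one_div_add_atTop_nhds_zero_nat (𝕜 := ℝ)).const_mul (r / 2)
  set G : ℕ → ℂ → ℂ := fun n z => ⨍ t in ball (0 : ℂ) (ε n), g (z + t) with hG
  have hfin : ∀ n, volume (ball (0 : ℂ) (ε n)) ≠ ⊤ := fun n => measure_ball_lt_top.ne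
  have hpos : ∀ n, volume (ball (0 : ℂ) (ε n)) ≠ 0 := fun n => (measure_ball_pos _ _ (hε0 n)).ne'
  have hintegr : ∀ n z, IntegrableOn (fun t => g (z + t)) (ball 0 (ε n)) := fun n z =>
    ((hg.continuous.comp (continuous_const.add continuous_id)).continuousOn.integrableOn_compact
      (isCompact_closedBall 0 (ε n))).mono_set ball_subset_closedBall
  have hGd : ∀ n, DifferentiableOn ℂ (G n) (ball z₀ (r / 2)) := by
    intro n z hz
    have hae : ∀ᵐ t ∂(volume.restrict (ball (0 : ℂ) (ε n))),
        HasDerivAt (fun w => g (w + t)) (deriv g (z + t)) z := by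
      rw [ae_restrict_iff' measurableSet_ball]
      have := (measurePreserving_add_left volume z).quasiMeasurePreserving.ae hd
      filter_upwards [this] with t ht ht'
      refine HasDerivAt.comp_add_const z t (ht (hrO ?_)).hasDerivAt
      rw [mem_ball, dist_eq_norm] at hz ⊢
      rw [mem_ball_zero_iff] at ht'
      calc ‖z + t - z₀‖ = ‖(z - z₀) + t‖ := by ring_nf
        _ ≤ ‖z - z₀‖ + ‖t‖ := norm_add_le _ _
        _ < r := by linarith [hεr n]
    have : IsFiniteMeasure (volume.restrict (ball (0 : ℂ) (ε n))) :=
      ⟨by rw [Measure.restrict_apply_univ]; exact measure_ball_lt_top⟩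
    have := (hasDerivAt_integral_of_dominated_loc_of_lip (μ := volume.restrict (ball (0 : ℂ) (ε n)))
      (F := fun w t => g (w + t)) (F' := fun t => deriv g (z + t)) (bound := fun _ => 1)
      (s := univ) Filter.univ_mem
      (Filter.Eventually.of_forall fun w => (hintegr n w).aestronglyMeasurable) (hintegr n z)
      (((measurable_deriv g).comp (measurable_const.add measurable_id)).aestronglyMeasurable)
      (Filter.Eventually.of_forall fun t => by
        simp only [map_one]
        exact LipschitzOnWith.of_dist_le_mul fun a _ b _ => by
          simpa using hg.dist_le_mul (a + t) (b + t))
      (integrable_const 1) hae).2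
    have h2 := this.differentiableAt.const_smul (volume.real (ball (0 : ℂ) (ε n)))⁻¹
    refine DifferentiableAt.differentiableWithinAt ?_
    refine h2.congr_of_eventuallyEq (Filter.Eventually.of_forall fun w => ?_)
    simp [hG, setAverage_eq]
  have hGl : TendstoLocallyUniformlyOn G g Filter.atTop (ball z₀ (r / 2)) := by
    apply TendstoUniformlyOn.tendstoLocallyUniformlyOn
    rw [Metric.tendstoUniformlyOn_iff]
    intro η hη
    filter_upwards [hεlim.eventually (gt_mem_nhds hη)] with n hn z hz
    refine lt_of_le_of_lt ?_ hn
    rw [dist_comm, ← mem_closedBall]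
    refine (convex_closedBall (g z) (ε n)).set_average_mem isClosed_closedBall (hpos n) (hfin n)
      ?_ (hintegr n z)
    rw [ae_restrict_iff' measurableSet_ball]
    refine Filter.Eventually.of_forall fun t ht => ?_
    rw [mem_closedBall]
    rw [mem_ball_zero_iff] at ht
    have := hg.dist_le_mul (z + t) z
    rw [dist_eq_norm (z + t), add_sub_cancel_left] at this
    simp at this
    linarith
  exact ((hGl.differentiableOn (Filter.Eventually.of_forall hGd) isOpen_ball).differentiableAt
    (ball_mem_nhds z₀ (by positivity))).differentiableWithinAt

lemma exists_inner_lt {U : Set ℂ} (hU : IsOpen U) (hc : Convex ℝ U) {x : ℂ} (hx : x ∉ U) :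
    ∃ v : ℂ, ∀ a ∈ U, ⟪v, a⟫ < ⟪v, x⟫ := by
  obtain ⟨f, hf⟩ := geometric_hahn_banach_open_point hc hU hx
  refine ⟨(InnerProductSpace.toDual ℝ ℂ).symm f, fun a ha => ?_⟩
  simpa only [InnerProductSpace.toDual_symm_apply] using hf a ha

lemma inner_le_of_mem_closure {U : Set ℂ} {v : ℂ} {m : ℝ} (h : ∀ a ∈ U, ⟪v, a⟫ ≤ m) {x : ℂ}
    (hx : x ∈ closure U) : ⟪v, x⟫ ≤ m :=
  closure_minimal (s := U) (t := {a | ⟪v, a⟫ ≤ m}) h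
    (isClosed_le (continuous_const.inner continuous_id) continuous_const) hx

/-- Strong maximum principle for real parts. -/
lemma re_eq_of_isMaxOn {F : ℂ → ℂ} {O : Set ℂ} {c : ℂ} (hO : IsPreconnected O) (ho : IsOpen O)
    (hF : DifferentiableOn ℂ F O) (hc : c ∈ O) (hm : ∀ z ∈ O, (F z).re ≤ (F c).re) {z : ℂ}
    (hz : z ∈ O) : (F z).re = (F c).re := by
  have := Complex.norm_eqOn_of_isPreconnected_of_isMaxOn hO ho hF.cexp hc (fun w hw => by
    simp only [mem_ofPred_eq, Function.comp, Complex.norm_exp]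
    exact Real.exp_le_exp.2 (hm w hw)) hz
  simpa [Complex.norm_exp] using this

namespace OTPot

variable {U₁ U₂ : Set ℂ} {ψ : ℂ → ℝ} {T : ℂ → ℂ}

lemma ae_differentiableAt_refl (h : OTPot U₁ U₂ ψ T) :
    ∀ᵐ z, h.prox z ∈ closure U₁ → DifferentiableAt ℂ h.refl z := by
  filter_upwards [h.ae_det_eq, h.prox_lipschitz.ae_differentiableAt] with z h1 hd hz
  have h2 := h1 hz hd
  have hs := h.fderiv_prox_im hd
  have hq := Firm.fderiv_id_sub hd
  rw [abs_of_nonneg (Firm.det_nonneg (h.firm.fderiv_le hd) hs), abs_of_nonneg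
    (Firm.det_nonneg (h.firm.id_sub.fderiv_le (differentiableAt_fun_id.sub hd)) (by
      rw [hq]; simp [hs])), hq, det_clm_complex, det_clm_complex] at h2
  have hD : HasFDerivAt h.refl
      ((Complex.conjCLE : ℂ →L[ℝ] ℂ).comp ((2 : ℝ) • fderiv ℝ h.prox z - .id ℝ ℂ)) z := by
    have h3 : HasFDerivAt (fun w => (2 : ℝ) • h.prox w - w)
        ((2 : ℝ) • fderiv ℝ h.prox z - .id ℝ ℂ) z :=
      (hd.hasFDerivAt.const_smul (2 : ℝ)).sub (hasFDerivAt_id z)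
    have h4 := (Complex.conjCLE : ℂ →L[ℝ] ℂ).hasFDerivAt.comp z h3
    refine h4.congr_of_eventuallyEq (Filter.Eventually.of_forall fun w => ?_)
    simp [refl, Complex.real_smul]
  rw [differentiableAt_complex_iff_differentiableAt_real]
  refine ⟨hD.differentiableAt, ?_⟩
  rw [hD.fderiv]
  simp at h2
  apply Complex.ext
  · simp; linarith
  · simp; linarith

lemma differentiableOn_refl (h : OTPot U₁ U₂ ψ T) {O : Set ℂ} (hO : IsOpen O)
    (hE : ∀ z ∈ O, h.prox z ∈ closure U₁) : DifferentiableOn ℂ h.refl O := by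
  refine h.refl_lipschitz.differentiableOn_of_ae hO ?_
  filter_upwards [h.ae_differentiableAt_refl] with z hz hzO using hz (hE z hzO)

lemma exists_T_mem (h : OTPot U₁ U₂ ψ T) {O : Set ℂ} (hO : IsOpen O) (hne : O.Nonempty)
    (hO2 : O ⊆ U₂) : ∃ u ∈ U₁, T u ∈ O := by
  have h1 := h.map_eq O hO.measurableSet
  rw [inter_eq_left.2 hO2] at h1
  have h2 : volume (U₁ ∩ T ⁻¹' O) ≠ 0 := by rw [h1]; exact (hO.measure_pos volume hne).ne'
  obtain ⟨u, hu, hu'⟩ := nonempty_of_measure_ne_zero h2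
  exact ⟨u, hu, hu'⟩

/-- Points whose target lies in `U₂` have their source in the closure of `U₁`. -/
lemma prox_mem_closure (h : OTPot U₁ U₂ ψ T) {ζ : ℂ} (hζ : ζ - h.prox ζ ∈ U₂) :
    h.prox ζ ∈ closure U₁ := by
  by_contra hx
  obtain ⟨f, m, hm, hmx⟩ := geometric_hahn_banach_closed_point h.conv₁.closure isClosed_closure hx
  set v := (InnerProductSpace.toDual ℝ ℂ).symm f with hv
  have hfv : ∀ a, f a = ⟪v, a⟫ := fun a => (InnerProductSpace.toDual_symm_apply).symm
  set x := h.prox ζ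
  set p := ζ - x
  set η := f x - m with hη
  have hη0 : 0 < η := by linarith
  obtain ⟨R, hR⟩ := h.bdd₁.subset_ball x
  obtain ⟨u₀, hu₀⟩ := h.nonempty₁
  have hR0 : 0 < R := pos_of_mem_ball (hR hu₀)
  obtain ⟨ρ, hρ, hρU⟩ := Metric.isOpen_iff.1 h.open₂ p hζ
  set t := ρ / 2 / (‖v‖ + 1) with ht
  have ht0 : 0 < t := by positivity
  have htv : t * ‖v‖ < ρ / 2 := by
    rw [ht, div_mul_eq_mul_div, div_lt_iff₀ (by positivity)]
    nlinarith [norm_nonneg v]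
  set s := min (ρ / 2) (t * η / R) with hs
  have hs0 : 0 < s := by positivity
  obtain ⟨u, hu, hTu⟩ := h.exists_T_mem (O := ball (p + t • v) s) isOpen_ball
    ⟨_, mem_ball_self hs0⟩ fun z hz => hρU (by
      rw [mem_ball, dist_eq_norm] at hz ⊢
      calc ‖z - p‖ = ‖(z - (p + t • v)) + t • v‖ := by ring_nf
        _ ≤ ‖z - (p + t • v)‖ + ‖t • v‖ := norm_add_le _ _
        _ < s + ρ / 2 := by
          rw [norm_smul, Real.norm_of_nonneg ht0.le]; exact add_lt_add hz htv
        _ ≤ ρ := by linarith [min_le_left (ρ / 2) (t * η / R)])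
  have h1 := subgrad_mono (h.prox_spec ζ) (h.T_sub u hu)
  have hux : ‖x - u‖ < R := by
    have := hR hu
    rwa [mem_ball, dist_comm, dist_eq_norm] at this
  rw [mem_ball, dist_eq_norm] at hTu
  have e : p - T u = -(T u - (p + t • v)) - t • v := by ring
  change 0 ≤ ⟪x - u, p - T u⟫ at h1
  rw [e, inner_sub_right, real_inner_smul_right] at h1
  have h2 : ⟪x - u, -(T u - (p + t • v))⟫ ≤ R * s := by
    refine (real_inner_le_norm _ _).trans ?_
    rw [norm_neg]
    gcongr
  have h3 : η < ⟪x - u, v⟫ := by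
    rw [real_inner_comm, inner_sub_right, ← hfv, ← hfv]
    have := hm u (subset_closure hu)
    linarith
  have h4 : R * s ≤ t * η := by
    calc R * s ≤ R * (t * η / R) := by gcongr; exact min_le_right _ _
      _ = t * η := by field_simp
  nlinarith

lemma inner_prox (h : OTPot U₁ U₂ ψ T) (v ζ : ℂ) :
    ⟪v, h.prox ζ⟫ = ((conj v * ζ + v * h.refl ζ) / 2).re := by
  rw [← h.srcPt_refl, srcPt, Complex.inner]
  simp
  ring

lemma inner_sub_prox (h : OTPot U₁ U₂ ψ T) (v ζ : ℂ) :
    ⟪v, ζ - h.prox ζ⟫ = ((conj v * ζ - v * h.refl ζ) / 2).re := by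
  rw [← h.tgtPt_refl, tgtPt, Complex.inner]
  simp
  ring

lemma holo_dom (h : OTPot U₁ U₂ ψ T) : DifferentiableOn ℂ h.refl h.dom :=
  h.differentiableOn_refl h.isOpen_dom fun _ hz => subset_closure hz

lemma src_frontier (h : OTPot U₁ U₂ ψ T) {ζ : ℂ} (hζ : ζ ∈ frontier h.dom) :
    h.prox ζ ∈ frontier U₁ := by
  rw [h.isOpen_dom.frontier_eq] at hζ
  rw [h.open₁.frontier_eq]
  exact ⟨map_mem_closure h.continuous_prox hζ.1 fun _ hz => hz, hζ.2⟩

lemma tgt_frontier (h : OTPot U₁ U₂ ψ T) {ζ : ℂ} (hζ : ζ ∈ frontier h.dom) :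
    ζ - h.prox ζ ∈ frontier U₂ := by
  have hx := h.src_frontier hζ
  rw [h.open₁.frontier_eq] at hx
  rw [h.open₂.frontier_eq]
  refine ⟨h.tgt_mem_closure ζ, fun hp => ?_⟩
  obtain ⟨v, hv⟩ := exists_inner_lt h.open₁ h.conv₁ hx.2
  have hop : IsOpen ((fun z => z - h.prox z) ⁻¹' U₂) :=
    h.open₂.preimage (continuous_id.sub h.continuous_prox)
  obtain ⟨r, hr, hrO⟩ := Metric.isOpen_iff.1 hop ζ hp
  obtain ⟨z, hz, hzd⟩ := Metric.mem_closure_iff.1 (frontier_subset_closure hζ) r hr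
  have hE : ∀ z ∈ ball ζ r, h.prox z ∈ closure U₁ := fun z hz => h.prox_mem_closure (hrO hz)
  have hF : DifferentiableOn ℂ (fun ζ => (conj v * ζ + v * h.refl ζ) / 2) (ball ζ r) :=
    ((differentiableOn_id.const_mul _).add
      ((h.differentiableOn_refl isOpen_ball hE).const_mul v)).div_const 2
  have := re_eq_of_isMaxOn (convex_ball ζ r).isPreconnected isOpen_ball hF (mem_ball_self hr)
    (fun z hz => by
      rw [← h.inner_prox, ← h.inner_prox]
      exact inner_le_of_mem_closure (fun a ha => (hv a ha).le) (hE z hz))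
    (mem_ball'.2 hzd)
  rw [← h.inner_prox, ← h.inner_prox] at this
  exact (hv _ hz).ne this

lemma tgt_mem (h : OTPot U₁ U₂ ψ T) {ζ : ℂ} (hζ : ζ ∈ h.dom) : ζ - h.prox ζ ∈ U₂ := by
  by_contra hp
  obtain ⟨v, hv⟩ := exists_inner_lt h.open₂ h.conv₂ hp
  have hF : DifferentiableOn ℂ (fun ζ => (conj v * ζ - v * h.refl ζ) / 2) h.dom :=
    ((differentiableOn_id.const_mul _).sub (h.holo_dom.const_mul v)).div_const 2
  have hne : U₂.Nonempty := nonempty_of_measure_ne_zero (μ := volume) (by rw [h.vol₂]; simp)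
  obtain ⟨u, hu, hTu⟩ := h.exists_T_mem h.open₂ hne subset_rfl
  have hud : u + T u ∈ h.dom := by rw [h.dom_eq]; exact ⟨u, hu, rfl⟩
  have := re_eq_of_isMaxOn h.isPreconnected_dom h.isOpen_dom hF hζ
    (fun z _ => by
      rw [← h.inner_sub_prox, ← h.inner_sub_prox]
      exact inner_le_of_mem_closure (fun a ha => (hv a ha).le) (h.tgt_mem_closure z)) hud
  rw [← h.inner_sub_prox, ← h.inner_sub_prox, h.prox_add hu, add_sub_cancel_left] at this
  exact (hv _ hTu).ne this

end OTPot

/-! ### Inradius of planar convex sets and the base point -/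

lemma volume_slab_le {v : ℂ} (hv : ‖v‖ = 1) {S : Set ℂ} {m w d : ℝ} (hw : 0 ≤ w)
    (h1 : ∀ u ∈ S, ⟪v, u⟫ ∈ Icc m (m + w)) (h2 : ∀ a ∈ S, ∀ b ∈ S, ‖a - b‖ ≤ d) :
    volume S ≤ ENNReal.ofReal (w * (2 * d)) := by
  rcases S.eq_empty_or_nonempty with rfl | ⟨b, hb⟩
  · simp
  set e : ℂ ≃ₗᵢ[ℝ] ℂ := rotation ⟨conj v, by simp [Submonoid.unitSphere, hv]⟩ with he
  have hea : ∀ u, e u = conj v * u := fun u => rfl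
  set q := (e b).im with hq
  have hP : MeasurableSet (Icc m (m + w) ×ˢ Icc (q - d) (q + d)) :=
    measurableSet_Icc.prod measurableSet_Icc
  have hsub : S ⊆ e ⁻¹' (Complex.measurableEquivRealProd ⁻¹'
      (Icc m (m + w) ×ˢ Icc (q - d) (q + d))) := by
    intro u hu
    have h3 := h1 u hu
    have h4 : |(e u).im - q| ≤ d := by
      calc |(e u).im - q| = |(e (u - b)).im| := by rw [map_sub, Complex.sub_im]
        _ ≤ ‖e (u - b)‖ := Complex.abs_im_le_norm _
        _ ≤ d := by rw [e.norm_map]; exact h2 u hu b hb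
    rw [abs_le] at h4
    have h5 : ⟪v, u⟫ = (e u).re := by rw [hea, Complex.inner, mul_comm]
    rw [h5] at h3
    exact ⟨h3, ⟨by simpa using by linarith, by simpa using by linarith⟩⟩
  calc volume S ≤ _ := measure_mono hsub
    _ = ENNReal.ofReal w * ENNReal.ofReal (2 * d) := by
      rw [e.measurePreserving.measure_preimage
        (Complex.measurableEquivRealProd.measurable hP).nullMeasurableSet,
        Complex.volume_preserving_equiv_real_prod.measure_preimage hP.nullMeasurableSet,
        Measure.volume_eq_prod, Measure.prod_prod, Real.volume_Icc, Real.volume_Icc]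
      congr 2 <;> ring
    _ = _ := (ENNReal.ofReal_mul hw).symm

/-- A planar convex set of unit area contains a disc whose radius is controlled by the diameter. -/
lemma exists_ball_subset_of_convex {U : Set ℂ} (ho : IsOpen U) (hc : Convex ℝ U)
    (hU : volume U = 1) {d : ℝ} (hd : 1 ≤ d) (hdiam : ∀ a ∈ U, ∀ b ∈ U, ‖a - b‖ ≤ d) :
    ∃ z, ball z (1 / (8 * d)) ⊆ U := by
  have hne : U.Nonempty := by
    by_contra hne
    rw [not_nonempty_iff_eq_empty.1 hne] at hU
    simp at hU
  obtain ⟨b, hb⟩ := hne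
  have hpr : IsProbabilityMeasure (volume.restrict U) := ⟨by simpa using hU⟩
  have hintegr : Integrable (fun u : ℂ => u) (volume.restrict U) := by
    refine Integrable.of_bound aestronglyMeasurable_id (‖b‖ + d) ?_
    filter_upwards [ae_restrict_mem ho.measurableSet] with u hu
    calc ‖u‖ = ‖b + (u - b)‖ := by ring_nf
      _ ≤ ‖b‖ + ‖u - b‖ := norm_add_le _ _
      _ ≤ ‖b‖ + d := by linarith [hdiam u hu b hb]
  refine ⟨∫ u in U, u, fun z hz => ?_⟩
  by_contra hzU
  obtain ⟨v₀, hv₀⟩ := exists_inner_lt ho hc hzU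
  have hvne : v₀ ≠ 0 := by
    rintro rfl
    simpa using hv₀ b hb
  have hvn : 0 < ‖v₀‖ := norm_pos_iff.2 hvne
  set v : ℂ := ‖v₀‖⁻¹ • v₀ with hv
  have hv1 : ‖v‖ = 1 := by rw [hv, norm_smul, norm_inv, norm_norm]; field_simp
  have hvlt : ∀ a ∈ U, ⟪v, a⟫ < ⟪v, z⟫ := fun a ha => by
    rw [hv, real_inner_smul_left, real_inner_smul_left]
    exact mul_lt_mul_of_pos_left (hv₀ a ha) (inv_pos.2 hvn)
  set m := ⟪v, z⟫ with hm
  set s := 1 / (8 * d) with hs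
  have hs0 : 0 < s := by positivity
  have hlt : ∫ u in U, (m - ⟪v, u⟫) < s := by
    rw [integral_sub (integrable_const _) (hintegr.const_inner v), integral_inner hintegr,
      integral_const]
    simp only [probReal_univ, one_smul]
    rw [hm, ← inner_sub_right]
    calc _ ≤ ‖v‖ * ‖z - ∫ u in U, u‖ := real_inner_le_norm _ _
      _ < s := by rw [hv1, one_mul, ← dist_eq_norm]; exact hz
  have hmk := mul_meas_ge_le_integral_of_nonneg (μ := volume.restrict U)
    (f := fun u => m - ⟪v, u⟫) (by
      filter_upwards [ae_restrict_mem ho.measurableSet] with u hu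
      simpa using (hvlt u hu).le) ((integrable_const _).sub (hintegr.const_inner v)) (2 * s)
  set A := {u | 2 * s ≤ m - ⟪v, u⟫} with hA
  have hAm : MeasurableSet A := by
    refine measurableSet_le measurable_const (Continuous.measurable ?_)
    exact continuous_const.sub (continuous_const.inner continuous_id)
  have hsl : volume (U ∩ Aᶜ) ≤ ENNReal.ofReal (1 / 2) := by
    have := volume_slab_le hv1 (S := U ∩ Aᶜ) (m := m - 2 * s) (w := 2 * s) (d := d)
      (by positivity) (fun u hu => by
        have h1 := hvlt u hu.1
        have h2 : ¬ 2 * s ≤ m - ⟪v, u⟫ := hu.2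
        constructor <;> linarith) fun a ha b hb => hdiam a ha.1 b hb.1
    rwa [show 2 * s * (2 * d) = 1 / 2 by rw [hs]; field_simp; norm_num] at this
  have h1 : (volume.restrict U).real A + (volume.restrict U).real Aᶜ = 1 := by
    rw [measureReal_add_measureReal_compl hAm, probReal_univ]
  have h2 : (volume.restrict U).real Aᶜ ≤ 1 / 2 := by
    rw [measureReal_def, Measure.restrict_apply hAm.compl, inter_comm]
    exact ENNReal.toReal_le_of_le_ofReal (by norm_num) hsl
  nlinarith

/-- A convex set of unit area contains a set of area `9/16` at definite distance from the
complement. -/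
lemma exists_core {U : Set ℂ} (ho : IsOpen U) (hc : Convex ℝ U)
    (hU : volume U = 1) {d : ℝ} (hd : 1 ≤ d) (hdiam : ∀ a ∈ U, ∀ b ∈ U, ‖a - b‖ ≤ d) :
    ∃ G ⊆ U, IsOpen G ∧ volume G = ENNReal.ofReal (9 / 16) ∧
      ∀ g ∈ G, ball g (1 / (32 * d)) ⊆ U := by
  obtain ⟨z, hz⟩ := exists_ball_subset_of_convex ho hc hU hd hdiam
  have hb : ∀ g ∈ AffineMap.homothety z (3 / 4 : ℝ) '' U, ball g (1 / (32 * d)) ⊆ U := by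
    rintro _ ⟨u, hu, rfl⟩ p hp
    rw [mem_ball, dist_eq_norm] at hp
    set g := AffineMap.homothety z (3 / 4 : ℝ) u with hg
    have h1 : z + (4 : ℝ) • (p - g) ∈ U := hz (by
      rw [mem_ball, dist_eq_norm, add_sub_cancel_left, norm_smul, Real.norm_ofNat]
      have : 1 / (8 * d) = 4 * (1 / (32 * d)) := by field_simp; norm_num
      linarith)
    have h2 := hc hu h1 (by norm_num : (0 : ℝ) ≤ 3 / 4) (by norm_num : (0 : ℝ) ≤ 1 / 4) (by norm_num)
    convert h2 using 1
    rw [hg, AffineMap.homothety_apply]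
    simp only [vsub_eq_sub, vadd_eq_add, Complex.real_smul]
    push_cast
    ring
  refine ⟨_, fun g hg => hb g hg (mem_ball_self (by positivity)),
    AffineMap.homothety_isOpenMap z _ (by norm_num) _ ho, ?_, hb⟩
  rw [Measure.addHaar_image_homothety, hU, mul_one, Complex.finrank_real_complex]
  norm_num

namespace OTPot

variable {U₁ U₂ : Set ℂ} {ψ : ℂ → ℝ} {T : ℂ → ℂ}

lemma hasFDerivAt_prox (h : OTPot U₁ U₂ ψ T) {ζ : ℂ} (hζ : ζ ∈ h.dom) :
    ∃ A : ℂ →L[ℝ] ℂ, HasFDerivAt h.prox A ζ ∧ A.det = (1 - ‖deriv h.refl ζ‖ ^ 2) / 4 := by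
  have hd := ((h.holo_dom.differentiableAt (h.isOpen_dom.mem_nhds hζ)).hasDerivAt).hasFDerivAt
  have h1 := hd.restrictScalars ℝ
  have h2 := ((hasFDerivAt_id ζ).add
    (Complex.conjCLE.toContinuousLinearMap.hasFDerivAt.comp ζ h1)).const_smul (2⁻¹ : ℝ)
  refine ⟨_, h2.congr_of_eventuallyEq (Filter.Eventually.of_forall fun w => ?_), ?_⟩
  · simp [← h.srcPt_refl, srcPt]
    ring
  · rw [det_clm_complex, Complex.sq_norm, Complex.normSq_apply]
    simp
    ring

/-- The transport data in the Minty plane, with a base point of controlled quality. -/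
lemma exists_otData (h : OTPot U₁ U₂ ψ T) {d : ℝ} (hd : 1 ≤ d)
    (hd₁ : ∀ a ∈ U₁, ∀ b ∈ U₁, ‖a - b‖ ≤ d) (hd₂ : ∀ a ∈ U₂, ∀ b ∈ U₂, ‖a - b‖ ≤ d) :
    ∃ y, OTData (1 / (32 * d)) (2 * d) (1 / (128 * d ^ 2)) h.refl h.dom U₁ U₂ y := by
  set c := 1 / (128 * d ^ 2) with hc
  have hdpos : 0 < d := by linarith
  obtain ⟨G₁, hG₁, hG₁o, hG₁v, hG₁b⟩ := exists_core h.open₁ h.conv₁ h.vol₁ hd hd₁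
  obtain ⟨G₂, hG₂, hG₂o, hG₂v, hG₂b⟩ := exists_core h.open₂ h.conv₂ h.vol₂ hd hd₂
  have hdom : ∀ ζ ∈ h.dom, ∀ y ∈ h.dom, ‖ζ - y‖ ≤ 2 * d := by
    intro ζ hζ y hy
    calc ‖ζ - y‖ = ‖(h.prox ζ - h.prox y) + ((ζ - h.prox ζ) - (y - h.prox y))‖ := by ring_nf
      _ ≤ ‖h.prox ζ - h.prox y‖ + ‖(ζ - h.prox ζ) - (y - h.prox y)‖ := norm_add_le _ _
      _ ≤ d + d := add_le_add (hd₁ _ hζ _ hy) (hd₂ _ (h.tgt_mem hζ) _ (h.tgt_mem hy))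
      _ = 2 * d := by ring
  have key : ∃ u ∈ G₁, T u ∈ G₂ ∧ ‖deriv h.refl (u + T u)‖ ≤ 1 - c := by
    by_contra! hcon
    set N := h.dom ∩ {ζ | 1 - c < ‖deriv h.refl ζ‖} with hN
    have hNm : MeasurableSet N := h.isOpen_dom.measurableSet.inter
      (measurableSet_lt measurable_const (measurable_deriv h.refl).norm)
    have hW : ENNReal.ofReal (1 / 8) ≤ volume (G₁ ∩ (U₁ ∩ T ⁻¹' G₂)) := by
      have h1 := measure_union_add_inter' (μ := volume) hG₁o.measurableSet (U₁ ∩ T ⁻¹' G₂)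
      rw [h.map_eq _ hG₂o.measurableSet, inter_eq_left.2 hG₂, hG₁v, hG₂v,
        ← ENNReal.ofReal_add (by norm_num) (by norm_num)] at h1
      have h2 : volume (G₁ ∪ U₁ ∩ T ⁻¹' G₂) ≤ ENNReal.ofReal 1 := by
        rw [ENNReal.ofReal_one, ← h.vol₁]
        exact measure_mono (union_subset hG₁ inter_subset_left)
      have h3 : ENNReal.ofReal 1 + ENNReal.ofReal (1 / 8) ≤
          ENNReal.ofReal 1 + volume (G₁ ∩ (U₁ ∩ T ⁻¹' G₂)) := by
        rw [← ENNReal.ofReal_add (by norm_num) (by norm_num)]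
        calc ENNReal.ofReal (1 + 1 / 8) = ENNReal.ofReal (9 / 16 + 9 / 16) := by norm_num
          _ = _ := h1.symm
          _ ≤ _ := by gcongr
      exact (ENNReal.add_le_add_iff_left ENNReal.ofReal_ne_top).1 h3
    have hsub : G₁ ∩ (U₁ ∩ T ⁻¹' G₂) ⊆ h.prox '' N := by
      rintro u ⟨hu, hu1, hu2⟩
      refine ⟨u + T u, ⟨?_, hcon u hu hu2⟩, h.prox_add hu1⟩
      rw [h.dom_eq]
      exact mem_image_of_mem _ hu1
    have hNv : volume N ≤ ENNReal.ofReal (16 * d ^ 2) := by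
      rcases N.eq_empty_or_nonempty with hNe | ⟨y, hy⟩
      · simp [hNe]
      calc volume N ≤ volume (closedBall y (2 * d)) := measure_mono fun ζ hζ => by
            rw [mem_closedBall, dist_eq_norm]; exact hdom ζ hζ.1 y hy.1
        _ = ENNReal.ofReal ((2 * d) ^ 2 * Real.pi) := by
            rw [Complex.volume_closedBall, ENNReal.ofReal_mul (p := (2 * d) ^ 2) (by positivity),
              ENNReal.ofReal_pow (by positivity), ← ENNReal.ofReal_coe_nnreal, NNReal.coe_real_pi]
        _ ≤ _ := ENNReal.ofReal_le_ofReal (by nlinarith [Real.pi_le_four, sq_nonneg d])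
    have hfd : ∀ ζ ∈ N, HasFDerivWithinAt h.prox (fderiv ℝ h.prox ζ) N ζ := fun ζ hζ => by
      obtain ⟨A, hA, -⟩ := h.hasFDerivAt_prox hζ.1
      exact hA.differentiableAt.hasFDerivAt.hasFDerivWithinAt
    have hle : volume (h.prox '' N) ≤ ENNReal.ofReal (c / 2) * volume N := by
      refine (addHaar_image_le_lintegral_abs_det_fderiv volume hNm hfd).trans ?_
      rw [← setLIntegral_const]
      refine setLIntegral_mono' hNm fun ζ hζ => ENNReal.ofReal_le_ofReal ?_
      obtain ⟨A, hA, hdet⟩ := h.hasFDerivAt_prox hζ.1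
      have h1 : 1 - c < ‖deriv h.refl ζ‖ := hζ.2
      have h2 : ‖deriv h.refl ζ‖ ≤ 1 := by
        simpa using norm_deriv_le_of_lipschitz h.refl_lipschitz
      rw [hA.fderiv, hdet, abs_of_nonneg (by nlinarith [norm_nonneg (deriv h.refl ζ)])]
      nlinarith [norm_nonneg (deriv h.refl ζ)]
    have := hW.trans ((measure_mono hsub).trans (hle.trans (mul_le_mul_right hNv _)))
    rw [← ENNReal.ofReal_mul (by positivity), ENNReal.ofReal_le_ofReal_iff (by positivity)] at this
    rw [show c / 2 * (16 * d ^ 2) = 1 / 16 by rw [hc]; field_simp; norm_num] at this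
    norm_num at this
  obtain ⟨u, hu, hTu, hder⟩ := key
  have hu1 := hG₁ hu
  have hp := h.prox_add hu1
  have hy : u + T u ∈ h.dom := by rw [h.dom_eq]; exact mem_image_of_mem _ hu1
  exact ⟨u + T u, {
    R_pos := by positivity
    R_le := by rw [div_le_one (by positivity)]; linarith
    d_ge := by linarith
    c_pos := by positivity
    lip := h.refl_lip
    isOpen := h.isOpen_dom
    preconn := h.isPreconnected_dom
    bdd := fun ζ hζ => hdom ζ hζ _ hy
    holo := h.holo_dom
    open₁ := h.open₁
    open₂ := h.open₂
    conv₁ := h.conv₁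
    conv₂ := h.conv₂
    src_mem := fun ζ hζ => by rw [h.srcPt_refl]; exact hζ
    tgt_mem := fun ζ hζ => by rw [h.tgtPt_refl]; exact h.tgt_mem hζ
    src_fr := fun ζ hζ => by rw [h.srcPt_refl]; exact h.src_frontier hζ
    tgt_fr := fun ζ hζ => by rw [h.tgtPt_refl]; exact h.tgt_frontier hζ
    y_mem := hy
    ball₁ := by rw [h.srcPt_refl, hp]; exact hG₁b u hu
    ball₂ := by rw [h.tgtPt_refl, hp, add_sub_cancel_left]; exact hG₂b _ hTu
    deriv_le := hder }⟩

end OTPot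

/-! ### Integration of local Lipschitz bounds -/

lemma norm_sub_le_of_eventually {f : ℝ → ℂ} {a b : ℝ} (hab : a ≤ b) (hf : ContinuousOn f (Icc a b))
    {B B' : ℝ → ℝ} (ha : 0 ≤ B a) (hB : ContinuousOn B (Icc a b))
    (hB' : ∀ x ∈ Ico a b, HasDerivAt B (B' x) x)
    (hL : ∀ x ∈ Ico a b, ∀ᶠ z in nhdsWithin x (Ioi x), ‖f z - f x‖ ≤ B' x * (z - x)) :
    ‖f b - f a‖ ≤ B b := by
  refine image_le_of_liminf_slope_right_le_deriv_boundary (f := fun x => ‖f x - f a‖)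
    (hf.sub continuousOn_const).norm (by simpa using ha) hB
    (fun x hx => (hB' x hx).hasDerivWithinAt) (fun x hx r hr => ?_) (right_mem_Icc.2 hab)
  refine Filter.Eventually.frequently ?_
  filter_upwards [hL x hx, self_mem_nhdsWithin] with z hz hxz
  have hxz : 0 < z - x := sub_pos.2 hxz
  rw [slope_def_field, div_lt_iff₀ hxz]
  have h1 : ‖f z - f a‖ ≤ ‖f z - f x‖ + ‖f x - f a‖ := norm_sub_le_norm_sub_add_norm_sub _ _ _
  nlinarith

lemma ball_lineMap_subset {U : Set ℂ} (hU : Convex ℝ U) {u z : ℂ} (hu : u ∈ U) {ρ t : ℝ}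
    (hz : ball z ρ ⊆ U) (ht : 0 < t) (ht1 : t ≤ 1) : ball (u + t • (z - u)) (t * ρ) ⊆ U := by
  intro p hp
  rw [mem_ball, dist_eq_norm] at hp
  have h1 : z + t⁻¹ • (p - (u + t • (z - u))) ∈ U := hz (by
    rw [mem_ball, dist_eq_norm, add_sub_cancel_left, norm_smul, norm_inv, Real.norm_of_nonneg ht.le,
      inv_mul_lt_iff₀ ht]
    exact hp)
  have h2 := hU hu h1 (by linarith : 0 ≤ 1 - t) ht.le (by ring)
  rw [smul_add, smul_smul, mul_inv_cancel₀ ht.ne', one_smul] at h2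
  convert h2 using 1
  simp only [Complex.real_smul]
  push_cast
  ring

namespace OTPot

variable {U₁ U₂ : Set ℂ} {ψ : ℂ → ℝ} {T : ℂ → ℂ} {R d c k r : ℝ} {y u : ℂ}

lemma add_mem_dom (h : OTPot U₁ U₂ ψ T) (hu : u ∈ U₁) : u + T u ∈ h.dom := by
  rw [h.dom_eq]
  exact mem_image_of_mem _ hu

lemma T_mem (h : OTPot U₁ U₂ ψ T) (hu : u ∈ U₁) : T u ∈ U₂ := by
  have := h.tgt_mem (h.add_mem_dom hu)
  rwa [h.prox_add hu, add_sub_cancel_left] at this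

lemma ball_subset_dom (h : OTPot U₁ U₂ ψ T) (hr : 0 < r) (hb : ball u r ⊆ U₁) :
    ball (u + T u) r ⊆ h.dom := fun q hq => hb (by
  rw [mem_ball, dist_eq_norm] at hq ⊢
  have := h.prox_lip q (u + T u)
  rw [h.prox_add (hb (mem_ball_self hr))] at this
  exact this.trans_lt hq)

lemma norm_T_sub_le (h : OTPot U₁ U₂ ψ T) (hD : OTData R d c h.refl h.dom U₁ U₂ y)
    (hr : 0 < r) (hb : ball u r ⊆ U₁) (hk0 : 0 < k) (hk : k ≤ 1 - ‖deriv h.refl (u + T u)‖)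
    {u' : ℂ} (hu' : u' ∈ U₁) (hlt : ‖u' - u‖ < k * r / 12) :
    ‖T u' - T u‖ ≤ 6 / k * ‖u' - u‖ := by
  have hu : u ∈ U₁ := hb (mem_ball_self hr)
  have h1 := hD.contract hr (h.ball_subset_dom hr hb) hk (u' + T u')
  have h2 := hD.tgt_lip (u' + T u') (u + T u)
  rw [h.tgtPt_refl, h.tgtPt_refl, h.prox_add hu, h.prox_add hu', add_sub_cancel_left,
    add_sub_cancel_left] at h2
  set n := ‖u' + T u' - (u + T u)‖ with hn
  have h3 : n - ‖h.refl (u' + T u') - h.refl (u + T u)‖ ≤ 2 * ‖u' - u‖ := by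
    have e : u' + T u' - (u + T u) =
        (2 : ℝ) • (u' - u) - conj (h.refl (u' + T u') - h.refl (u + T u)) := by
      simp only [refl, h.prox_add hu, h.prox_add hu', ← map_sub, Complex.conj_conj,
        Complex.real_smul]
      push_cast
      ring
    have := norm_sub_le ((2 : ℝ) • (u' - u)) (conj (h.refl (u' + T u') - h.refl (u + T u)))
    rw [← e, RCLike.norm_conj, norm_smul, Real.norm_ofNat] at this
    linarith
  have h4 : k / 3 * min n (r / 2) ≤ 2 * ‖u' - u‖ := by linarith
  rcases le_total n (r / 2) with h5 | h5
  · rw [min_eq_left h5] at h4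
    refine h2.trans ?_
    rw [div_mul_eq_mul_div, le_div_iff₀ hk0]
    linarith
  · rw [min_eq_right h5] at h4
    exfalso
    nlinarith

lemma eventually_norm_T_sub_le (h : OTPot U₁ U₂ ψ T) (hD : OTData R d c h.refl h.dom U₁ U₂ y)
    {p w : ℂ} {x : ℝ} (hr : 0 < r) (hb : ball (p + x • w) r ⊆ U₁) (hk0 : 0 < k)
    (hk : k ≤ 1 - ‖deriv h.refl (p + x • w + T (p + x • w))‖) :
    ∀ᶠ z in nhdsWithin x (Ioi x),
      ‖T (p + z • w) - T (p + x • w)‖ ≤ 6 / k * ‖w‖ * (z - x) := by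
  have hc : ContinuousAt (fun z : ℝ => p + z • w) x := by fun_prop
  have hev := (hc.eventually (ball_mem_nhds _ (by positivity : 0 < min r (k * r / 12)))).filter_mono
    (nhdsWithin_le_nhds (s := Ioi x))
  filter_upwards [hev, self_mem_nhdsWithin] with z hz hxz
  have hxz : 0 < z - x := sub_pos.2 hxz
  have e : ‖p + z • w - (p + x • w)‖ = (z - x) * ‖w‖ := by
    rw [add_sub_add_left_eq_sub, ← sub_smul, norm_smul, Real.norm_of_nonneg hxz.le]
  have hz' := mem_ball.1 hz
  rw [lt_min_iff] at hz'
  have := h.norm_T_sub_le hD hr hb hk0 hk (hb (mem_ball.2 hz'.1)) (by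
    rw [← dist_eq_norm]; exact hz'.2)
  rw [e] at this
  linarith

end OTPot

open OTPot in
/-- Interior Hölder estimate for the transport map on the complex plane. -/
theorem exists_holder_const {α d : ℝ} (hα : 0 < α) (hα1 : α < 1) (hd : 1 ≤ d) :
    ∃ C, 0 < C ∧ ∀ (U₁ U₂ : Set ℂ) (ψ : ℂ → ℝ) (T : ℂ → ℂ), OTPot U₁ U₂ ψ T →
      (∀ a ∈ U₁, ∀ b ∈ U₁, ‖a - b‖ ≤ d) → (∀ a ∈ U₂, ∀ b ∈ U₂, ‖a - b‖ ≤ d) →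
      ∀ u ∈ U₁, ∀ u' ∈ U₁, ‖T u - T u'‖ ≤ C * ‖u - u'‖ ^ α := by
  obtain ⟨c₀, hc₀, hlow⟩ := exists_deriv_lower (1 / (32 * d)) (2 * d) (1 / (128 * d ^ 2)) (1 - α)
    (by linarith) (by linarith)
  set ρ := 1 / (8 * d) with hρ
  have hρ0 : 0 < ρ := by positivity
  have hρ1 : ρ ≤ 1 := by rw [hρ, div_le_one (by positivity)]; linarith
  set K := 6 / (c₀ * ρ ^ (1 - α)) with hK
  have hK0 : 0 < K := by positivity
  refine ⟨2 * (K * d / α) + K + d, by positivity, fun U₁ U₂ ψ T h hd₁ hd₂ => ?_⟩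
  obtain ⟨y, hD⟩ := h.exists_otData hd hd₁ hd₂
  obtain ⟨z, hz⟩ := exists_ball_subset_of_convex h.open₁ h.conv₁ h.vol₁ hd hd₁
  have hzU : z ∈ U₁ := hz (mem_ball_self hρ0)
  have hloc : ∀ (p w : ℂ) (x t : ℝ), 0 < t → t ≤ 1 → ball (p + x • w) (t * ρ) ⊆ U₁ →
      ∀ᶠ s in nhdsWithin x (Ioi x),
        ‖T (p + s • w) - T (p + x • w)‖ ≤ K * t ^ (α - 1) * ‖w‖ * (s - x) := by
    intro p w x t ht ht1 hb
    have htρ : 0 < t * ρ := by positivity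
    have := h.eventually_norm_T_sub_le hD htρ hb (k := c₀ * (t * ρ) ^ (1 - α)) (by positivity)
      (hlow _ _ _ _ _ hD _ (h.add_mem_dom (hb (mem_ball_self htρ))) _ htρ
        (mul_le_one₀ ht1 hρ0.le hρ1) (h.ball_subset_dom htρ hb))
    rwa [show 6 / (c₀ * (t * ρ) ^ (1 - α)) = K * t ^ (α - 1) by
      rw [Real.mul_rpow ht.le hρ0.le, hK, show α - 1 = -(1 - α) by ring, Real.rpow_neg ht.le]
      field_simp] at this
  have hray : ∀ u ∈ U₁, ∀ b : ℝ, 0 < b → b ≤ 1 →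
      ‖T (u + b • (z - u)) - T u‖ ≤ K * d / α * b ^ α := by
    intro u hu b hb hb1
    have hmem : ∀ t : ℝ, 0 ≤ t → t ≤ 1 → u + t • (z - u) ∈ U₁ := fun t h0 h1 =>
      h.conv₁.add_smul_sub_mem hu hzU ⟨h0, h1⟩
    have hcont : ContinuousOn (fun t : ℝ => T (u + t • (z - u))) (Icc 0 1) :=
      h.T_cont.comp (by fun_prop) fun t ht => hmem t ht.1 ht.2
    have hpos : ∀ a ∈ Ioc 0 b, ‖T (u + b • (z - u)) - T (u + a • (z - u))‖ ≤ K * d / α * b ^ α := by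
      intro a ha
      refine norm_sub_le_of_eventually (f := fun t : ℝ => T (u + t • (z - u)))
        (B := fun t => K * d / α * t ^ α) (B' := fun t => K * t ^ (α - 1) * d) ha.2
        (hcont.mono (Icc_subset_Icc ha.1.le hb1)) (by have := ha.1; positivity)
        (continuousOn_const.mul (continuousOn_id.rpow_const fun _ _ => Or.inr hα.le))
        (fun x hx => ?_) (fun x hx => ?_)
      · have hx0 : 0 < x := ha.1.trans_le hx.1
        have := (Real.hasDerivAt_rpow_const (p := α) (Or.inl hx0.ne')).const_mul (K * d / α)
        rwa [show K * d / α * (α * x ^ (α - 1)) = K * x ^ (α - 1) * d by field_simp] at this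
      · have hx0 : 0 < x := ha.1.trans_le hx.1
        have hx1 : x ≤ 1 := hx.2.le.trans hb1
        filter_upwards [hloc u (z - u) x x hx0 hx1 (ball_lineMap_subset h.conv₁ hu hz hx0 hx1),
          self_mem_nhdsWithin] with s hs hxs
        refine hs.trans ?_
        have : 0 < s - x := sub_pos.2 hxs
        gcongr
        exact hd₁ z hzU u hu
    have hlim : Filter.Tendsto (fun a : ℝ => ‖T (u + b • (z - u)) - T (u + a • (z - u))‖)
        (nhdsWithin 0 (Ioc 0 b)) (nhds ‖T (u + b • (z - u)) - T (u + (0 : ℝ) • (z - u))‖) :=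
      (tendsto_const_nhds.sub ((hcont 0 ⟨le_rfl, zero_le_one⟩).mono fun a ha =>
        ⟨ha.1.le, ha.2.trans hb1⟩)).norm
    have hne : (nhdsWithin (0 : ℝ) (Ioc 0 b)).NeBot := by
      rw [← mem_closure_iff_nhdsWithin_neBot, closure_Ioc hb.ne]
      exact ⟨le_rfl, hb.le⟩
    simpa using le_of_tendsto hlim (Filter.eventually_of_mem self_mem_nhdsWithin hpos)
  intro u hu u' hu'
  set l := ‖u - u'‖ with hl
  rcases eq_or_ne u u' with rfl | hne
  · simp only [sub_self, norm_zero]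
    positivity
  have hl0 : 0 < l := norm_pos_iff.2 (sub_ne_zero.2 hne)
  have hlα : 0 < l ^ α := Real.rpow_pos_of_pos hl0 α
  have hnn : 0 ≤ K * d / α := by positivity
  rcases le_or_gt 1 l with h1 | h1
  · have h2 : ‖T u - T u'‖ ≤ d := hd₂ _ (h.T_mem hu) _ (h.T_mem hu')
    have h3 : 1 ≤ l ^ α := Real.one_le_rpow h1 hα.le
    nlinarith
  · have ha := hray u hu l hl0 h1.le
    have hb := hray u' hu' l hl0 h1.le
    set p := u + l • (z - u) with hp
    set p' := u' + l • (z - u') with hp'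
    have hball : ∀ t : ℝ, 0 ≤ t → t ≤ 1 → ball (p' + t • (p - p')) (l * ρ) ⊆ U₁ := by
      intro t h0 ht1
      have := ball_lineMap_subset h.conv₁ (h.conv₁.add_smul_sub_mem hu' hu ⟨h0, ht1⟩) hz hl0 h1.le
      convert this using 2
      rw [hp, hp']
      simp only [Complex.real_smul]
      ring
    have hw : ‖p - p'‖ ≤ l := by
      have : p - p' = (1 - l) • (u - u') := by
        rw [hp, hp']
        simp only [Complex.real_smul]
        push_cast
        ring
      rw [this, norm_smul, Real.norm_of_nonneg (by linarith)]
      nlinarith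
    have hmid := norm_sub_le_of_eventually (f := fun t : ℝ => T (p' + t • (p - p')))
      (B := fun t => K * l ^ α * t) (B' := fun _ => K * l ^ α) zero_le_one
      (h.T_cont.comp (by fun_prop) fun t ht =>
        hball t ht.1 ht.2 (mem_ball_self (by positivity))) (by simp) (by fun_prop)
      (fun x _ => by simpa using (hasDerivAt_id x).const_mul (K * l ^ α)) (fun x hx => by
        filter_upwards [hloc p' (p - p') x l hl0 h1.le (hball x hx.1 hx.2.le),
          self_mem_nhdsWithin] with s hs hxs
        refine hs.trans ?_
        have : 0 < s - x := sub_pos.2 hxs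
        rw [show K * l ^ α = K * l ^ (α - 1) * l by
          rw [mul_assoc, ← Real.rpow_add_one hl0.ne', sub_add_cancel]]
        gcongr)
    simp only [one_smul, zero_smul, add_zero, add_sub_cancel, mul_one] at hmid
    have e : T u - T u' = -(T p - T u) + (T p - T p') + (T p' - T u') := by ring
    have h2 : ‖T u - T u'‖ ≤ ‖T p - T u‖ + ‖T p - T p'‖ + ‖T p' - T u'‖ := by
      rw [e]
      refine (norm_add_le _ _).trans (add_le_add_left ((norm_add_le _ _).trans ?_) _)
      rw [norm_neg]
    nlinarith

/-! ### From the Euclidean plane to the complex plane -/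

lemma ConvexOn.exists_differentiableAt {ψ : R2 → ℝ} (hψ : ConvexOn ℝ univ ψ) {O : Set R2}
    (hO : IsOpen O) (hne : O.Nonempty) : ∃ x ∈ O, DifferentiableAt ℝ ψ x := by
  obtain ⟨x, hx⟩ := hne
  obtain ⟨K, t, ht, hK⟩ := hψ.locallyLipschitz x
  set V := O ∩ interior t with hV
  have hVo : IsOpen V := hO.inter isOpen_interior
  have hxV : x ∈ V := ⟨hx, mem_interior_iff_mem_nhds.2 ht⟩
  have hae := (hK.mono (inter_subset_right.trans interior_subset :
    V ⊆ t)).ae_differentiableWithinAt_of_mem (μ := volume)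
  by_contra! hcon
  refine (hVo.measure_pos volume ⟨x, hxV⟩).ne' (measure_mono_null (fun z hz => ?_) hae)
  exact fun hd => hcon z hz.1 ((hd hz).differentiableAt (hVo.mem_nhds hz))

lemma ConvexOn.subgradAt_gradient {ψ : R2 → ℝ} (hψ : ConvexOn ℝ univ ψ) {x : R2}
    (hd : DifferentiableAt ℝ ψ x) : SubgradAt ψ x (gradient ψ x) := by
  intro y
  have hconv : ConvexOn ℝ univ (fun t : ℝ => ψ (AffineMap.lineMap x y t)) :=
    hψ.comp_affineMap (AffineMap.lineMap x y)
  have hder : HasDerivAt (fun t : ℝ => ψ (AffineMap.lineMap x y t)) ⟪gradient ψ x, y - x⟫ 0 := by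
    have h1 : HasFDerivAt ψ (InnerProductSpace.toDual ℝ R2 (gradient ψ x))
        (AffineMap.lineMap x y (0 : ℝ)) := by
      simpa using hd.hasGradientAt.hasFDerivAt
    exact h1.comp_hasDerivAt 0 AffineMap.hasDerivAt_lineMap
  have := hconv.le_slope_of_hasDerivAt (mem_univ 0) (mem_univ 1) zero_lt_one hder
  rw [slope_def_field] at this
  simp only [AffineMap.lineMap_apply_one, AffineMap.lineMap_apply_zero, sub_zero, div_one] at this
  linarith

lemma ConvexOn.subgradAt_of_continuousOn {ψ : R2 → ℝ} (hψ : ConvexOn ℝ univ ψ) {U : Set R2}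
    (hU : IsOpen U) {T : R2 → R2} (hT : ContinuousOn T U) (hg : ∀ x ∈ U, T x = gradient ψ x)
    {x : R2} (hx : x ∈ U) : SubgradAt ψ x (T x) := by
  intro y
  by_contra! hlt
  have hc : ContinuousOn (fun z => ψ z + ⟪T z, y - z⟫) U :=
    hψ.locallyLipschitz.continuous.continuousOn.add
      (hT.inner (continuousOn_const.sub continuousOn_id))
  obtain ⟨z, ⟨hzU, hz⟩, hd⟩ := hψ.exists_differentiableAt
    (hc.isOpen_inter_preimage hU isOpen_Ioi) ⟨x, hx, hlt⟩
  have := hψ.subgradAt_gradient hd y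
  rw [← hg z hzU] at this
  exact absurd hz (not_lt.2 this)

/-- The standard isometry from the complex plane to the Euclidean plane. -/
abbrev complexIsometry : ℂ ≃ₗᵢ[ℝ] R2 := Complex.orthonormalBasisOneI.repr

lemma volume_preimage_complexIsometry (S : Set R2) :
    volume (complexIsometry ⁻¹' S) = volume S :=
  complexIsometry.measurePreserving.measure_preimage_equiv (f := complexIsometry.toMeasurableEquiv) S

lemma IsOTPotential.otPot {U₁ U₂ : Set R2} {ψ : R2 → ℝ} {T : R2 → R2} (h : IsOTPotential U₁ U₂ ψ)
    (ho₁ : IsOpen U₁) (ho₂ : IsOpen U₂) (hc₁ : Convex ℝ U₁) (hc₂ : Convex ℝ U₂)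
    (hb₁ : Bornology.IsBounded U₁) (hb₂ : Bornology.IsBounded U₂) (hv₁ : volume U₁ = 1)
    (hv₂ : volume U₂ = 1) (hT : ContinuousOn T U₁) (hg : ∀ x ∈ U₁, T x = gradient ψ x) :
    OTPot (complexIsometry ⁻¹' U₁) (complexIsometry ⁻¹' U₂) (fun z => ψ (complexIsometry z))
      (fun z => complexIsometry.symm (T (complexIsometry z))) := by
  set e := complexIsometry with he
  have hinner : ∀ p z : ℂ, ⟪e p, e z⟫ = ⟪p, z⟫ := e.inner_map_map
  exact {
    open₁ := ho₁.preimage e.continuous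
    open₂ := ho₂.preimage e.continuous
    conv₁ := hc₁.linear_preimage e.toLinearEquiv.toLinearMap
    conv₂ := hc₂.linear_preimage e.toLinearEquiv.toLinearMap
    bdd₁ := e.antilipschitz.isBounded_preimage hb₁
    bdd₂ := e.antilipschitz.isBounded_preimage hb₂
    vol₁ := by rw [volume_preimage_complexIsometry, hv₁]
    vol₂ := by rw [volume_preimage_complexIsometry, hv₂]
    cont := h.1.locallyLipschitz.continuous.comp e.continuous
    cvx := h.1.comp_linearMap e.toLinearEquiv.toLinearMap
    sub_mem := fun x p hp => by
      have := h.2.1 (e x) (e p) fun y => by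
        have := hp (e.symm y)
        rwa [← hinner, map_sub, e.apply_symm_apply] at this
      exact (e.toHomeomorph.preimage_closure U₂).subset this
    T_cont := e.symm.continuous.comp_continuousOn
      (hT.comp e.continuous.continuousOn fun _ hz => hz)
    T_sub := fun x hx y => by
      have := h.1.subgradAt_of_continuousOn ho₁ hT hg hx (e y)
      rwa [← hinner, map_sub, e.apply_symm_apply]
    map_eq := fun B hB => by
      have hB' : MeasurableSet (e.symm ⁻¹' B) := e.symm.continuous.measurable hB
      have hm : AEMeasurable (fun x => gradient ψ x) (volume.restrict U₁) :=
        (hT.aemeasurable ho₁.measurableSet).congr (by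
          filter_upwards [ae_restrict_mem ho₁.measurableSet] with x hx using hg x hx)
      have h1 := congrArg (fun μ => μ (e.symm ⁻¹' B)) h.2.2
      simp only [Measure.map_apply_of_aemeasurable hm hB', Measure.restrict_apply hB'] at h1
      rw [Measure.restrict_apply' ho₁.measurableSet] at h1
      have e1 : (fun x => gradient ψ x) ⁻¹' (e.symm ⁻¹' B) ∩ U₁ = U₁ ∩ T ⁻¹' (e.symm ⁻¹' B) := by
        ext x
        constructor
        · rintro ⟨hx, hxU⟩
          exact ⟨hxU, by simpa only [mem_preimage, hg x hxU] using hx⟩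
        · rintro ⟨hxU, hx⟩
          exact ⟨by simpa only [mem_preimage, hg x hxU] using hx, hxU⟩
      rw [e1, ← volume_preimage_complexIsometry, ← volume_preimage_complexIsometry (_ ∩ U₂)] at h1
      simpa only [preimage_inter, preimage_preimage, ← he, e.symm_apply_apply, preimage_id']
        using h1 }

/-- global Hölder regularity of the optimal transport map: for every
`α ∈ (0,1)` there is `C`, depending only on `α` and the diameters of the domains, such that
the continuous extension `T` of `∇ψ` to `closure U₁` satisfies
`‖T x - T y‖ ≤ C ‖x - y‖^α` for all `x, y ∈ closure U₁`. -/
theorem stmt_19 :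
    ∀ α : ℝ, 0 < α → α < 1 → ∀ d₁ d₂ : ℝ, ∃ C : ℝ, 0 < C ∧
      ∀ (U₁ U₂ : Set R2) (ψ : R2 → ℝ) (T : R2 → R2),
        IsOpen U₁ → IsOpen U₂ → Convex ℝ U₁ → Convex ℝ U₂ →
        Bornology.IsBounded U₁ → Bornology.IsBounded U₂ →
        MeasureTheory.volume U₁ = 1 → MeasureTheory.volume U₂ = 1 →
        Metric.diam U₁ = d₁ → Metric.diam U₂ = d₂ →
        IsOTPotential U₁ U₂ ψ →
        ContinuousOn T (closure U₁) → (∀ x ∈ U₁, T x = gradient ψ x) →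
        ∀ x ∈ closure U₁, ∀ y ∈ closure U₁,
          ‖T x - T y‖ ≤ C * ‖x - y‖ ^ α := by
  intro α hα hα1 d₁ d₂
  obtain ⟨C, hC, hmain⟩ := exists_holder_const hα hα1 (d := |d₁| + |d₂| + 1)
    (by linarith [abs_nonneg d₁, abs_nonneg d₂])
  refine ⟨C, hC, fun U₁ U₂ ψ T ho₁ ho₂ hc₁ hc₂ hb₁ hb₂ hv₁ hv₂ hd₁ hd₂ hψ hT hg x hx y hy => ?_⟩
  set e := complexIsometry with he
  have hdist : ∀ {U : Set R2} {δ : ℝ}, Bornology.IsBounded U → diam U = δ →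
      ∀ a ∈ e ⁻¹' U, ∀ b ∈ e ⁻¹' U, ‖a - b‖ ≤ |δ| := by
    intro U δ hb hδ a ha b hb'
    rw [← e.norm_map, map_sub, ← dist_eq_norm, ← hδ]
    exact (dist_le_diam_of_mem hb ha hb').trans (le_abs_self _)
  have hin : ∀ p ∈ U₁ ×ˢ U₁, ‖T p.1 - T p.2‖ ≤ C * ‖p.1 - p.2‖ ^ α := by
    rintro ⟨a, b⟩ ⟨ha, hb⟩
    have := hmain _ _ _ _
      (hψ.otPot ho₁ ho₂ hc₁ hc₂ hb₁ hb₂ hv₁ hv₂ (hT.mono subset_closure) hg)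
      (fun a ha b hb => (hdist hb₁ hd₁ a ha b hb).trans (by linarith [abs_nonneg d₂]))
      (fun a ha b hb => (hdist hb₂ hd₂ a ha b hb).trans (by linarith [abs_nonneg d₁]))
      (e.symm a) (by rwa [mem_preimage, ← he, e.apply_symm_apply]) (e.symm b) (by rwa [mem_preimage, ← he, e.apply_symm_apply])
    simpa only [← he, ← map_sub, e.symm.norm_map, e.apply_symm_apply] using this
  have hcl : closure (U₁ ×ˢ U₁) = closure U₁ ×ˢ closure U₁ := closure_prod_eq
  refine le_on_closure hin ?_ ?_ (x := (x, y)) (by rw [hcl]; exact ⟨hx, hy⟩)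
  · rw [hcl]
    exact ((hT.comp continuousOn_fst fun p hp => hp.1).sub
      (hT.comp continuousOn_snd fun p hp => hp.2)).norm
  · exact (continuousOn_const.mul ((continuous_fst.sub continuous_snd).norm.continuousOn.rpow_const
      fun _ _ => Or.inr hα.le))
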